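/- arXiv:2409.08818 — 11 statements merged into one kernel-verified Lean document; each statement's English description precedes it below -/
import Mathlib

section
/- Let n ≥ 3 be an integer and let a, c be real numbers with 0 ≤ a ≤ (n−2)/(4(n−1)) and c ≥ 0. Let I ⊆ ℝ be an open interval and ρ : ℝ → ℝ be continuously differentiable with ρ(r) > 0 for all r ∈ I. Then for every continuously differentiable f : ℝ → ℝ with compact support contained in I, one has ∫_I [ f'(r)² ρ(r)^{n−1} + a(n−1)(n−2) ρ'(r)² ρ(r)^{n−3} f(r)² + 4a(n−1) ρ'(r) ρ(r)^{n−2} f(r) f'(r) + a·c·ρ(r)^{n−3} f(r)² ] dr ≥ 0. -/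
open MeasureTheory Filter Set

/-- Radial-test-function core of Theorem 3.1: for `0 ≤ a ≤ (n-2)/(4(n-1))` and `c ≥ 0`,
the radial stability form of the warped product `I ×_ρ F` is nonnegative. -/
theorem stmt_0 (n : ℕ) (hn : 3 ≤ n) (a c : ℝ)
    (ha0 : 0 ≤ a) (ha1 : a ≤ ((n : ℝ) - 2) / (4 * ((n : ℝ) - 1))) (hc : 0 ≤ c)
    (I : Set ℝ) (hIopen : IsOpen I) (hIconn : I.OrdConnected)
    (ρ : ℝ → ℝ) (hρ : ContDiff ℝ 1 ρ) (hρpos : ∀ r ∈ I, 0 < ρ r)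
    (f : ℝ → ℝ) (hf : ContDiff ℝ 1 f) (hfc : HasCompactSupport f)
    (hfs : tsupport f ⊆ I) :
    0 ≤ ∫ r in I, ((deriv f r) ^ 2 * (ρ r) ^ (n - 1)
      + a * ((n : ℝ) - 1) * ((n : ℝ) - 2) * (deriv ρ r) ^ 2 * (ρ r) ^ (n - 3) * (f r) ^ 2
      + 4 * a * ((n : ℝ) - 1) * (deriv ρ r) * (ρ r) ^ (n - 2) * (f r) * (deriv f r)
      + a * c * (ρ r) ^ (n - 3) * (f r) ^ 2) := by
  apply setIntegral_nonneg hIopen.measurableSet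
  intro r hr
  have hp := hρpos r hr
  obtain ⟨k, rfl⟩ : ∃ k, n = k + 3 := ⟨n - 3, by omega⟩
  have e1 : k + 3 - 1 = k + 2 := by omega
  have e2 : k + 3 - 2 = k + 1 := by omega
  have e3 : k + 3 - 3 = k := by omega
  rw [e1, e2, e3]
  push_cast at ha1 ⊢
  have hk : (0 : ℝ) ≤ k := Nat.cast_nonneg k
  rw [le_div_iff₀ (by linarith)] at ha1
  have hd : 0 ≤ ((k : ℝ) + 3 - 2) - a * (4 * ((k : ℝ) + 3 - 1)) := by linarith
  have hm : 0 ≤ (k : ℝ) + 3 - 1 := by linarith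
  have hpk : 0 ≤ ρ r ^ k := pow_nonneg hp.le k
  have key : 0 ≤ ρ r ^ k * ((deriv f r * ρ r + 2 * a * ((k : ℝ) + 3 - 1) * (deriv ρ r * f r)) ^ 2
      + a * ((k : ℝ) + 3 - 1) * (((k : ℝ) + 3 - 2) - a * (4 * ((k : ℝ) + 3 - 1)))
        * (deriv ρ r * f r) ^ 2 + a * c * f r ^ 2) := by
    positivity
  refine key.trans_eq ?_
  ring
end

section
/- Let n ≥ 3 be an integer, C > 0 a real number, and a a real number with 0 ≤ a ≤ (C²+1)(n−2)/(4C²(n−1)). Let I ⊆ ℝ be an open interval and ρ : ℝ → ℝ be continuously differentiable with ρ(r) > 0 and |ρ'(r)| ≤ C for all r ∈ I. Then for every continuously differentiable f : ℝ → ℝ with compact support contained in I, one has ∫_I [ f'(r)² ρ(r)^{n−1} + a(n−1)(n−2)(ρ'(r)² + 1) ρ(r)^{n−3} f(r)² + 4a(n−1) ρ'(r) ρ(r)^{n−2} f(r) f'(r) ] dr ≥ 0. -/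
open MeasureTheory Filter Set

/-- Radial-test-function core of the theorem: a warped product `I ×_ρ 𝕊^{n-1}` with
`|ρ'| ≤ C` is `a`-stable for all `0 ≤ a ≤ (C²+1)(n-2)/(4C²(n-1))`. -/
theorem stmt_1 (n : ℕ) (hn : 3 ≤ n) (C a : ℝ) (hC : 0 < C)
    (ha0 : 0 ≤ a) (ha1 : a ≤ (C ^ 2 + 1) * ((n : ℝ) - 2) / (4 * C ^ 2 * ((n : ℝ) - 1)))
    (I : Set ℝ) (hIopen : IsOpen I) (hIconn : I.OrdConnected)
    (ρ : ℝ → ℝ) (hρ : ContDiff ℝ 1 ρ) (hρpos : ∀ r ∈ I, 0 < ρ r)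
    (hρ' : ∀ r ∈ I, |deriv ρ r| ≤ C)
    (f : ℝ → ℝ) (hf : ContDiff ℝ 1 f) (hfc : HasCompactSupport f)
    (hfs : tsupport f ⊆ I) :
    0 ≤ ∫ r in I, ((deriv f r) ^ 2 * (ρ r) ^ (n - 1)
      + a * ((n : ℝ) - 1) * ((n : ℝ) - 2) * ((deriv ρ r) ^ 2 + 1) * (ρ r) ^ (n - 3) * (f r) ^ 2
      + 4 * a * ((n : ℝ) - 1) * (deriv ρ r) * (ρ r) ^ (n - 2) * (f r) * (deriv f r)) := by
  refine setIntegral_nonneg hIopen.measurableSet fun r hr => ?_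
  have hρr := hρpos r hr
  have hp := hρ' r hr
  obtain ⟨m, rfl⟩ : ∃ m, n = m + 3 := ⟨n - 3, by omega⟩
  have e1 : m + 3 - 1 = m + 2 := by omega
  have e2 : m + 3 - 2 = m + 1 := by omega
  have e3 : m + 3 - 3 = m := by omega
  rw [e1, e2, e3]
  push_cast at ha1 ⊢
  have hm : (0 : ℝ) ≤ m := Nat.cast_nonneg m
  generalize (m : ℝ) = k at ha1 hm ⊢
  generalize deriv ρ r = p at hp ⊢
  generalize deriv f r = g
  generalize f r = y
  generalize ρ r = t at hρr ⊢
  have hp2 : p ^ 2 ≤ C ^ 2 := sq_le_sq' (abs_le.mp hp).1 (abs_le.mp hp).2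
  have hC2 : 0 < C ^ 2 := by positivity
  have h1 : a * (4 * C ^ 2 * (k + 2)) ≤ (C ^ 2 + 1) * (k + 1) := by
    rw [le_div_iff₀ (mul_pos (by positivity) (by linarith))] at ha1
    linarith
  have h2 : 4 * a * (k + 2) * p ^ 2 ≤ (k + 1) * (p ^ 2 + 1) := by
    have h3 : C ^ 2 * (4 * a * (k + 2) * p ^ 2) ≤ C ^ 2 * ((k + 1) * (p ^ 2 + 1)) := by
      have := mul_le_mul_of_nonneg_right h1 (sq_nonneg p)
      have := mul_le_mul_of_nonneg_left hp2 (by linarith : 0 ≤ k + 1)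
      linarith
    exact le_of_mul_le_mul_left h3 hC2
  have h4 : 0 ≤ a * (k + 2) * y ^ 2 := by positivity
  have h5 := mul_le_mul_of_nonneg_left h2 h4
  have h6 := sq_nonneg (g * t + 2 * a * (k + 2) * p * y)
  have h7 : 0 ≤ t ^ m * ((g * t) ^ 2 + a * (k + 2) * (k + 1) * (p ^ 2 + 1) * y ^ 2
      + 4 * a * (k + 2) * p * y * (g * t)) :=
    mul_nonneg (by positivity) (by linarith)
  refine h7.trans_eq ?_
  ring
end

section
/- Let n ≥ 3 be an integer, α > 1 a real number, and a a real number with 0 ≤ a ≤ (nα−α−1)²/(4α(n−1)(nα−2)). Then for every continuously differentiable f : ℝ → ℝ with compact support, ∫_0^∞ f'(r)² r^{nα−α} dr − aα(n−1)(nα−2) ∫_0^∞ r^{nα−α−2} f(r)² dr + a(n−1)(n−2)(α+1)² ∫_0^∞ r^{nα−3α} f(r)² dr ≥ 0. -/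
open MeasureTheory Filter Set

theorem hardy_aux (p : ℝ) (hp : 2 < p) (f : ℝ → ℝ) (hf : ContDiff ℝ 1 f)
    (hfc : HasCompactSupport f) :
    ((p - 1) / 2) ^ 2 * (∫ r in Set.Ioi (0 : ℝ), r ^ (p - 2) * (f r) ^ 2)
      ≤ ∫ r in Set.Ioi (0 : ℝ), (deriv f r) ^ 2 * r ^ p := by
  have hcf : Continuous f := hf.continuous
  have hcd : Continuous (deriv f) := hf.continuous_deriv le_rfl
  have hc (q : ℝ) (hq : 0 ≤ q) : Continuous (fun r : ℝ => r ^ q) :=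
    Real.continuous_rpow_const hq
  have hfd : HasCompactSupport (deriv f) := hfc.deriv
  have i1 : Integrable (fun r : ℝ => r ^ (p - 2) * (f r) ^ 2) := by
    apply Continuous.integrable_of_hasCompactSupport
    · exact (hc _ (by linarith)).mul (hcf.pow 2)
    · have : HasCompactSupport (fun r => f r ^ 2) := hfc.comp_left (g := fun x => x ^ 2) (by simp)
      exact this.mul_left
  have i2 : Integrable (fun r : ℝ => (deriv f r) ^ 2 * r ^ p) := by
    apply Continuous.integrable_of_hasCompactSupport
    · exact (hcd.pow 2).mul (hc _ (by linarith))
    · have : HasCompactSupport (fun r => deriv f r ^ 2) :=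
        hfd.comp_left (g := fun x => x ^ 2) (by simp)
      exact this.mul_right
  have i3 : Integrable (fun r : ℝ => f r * (2 * deriv f r * r ^ (p - 1))) := by
    apply Continuous.integrable_of_hasCompactSupport
    · exact hcf.mul ((continuous_const.mul hcd).mul (hc _ (by linarith)))
    · exact hfc.mul_right
  have hs : HasCompactSupport (fun r : ℝ => f r * (f r * r ^ (p - 1))) := hfc.mul_right
  have key : ∫ r in Set.Ioi (0 : ℝ),
      (f r * (2 * deriv f r * r ^ (p - 1)) + (p - 1) * (r ^ (p - 2) * (f r) ^ 2)) = 0 := by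
    have h0 : (0 : ℝ) = 0 - (fun r : ℝ => f r * (f r * r ^ (p - 1))) 0 := by
      simp [Real.zero_rpow (show p - 1 ≠ 0 by linarith)]
    refine Eq.trans (integral_Ioi_of_hasDerivAt_of_tendsto
      (f := fun r : ℝ => f r * (f r * r ^ (p - 1))) (m := 0) ?_ ?_ ?_ ?_) h0.symm
    · exact (hcf.mul (hcf.mul (hc _ (by linarith)))).continuousWithinAt
    · intro x hx
      have hx' : (0 : ℝ) < x := hx
      have d1 : HasDerivAt f (deriv f x) x :=
        (hf.differentiable (by norm_num) x).hasDerivAt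
      have d2 := Real.hasDerivAt_rpow_const (x := x) (p := p - 1) (Or.inl hx'.ne')
      refine HasDerivAt.congr_deriv (d1.mul (d1.mul d2)) ?_
      rw [show p - 1 - 1 = p - 2 by ring]
      ring
    · exact (i3.add (i1.const_mul _)).integrableOn
    · exact (hs.is_zero_at_infty).mono_left atTop_le_cocompact
  have hnn : 0 ≤ ∫ r in Set.Ioi (0 : ℝ), ((deriv f r) ^ 2 * r ^ p
      + ((p - 1) / 2) * (f r * (2 * deriv f r * r ^ (p - 1)))
      + ((p - 1) / 2) ^ 2 * (r ^ (p - 2) * (f r) ^ 2)) := by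
    apply setIntegral_nonneg measurableSet_Ioi
    intro r hr
    have hr' : (0 : ℝ) < r := hr
    have e1 : r ^ p = r ^ (p - 2) * r ^ 2 := by
      rw [← Real.rpow_natCast, ← Real.rpow_add hr']; norm_num
    have e2 : r ^ (p - 1) = r ^ (p - 2) * r := by
      rw [← Real.rpow_add_one hr'.ne']; ring_nf
    rw [e1, e2]
    have := Real.rpow_nonneg hr'.le (p - 2)
    have := mul_nonneg this (sq_nonneg (deriv f r * r + (p - 1) / 2 * f r))
    linarith
  have j1 := i1.integrableOn (s := Set.Ioi (0 : ℝ))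
  have j2 := i2.integrableOn (s := Set.Ioi (0 : ℝ))
  have j3 := i3.integrableOn (s := Set.Ioi (0 : ℝ))
  rw [integral_add j3 (j1.const_mul _), integral_const_mul] at key
  have j4 : IntegrableOn (fun r : ℝ => (deriv f r) ^ 2 * r ^ p
      + ((p - 1) / 2) * (f r * (2 * deriv f r * r ^ (p - 1)))) (Set.Ioi 0) :=
    j2.add (j3.const_mul _)
  rw [integral_add j4 (j1.const_mul _),
    integral_add j2 (j3.const_mul _), integral_const_mul, integral_const_mul] at hnn
  have k2 := eq_neg_of_add_eq_zero_left key
  rw [k2] at hnn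
  linarith

/-- Sharpness of the instability threshold: for the warped product
`[0,∞) ×_ρ 𝕊^{n-1}` with `ρ(r) = r^α/(α+1)`, the radial stability form is
nonnegative whenever `0 ≤ a ≤ (nα-α-1)²/(4α(n-1)(nα-2))`. -/
theorem stmt_3 (n : ℕ) (hn : 3 ≤ n) (α a : ℝ) (hα : 1 < α)
    (ha0 : 0 ≤ a)
    (ha1 : a ≤ ((n : ℝ) * α - α - 1) ^ 2 / (4 * α * ((n : ℝ) - 1) * ((n : ℝ) * α - 2)))
    (f : ℝ → ℝ) (hf : ContDiff ℝ 1 f) (hfc : HasCompactSupport f) :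
    0 ≤ (∫ r in Set.Ioi (0 : ℝ), (deriv f r) ^ 2 * r ^ ((n : ℝ) * α - α))
      - a * α * ((n : ℝ) - 1) * ((n : ℝ) * α - 2)
        * (∫ r in Set.Ioi (0 : ℝ), r ^ ((n : ℝ) * α - α - 2) * (f r) ^ 2)
      + a * ((n : ℝ) - 1) * ((n : ℝ) - 2) * (α + 1) ^ 2
        * (∫ r in Set.Ioi (0 : ℝ), r ^ ((n : ℝ) * α - 3 * α) * (f r) ^ 2) := by
  have hn' : (3 : ℝ) ≤ n := by exact_mod_cast hn
  have hp : 2 < (n : ℝ) * α - α := by nlinarith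
  have H := hardy_aux _ hp f hf hfc
  have hden : 0 < 4 * α * ((n : ℝ) - 1) * ((n : ℝ) * α - 2) :=
    mul_pos (mul_pos (by linarith) (by linarith)) (by linarith)
  rw [le_div_iff₀ hden] at ha1
  have hI : 0 ≤ ∫ r in Set.Ioi (0 : ℝ), r ^ ((n : ℝ) * α - α - 2) * (f r) ^ 2 :=
    setIntegral_nonneg measurableSet_Ioi fun r hr =>
      mul_nonneg (Real.rpow_nonneg (le_of_lt hr) _) (sq_nonneg _)
  have hJ : 0 ≤ ∫ r in Set.Ioi (0 : ℝ), r ^ ((n : ℝ) * α - 3 * α) * (f r) ^ 2 :=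
    setIntegral_nonneg measurableSet_Ioi fun r hr =>
      mul_nonneg (Real.rpow_nonneg (le_of_lt hr) _) (sq_nonneg _)
  have hK : 0 ≤ a * ((n : ℝ) - 1) * ((n : ℝ) - 2) * (α + 1) ^ 2 :=
    mul_nonneg (mul_nonneg (mul_nonneg ha0 (by linarith)) (by linarith)) (sq_nonneg _)
  have h3 := mul_nonneg hK hJ
  have hle : a * α * ((n : ℝ) - 1) * ((n : ℝ) * α - 2) ≤ (((n : ℝ) * α - α - 1) / 2) ^ 2 := by
    linarith
  have h4 := mul_le_mul_of_nonneg_right hle hI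
  linarith
end

section
/- Let n ≥ 3 be an integer and c a real number. Let ρ : ℝ → ℝ be twice continuously differentiable with ρ(0) = 0, ρ(r) > 0 and ρ''(r) > 0 for all r > 0. Assume that either lim_{r→∞} ρ'(r) = ∞, or c ≤ 0. Then for every real a > (n−1)/(4n) and every R₀ > 0 there exists a Lipschitz function f : ℝ → ℝ with compact support contained in (R₀, ∞) such that ∫_0^∞ [ f'(r)² ρ(r)^{n−1} + a(n−1)(n−2) ρ'(r)² ρ(r)^{n−3} f(r)² + 4a(n−1) ρ'(r) ρ(r)^{n−2} f(r) f'(r) + a·c·ρ(r)^{n−3} f(r)² ] dr < 0, where f' denotes the almost-everywhere derivative of f. -/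
open MeasureTheory Filter Set

lemma clamp_lip (G G' : ℝ → ℝ) (x y : ℝ) (hxy : x ≤ y)
    (hd : ∀ r ∈ Icc x y, HasDerivAt G (G' r) r) (hc : ContinuousOn G' (Icc x y)) :
    ∃ K, LipschitzWith K (fun r => G (max x (min y r))) := by
  obtain ⟨C, hC⟩ := isCompact_Icc.exists_bound_of_continuousOn hc
  have hl : LipschitzOnWith (Real.toNNReal C) G (Icc x y) := by
    apply (convex_Icc x y).lipschitzOnWith_of_nnnorm_hasDerivWithin_le
      (fun r hr => (hd r hr).hasDerivWithinAt)
    intro r hr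
    rw [← NNReal.coe_le_coe, coe_nnnorm]
    exact (hC r hr).trans (Real.le_coe_toNNReal C)
  refine ⟨Real.toNNReal C, LipschitzWith.of_dist_le_mul fun r s => ?_⟩
  have hm : ∀ r, max x (min y r) ∈ Icc x y := fun r =>
    ⟨le_max_left _ _, max_le hxy (min_le_left _ _)⟩
  refine (hl.dist_le_mul _ (hm r) _ (hm s)).trans ?_
  gcongr
  have h1 : LipschitzWith 1 (fun r : ℝ => max x (min y r)) :=
    (LipschitzWith.id.const_min y).const_max x
  simpa using h1.dist_le_mul r s

lemma glue (Φ : ℝ → ℝ → ℝ → ℝ) (hΦ : Continuous fun p : ℝ × ℝ × ℝ => Φ p.1 p.2.1 p.2.2)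
    (hΦ0 : ∀ r, Φ r 0 0 = 0)
    (G₁ G₁' G₂ G₂' G₃ G₃' : ℝ → ℝ) (r₀ r₁ r₂ r₃ R₀ : ℝ) (hR : 0 < R₀)
    (h0 : R₀ < r₀) (h1 : r₀ < r₁) (h2 : r₁ < r₂) (h3 : r₂ < r₃)
    (hd₁ : ∀ r ∈ Icc r₀ r₁, HasDerivAt G₁ (G₁' r) r) (hc₁ : ContinuousOn G₁' (Icc r₀ r₁))
    (hd₂ : ∀ r ∈ Icc r₁ r₂, HasDerivAt G₂ (G₂' r) r) (hc₂ : ContinuousOn G₂' (Icc r₁ r₂))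
    (hd₃ : ∀ r ∈ Icc r₂ r₃, HasDerivAt G₃ (G₃' r) r) (hc₃ : ContinuousOn G₃' (Icc r₂ r₃))
    (e0 : G₁ r₀ = 0) (e1 : G₁ r₁ = G₂ r₁) (e2 : G₂ r₂ = G₃ r₂) (e3 : G₃ r₃ = 0)
    (hneg : (∫ r in r₀..r₁, Φ r (G₁ r) (G₁' r)) + (∫ r in r₁..r₂, Φ r (G₂ r) (G₂' r))
      + (∫ r in r₂..r₃, Φ r (G₃ r) (G₃' r)) < 0) :
    ∃ f : ℝ → ℝ, (∃ K, LipschitzWith K f) ∧ HasCompactSupport f ∧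
      tsupport f ⊆ Set.Ioi R₀ ∧ (∫ r in Set.Ioi (0 : ℝ), Φ r (f r) (deriv f r)) < 0 := by
  obtain ⟨K₁, hK₁⟩ := clamp_lip G₁ G₁' r₀ r₁ h1.le hd₁ hc₁
  obtain ⟨K₂, hK₂⟩ := clamp_lip G₂ G₂' r₁ r₂ h2.le hd₂ hc₂
  obtain ⟨K₃, hK₃⟩ := clamp_lip G₃ G₃' r₂ r₃ h3.le hd₃ hc₃
  set f : ℝ → ℝ := fun r => (G₁ (max r₀ (min r₁ r)) + (G₂ (max r₁ (min r₂ r)) + G₃ (max r₂ (min r₃ r))))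
    + (- G₂ r₁ - G₃ r₂) with hf
  have hin₁ : ∀ r ∈ Ioo r₀ r₁, f r = G₁ r := by
    rintro r ⟨ha, hb⟩
    simp only [hf]
    rw [min_eq_right hb.le, max_eq_right ha.le, min_eq_right (by linarith), max_eq_left hb.le,
      min_eq_right (by linarith), max_eq_left (by linarith)]
    ring
  have hin₂ : ∀ r ∈ Ioo r₁ r₂, f r = G₂ r := by
    rintro r ⟨ha, hb⟩
    simp only [hf]
    rw [min_eq_left ha.le, max_eq_right h1.le, min_eq_right (by linarith), max_eq_right ha.le,
      min_eq_right (by linarith), max_eq_left (by linarith)]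
    linarith
  have hin₃ : ∀ r ∈ Ioo r₂ r₃, f r = G₃ r := by
    rintro r ⟨ha, hb⟩
    simp only [hf]
    rw [min_eq_left (by linarith), max_eq_right h1.le, min_eq_left (by linarith),
      max_eq_right h2.le,
      min_eq_right (by linarith), max_eq_right (by linarith)]
    linarith
  have hout : ∀ r, r ∉ Icc r₀ r₃ → f r = 0 := by
    intro r hr
    simp only [hf]
    rcases lt_or_ge r r₀ with h | h
    · rw [min_eq_right (by linarith), max_eq_left h.le, min_eq_right (by linarith),
        max_eq_left (by linarith),
        min_eq_right (by linarith), max_eq_left (by linarith)]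
      linarith
    · have h : r₃ < r := by
        by_contra h'
        exact hr ⟨h, not_lt.1 h'⟩
      rw [min_eq_left (by linarith), max_eq_right h1.le, min_eq_left (by linarith),
        max_eq_right h2.le,
        min_eq_left (by linarith), max_eq_right (by linarith)]
      linarith
  have hder : ∀ (G G' : ℝ → ℝ) (x y : ℝ), (∀ r ∈ Icc x y, HasDerivAt G (G' r) r) →
      (∀ r ∈ Ioo x y, f r = G r) → ∀ r ∈ Ioo x y, Φ r (f r) (deriv f r) = Φ r (G r) (G' r) := by
    intro G G' x y hd he r hr
    have : f =ᶠ[nhds r] G := by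
      filter_upwards [isOpen_Ioo.mem_nhds hr] with s hs using he s hs
    rw [he r hr, this.deriv_eq, (hd r (Ioo_subset_Icc_self hr)).deriv]
  have hint : ∀ (G G' : ℝ → ℝ) (x y : ℝ), x < y → (∀ r ∈ Icc x y, HasDerivAt G (G' r) r) →
      ContinuousOn G' (Icc x y) →
      (∀ r ∈ Ioo x y, f r = G r) →
      IntervalIntegrable (fun r => Φ r (f r) (deriv f r)) volume x y ∧
      ∫ r in x..y, Φ r (f r) (deriv f r) = ∫ r in x..y, Φ r (G r) (G' r) := by
    intro G G' x y hxy hd hc he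
    have hE := hder G G' x y hd he
    have hcG : ContinuousOn (fun r => Φ r (G r) (G' r)) (Icc x y) := by
      have hG : ContinuousOn G (Icc x y) := fun r hr => (hd r hr).continuousAt.continuousWithinAt
      exact hΦ.comp_continuousOn (continuousOn_id.prodMk (hG.prodMk hc))
    constructor
    · have hi : IntervalIntegrable (fun r => Φ r (G r) (G' r)) volume x y :=
        hcG.intervalIntegrable_of_Icc hxy.le
      rw [intervalIntegrable_iff_integrableOn_Ioo_of_le hxy.le] at hi ⊢
      exact hi.congr_fun (fun r hr => (hE r hr).symm) measurableSet_Ioo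
    · rw [intervalIntegral.integral_of_le hxy.le, intervalIntegral.integral_of_le hxy.le,
        integral_Ioc_eq_integral_Ioo, integral_Ioc_eq_integral_Ioo]
      exact setIntegral_congr_fun measurableSet_Ioo hE
  have hts : tsupport f ⊆ Icc r₀ r₃ := by
    apply closure_minimal _ isClosed_Icc
    intro r hr
    by_contra h
    exact hr (hout r h)
  refine ⟨f, ⟨_, (hK₁.add (hK₂.add hK₃)).add (LipschitzWith.const _)⟩,
    HasCompactSupport.of_support_subset_isCompact isCompact_Icc ((subset_tsupport f).trans hts),
    fun r hr => lt_of_lt_of_le h0 (hts hr).1, ?_⟩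
  obtain ⟨i1, j1⟩ := hint G₁ G₁' r₀ r₁ h1 hd₁ hc₁ hin₁
  obtain ⟨i2, j2⟩ := hint G₂ G₂' r₁ r₂ h2 hd₂ hc₂ hin₂
  obtain ⟨i3, j3⟩ := hint G₃ G₃' r₂ r₃ h3 hd₃ hc₃ hin₃
  have hsub : Icc r₀ r₃ ⊆ Ioi (0:ℝ) := fun r hr => lt_of_lt_of_le (hR.trans h0) hr.1
  rw [setIntegral_eq_of_subset_of_forall_sdiff_eq_zero (s := Icc r₀ r₃) measurableSet_Ioi hsub,
    integral_Icc_eq_integral_Ioc, ← intervalIntegral.integral_of_le (by linarith),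
    ← intervalIntegral.integral_add_adjacent_intervals (i1.trans i2) i3,
    ← intervalIntegral.integral_add_adjacent_intervals i1 i2, j1, j2, j3]
  · exact hneg
  · rintro r ⟨-, hr⟩
    have : f =ᶠ[nhds r] fun _ => 0 := by
      filter_upwards [isClosed_Icc.isOpen_compl.mem_nhds hr] with s hs using hout s hs
    rw [hout r hr, this.deriv_eq, deriv_const, hΦ0]

/-- The integrand. -/
noncomputable def PhiS4 (n : ℕ) (a c : ℝ) (ρ : ℝ → ℝ) (r x y : ℝ) : ℝ :=
  y ^ 2 * (ρ r) ^ (n - 1)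
        + a * ((n : ℝ) - 1) * ((n : ℝ) - 2) * (deriv ρ r) ^ 2 * (ρ r) ^ (n - 3) * x ^ 2
        + 4 * a * ((n : ℝ) - 1) * (deriv ρ r) * (ρ r) ^ (n - 2) * x * y
        + a * c * (ρ r) ^ (n - 3) * x ^ 2

lemma phi_eq (n : ℕ) (hn : 3 ≤ n) (a c b m κ : ℝ) (ρ : ℝ → ℝ) (r h h' : ℝ) (hρ : 0 < ρ r)
    (hb : b = 2 * a * ((n : ℝ) - 1)) (hm : m = (n : ℝ) - 1 - 2 * b)
    (hκ : κ = b ^ 2 - b * ((n : ℝ) - 2) / 2) :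
    PhiS4 n a c ρ r (ρ r ^ (-b) * h) (ρ r ^ (-b) * (h' - b * (deriv ρ r / ρ r) * h))
      = ρ r ^ m * (h' ^ 2 - κ * (deriv ρ r / ρ r) ^ 2 * h ^ 2 + a * c / ρ r ^ 2 * h ^ 2) := by
  obtain ⟨k, rfl⟩ := Nat.exists_eq_add_of_le hn
  have hW : ρ r ^ m = ρ r ^ k * ρ r ^ 2 * (ρ r ^ (-b)) ^ 2 := by
    rw [← Real.rpow_natCast, ← Real.rpow_natCast, ← Real.rpow_natCast, ← Real.rpow_mul hρ.le,
      ← Real.rpow_add hρ, ← Real.rpow_add hρ]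
    congr 1
    rw [hm]; push_cast; ring
  rw [hW]
  unfold PhiS4
  have e1 : 3 + k - 1 = k + 2 := by omega
  have e2 : 3 + k - 2 = k + 1 := by omega
  have e3 : 3 + k - 3 = k := by omega
  rw [e1, e2, e3]
  set e := ρ r ^ (-b)
  set D := deriv ρ r
  set x := ρ r
  have hx : x ≠ 0 := hρ.ne'
  rw [pow_add, pow_add]
  have hb' : 4 * a * (((3 + k : ℕ) : ℝ) - 1) = 2 * b := by rw [hb]; ring
  have hb2 : a * (((3 + k : ℕ) : ℝ) - 1) = b / 2 := by rw [hb]; ring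
  rw [hb', hb2, hκ]
  field_simp
  ring

lemma G_deriv (b : ℝ) (ρ h : ℝ → ℝ) (r h' : ℝ) (hρ : 0 < ρ r) (hd : DifferentiableAt ℝ ρ r)
    (hh : HasDerivAt h h' r) :
    HasDerivAt (fun s => ρ s ^ (-b) * h s)
      (ρ r ^ (-b) * (h' - b * (deriv ρ r / ρ r) * h r)) r := by
  have := (hd.hasDerivAt.rpow_const (p := -b) (Or.inl hρ.ne')).mul hh
  convert! this using 1
  rw [Real.rpow_sub_one hρ.ne']
  field_simp
  ring

lemma F_deriv (m : ℝ) (ρ h h' : ℝ → ℝ) (r h'' : ℝ) (hρ : 0 < ρ r) (hd : DifferentiableAt ℝ ρ r)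
    (hh : HasDerivAt h (h' r) r) (hh' : HasDerivAt h' h'' r) :
    HasDerivAt (fun s => ρ s ^ m * (h s * h' s))
      (ρ r ^ m * (h' r ^ 2 + (h r * h'' + m * (deriv ρ r / ρ r) * (h r * h' r)))) r := by
  have := (hd.hasDerivAt.rpow_const (p := m) (Or.inl hρ.ne')).mul (hh.mul hh')
  convert! this using 1
  rw [Real.rpow_sub_one hρ.ne']
  simp only [Pi.mul_apply]
  field_simp
  ring

lemma phi_cont (n : ℕ) (a c : ℝ) (ρ : ℝ → ℝ) (hρ : ContDiff ℝ 2 ρ) :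
    Continuous fun p : ℝ × ℝ × ℝ => PhiS4 n a c ρ p.1 p.2.1 p.2.2 := by
  have h1 : Continuous ρ := hρ.continuous
  have h2 : Continuous (deriv ρ) := hρ.continuous_deriv (by norm_num)
  unfold PhiS4
  fun_prop

lemma G'_cont (b : ℝ) (ρ h h' : ℝ → ℝ) (hρ : ContDiff ℝ 2 ρ) (x y : ℝ)
    (hpos : ∀ r ∈ Icc x y, 0 < ρ r)
    (hh : ContinuousOn h (Icc x y)) (hh' : ContinuousOn h' (Icc x y)) :
    ContinuousOn (fun r => ρ r ^ (-b) * (h' r - b * (deriv ρ r / ρ r) * h r)) (Icc x y) := by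
  have h1 : Continuous ρ := hρ.continuous
  have h2 : Continuous (deriv ρ) := hρ.continuous_deriv (by norm_num)
  have h3 : ContinuousOn (fun r => ρ r ^ (-b)) (Icc x y) :=
    h1.continuousOn.rpow_const (fun r hr => Or.inl (hpos r hr).ne')
  exact h3.mul (hh'.sub ((continuousOn_const.mul
    (h2.continuousOn.div h1.continuousOn (fun r hr => (hpos r hr).ne'))).mul hh))

lemma phi_le (n : ℕ) (hn : 3 ≤ n) (a c b m κ κ' : ℝ) (ρ : ℝ → ℝ) (r h h' : ℝ) (hρ : 0 < ρ r)
    (hb : b = 2 * a * ((n : ℝ) - 1)) (hm : m = (n : ℝ) - 1 - 2 * b)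
    (hκ : κ = b ^ 2 - b * ((n : ℝ) - 2) / 2)
    (hac : a * c ≤ (κ - κ') * deriv ρ r ^ 2) :
    PhiS4 n a c ρ r (ρ r ^ (-b) * h) (ρ r ^ (-b) * (h' - b * (deriv ρ r / ρ r) * h))
      ≤ ρ r ^ m * (h' ^ 2 - κ' * (deriv ρ r / ρ r) ^ 2 * h ^ 2) := by
  rw [phi_eq n hn a c b m κ ρ r h h' hρ hb hm hκ]
  have hW : 0 < ρ r ^ m := Real.rpow_pos_of_pos hρ m
  apply mul_le_mul_of_nonneg_left _ hW.le
  have : a * c / ρ r ^ 2 ≤ (κ - κ') * (deriv ρ r / ρ r) ^ 2 := by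
    rw [div_pow, ← mul_div_assoc]
    gcongr
  nlinarith [mul_le_mul_of_nonneg_right this (sq_nonneg h)]

lemma phase (n : ℕ) (hn : 3 ≤ n) (a c b m κ κ' : ℝ) (ρ h h' h'' : ℝ → ℝ) (hρ : ContDiff ℝ 2 ρ)
    (x y : ℝ) (hxy : x ≤ y) (hpos : ∀ r ∈ Icc x y, 0 < ρ r)
    (hb : b = 2 * a * ((n : ℝ) - 1)) (hm : m = (n : ℝ) - 1 - 2 * b)
    (hκ : κ = b ^ 2 - b * ((n : ℝ) - 2) / 2)
    (hac : ∀ r ∈ Icc x y, a * c ≤ (κ - κ') * deriv ρ r ^ 2)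
    (hh : ∀ r ∈ Icc x y, HasDerivAt h (h' r) r) (hh' : ∀ r ∈ Icc x y, HasDerivAt h' (h'' r) r)
    (hineq : ∀ r ∈ Icc x y, 0 ≤ h r * h'' r + m * (deriv ρ r / ρ r) * (h r * h' r)
      + κ' * (deriv ρ r / ρ r) ^ 2 * h r ^ 2) :
    ∫ r in x..y, PhiS4 n a c ρ r (ρ r ^ (-b) * h r)
      (ρ r ^ (-b) * (h' r - b * (deriv ρ r / ρ r) * h r))
      ≤ ρ y ^ m * (h y * h' y) - ρ x ^ m * (h x * h' x) := by
  have hdρ : ∀ r, DifferentiableAt ℝ ρ r := fun r => (hρ.differentiable (by norm_num)) r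
  have hF := fun r hr => F_deriv m ρ h h' r (h'' r) (hpos r hr) (hdρ r) (hh r hr) (hh' r hr)
  have hhc : ContinuousOn h (Icc x y) := fun r hr => (hh r hr).continuousAt.continuousWithinAt
  have hhc' : ContinuousOn h' (Icc x y) := fun r hr => (hh' r hr).continuousAt.continuousWithinAt
  have hGc : ContinuousOn (fun s => ρ s ^ (-b) * h s) (Icc x y) := fun r hr =>
    (G_deriv b ρ h r (h' r) (hpos r hr) (hdρ r) (hh r hr)).continuousAt.continuousWithinAt
  have hGc' := G'_cont b ρ h h' hρ x y hpos hhc hhc'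
  have key := intervalIntegral.integral_le_sub_of_hasDeriv_right_of_le hxy
    (fun r hr => (hF r hr).continuousAt.continuousWithinAt)
    (fun r hr => (hF r (Ioo_subset_Icc_self hr)).hasDerivWithinAt)
    (φ := fun r => PhiS4 n a c ρ r (ρ r ^ (-b) * h r)
      (ρ r ^ (-b) * (h' r - b * (deriv ρ r / ρ r) * h r)))
    (((phi_cont n a c ρ hρ).comp_continuousOn
      (continuousOn_id.prodMk (hGc.prodMk hGc'))).integrableOn_Icc)
    (by
      intro r hr
      have hr := Ioo_subset_Icc_self hr
      refine (phi_le n hn a c b m κ κ' ρ r (h r) (h' r) (hpos r hr) hb hm hκ (hac r hr)).trans ?_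
      apply mul_le_mul_of_nonneg_left _ (Real.rpow_pos_of_pos (hpos r hr) m).le
      linarith [hineq r hr])
  exact key

lemma exists_T (μ κ' : ℝ) (h : μ ^ 2 < κ') : ∃ ω T : ℝ, 0 < ω ∧ 0 < T ∧ ω ^ 2 = κ' - μ ^ 2 ∧
    0 < Real.sin (ω * T) ∧ ω * Real.cos (ω * T) - μ * Real.sin (ω * T) = 0 ∧
    ∀ t ∈ Icc 0 T, 0 ≤ Real.sin (ω * t) ∧ 0 ≤ ω * Real.cos (ω * t) - μ * Real.sin (ω * t) := by
  have hκ : 0 < κ' := lt_of_le_of_lt (sq_nonneg μ) h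
  set R := Real.sqrt κ' with hR
  have hRp : 0 < R := Real.sqrt_pos.2 hκ
  have hR2 : R ^ 2 = κ' := Real.sq_sqrt hκ.le
  have habs : |μ| < R := abs_lt_of_sq_lt_sq (by rw [hR2]; exact h) hRp.le
  rw [abs_lt] at habs
  have h1 : μ / R < 1 := by rw [div_lt_one hRp]; exact habs.2
  have h2 : -1 < μ / R := by rw [lt_div_iff₀ hRp]; linarith
  set α := Real.arccos (μ / R) with hα
  have hc : Real.cos α = μ / R := Real.cos_arccos h2.le h1.le
  have hα0 : 0 < α := Real.arccos_pos.2 h1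
  have hαπ : α < Real.pi := by
    rcases (Real.arccos_le_pi (μ / R)).lt_or_eq with h | h
    · exact h
    · rw [Real.arccos_eq_pi] at h; linarith
  have hs : 0 < Real.sin α := Real.sin_pos_of_pos_of_lt_pi hα0 hαπ
  have hμ : μ = R * Real.cos α := by rw [hc]; field_simp
  have hω : 0 < R * Real.sin α := mul_pos hRp hs
  have hT : R * Real.sin α * (α / (R * Real.sin α)) = α := by field_simp
  refine ⟨R * Real.sin α, α / (R * Real.sin α), hω, div_pos hα0 hω, ?_, ?_, ?_, ?_⟩
  · rw [← hR2, hμ]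
    nlinarith [Real.sin_sq_add_cos_sq α]
  · rw [hT]; exact hs
  · rw [hT, hμ]; ring
  · rintro t ⟨ht0, ht1⟩
    have hle : R * Real.sin α * t ≤ α := by
      rw [le_div_iff₀ hω] at ht1; linarith
    have h0 : 0 ≤ R * Real.sin α * t := by positivity
    refine ⟨Real.sin_nonneg_of_nonneg_of_le_pi h0 (hle.trans hαπ.le), ?_⟩
    have : R * Real.sin α * Real.cos (R * Real.sin α * t) - μ * Real.sin (R * Real.sin α * t)
        = R * Real.sin (α - R * Real.sin α * t) := by
      rw [Real.sin_sub]
      linear_combination (-Real.sin (R * Real.sin α * t)) * hμ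
    rw [this]
    apply mul_nonneg hRp.le
    exact Real.sin_nonneg_of_nonneg_of_le_pi (by linarith) (by linarith)

lemma H_deriv (μ ω t : ℝ) : HasDerivAt (fun t => Real.exp (-μ * t) * Real.sin (ω * t))
    (Real.exp (-μ * t) * (ω * Real.cos (ω * t) - μ * Real.sin (ω * t))) t := by
  have h1 : HasDerivAt (fun t => Real.exp (-μ * t)) (Real.exp (-μ * t) * (-μ * 1)) t :=
    ((hasDerivAt_id t).const_mul (-μ)).exp
  have h2 : HasDerivAt (fun t => Real.sin (ω * t)) (Real.cos (ω * t) * (ω * 1)) t :=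
    ((hasDerivAt_id t).const_mul ω).sin
  convert! h1.mul h2 using 1
  ring

lemma H1_deriv (μ ω t : ℝ) : HasDerivAt
    (fun t => Real.exp (-μ * t) * (ω * Real.cos (ω * t) - μ * Real.sin (ω * t)))
    (-2 * μ * (Real.exp (-μ * t) * (ω * Real.cos (ω * t) - μ * Real.sin (ω * t)))
      - (μ ^ 2 + ω ^ 2) * (Real.exp (-μ * t) * Real.sin (ω * t))) t := by
  have h1 : HasDerivAt (fun t => Real.exp (-μ * t)) (Real.exp (-μ * t) * (-μ * 1)) t :=
    ((hasDerivAt_id t).const_mul (-μ)).exp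
  have h2 : HasDerivAt (fun t => Real.sin (ω * t)) (Real.cos (ω * t) * (ω * 1)) t :=
    ((hasDerivAt_id t).const_mul ω).sin
  have h3 : HasDerivAt (fun t => Real.cos (ω * t)) (-Real.sin (ω * t) * (ω * 1)) t :=
    ((hasDerivAt_id t).const_mul ω).cos
  convert! h1.mul ((h3.const_mul ω).sub (h2.const_mul μ)) using 1
  simp only [Pi.sub_apply]
  ring

lemma rho_facts (ρ : ℝ → ℝ) (hρ : ContDiff ℝ 2 ρ) (hρ0 : ρ 0 = 0)
    (hρpos : ∀ r > (0 : ℝ), 0 < ρ r)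
    (hρ'' : ∀ r > (0 : ℝ), 0 < deriv (deriv ρ) r) :
    (∀ r > 0, 0 < deriv ρ r) ∧ StrictMonoOn ρ (Ici 0) ∧ Tendsto ρ atTop atTop := by
  have hc1 : Continuous ρ := hρ.continuous
  have hc2 : Continuous (deriv ρ) := hρ.continuous_deriv (by norm_num)
  have hd : Differentiable ℝ ρ := hρ.differentiable (by norm_num)
  have hm' : StrictMonoOn (deriv ρ) (Ici 0) := by
    apply strictMonoOn_of_deriv_pos (convex_Ici 0) hc2.continuousOn
    intro r hr
    rw [interior_Ici] at hr
    exact hρ'' r hr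
  have h1 : ∀ r > 0, 0 < deriv ρ r := by
    intro r hr
    obtain ⟨ξ, hξ, he⟩ := exists_deriv_eq_slope ρ hr hc1.continuousOn hd.differentiableOn
    have : 0 < deriv ρ ξ := by
      rw [he, hρ0]
      have := hρpos r hr
      simp only [sub_zero]; positivity
    exact this.trans (hm' (mem_Ici.2 hξ.1.le) (mem_Ici.2 hr.le) hξ.2)
  refine ⟨h1, ?_, ?_⟩
  · apply strictMonoOn_of_deriv_pos (convex_Ici 0) hc1.continuousOn
    intro r hr
    rw [interior_Ici] at hr
    exact h1 r hr
  · have hlin : Tendsto (fun r : ℝ => deriv ρ 1 * (r - 1)) atTop atTop :=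
      (tendsto_atTop_add_const_right _ (-1) tendsto_id).const_mul_atTop (h1 1 one_pos)
    apply tendsto_atTop_mono' _ _ hlin
    filter_upwards [eventually_gt_atTop 1] with r hr
    obtain ⟨ξ, hξ, he⟩ := exists_deriv_eq_slope ρ hr hc1.continuousOn hd.differentiableOn
    have h2 : deriv ρ 1 < deriv ρ ξ :=
      hm' (mem_Ici.2 zero_le_one) (mem_Ici.2 (by linarith [hξ.1])) hξ.1
    rw [he, lt_div_iff₀ (by linarith)] at h2
    linarith [hρpos 1 one_pos]

lemma phase1 (n : ℕ) (hn : 3 ≤ n) (a c b m κ κ' μ ω T : ℝ) (ρ : ℝ → ℝ) (hρ : ContDiff ℝ 2 ρ)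
    (x y : ℝ) (hxy : x ≤ y) (hpos : ∀ r ∈ Icc x y, 0 < ρ r)
    (hρ2 : ∀ r ∈ Icc x y, 0 < deriv (deriv ρ) r)
    (hb : b = 2 * a * ((n : ℝ) - 1)) (hm : m = (n : ℝ) - 1 - 2 * b)
    (hκ : κ = b ^ 2 - b * ((n : ℝ) - 2) / 2)
    (hac : ∀ r ∈ Icc x y, a * c ≤ (κ - κ') * deriv ρ r ^ 2)
    (hμ : μ = (m - 1) / 2) (hω : ω ^ 2 = κ' - μ ^ 2)
    (hmono : ∀ r ∈ Icc x y, ρ x ≤ ρ r ∧ ρ r ≤ ρ y) (hy : ρ y = ρ x * Real.exp T)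
    (hTz : ω * Real.cos (ω * T) - μ * Real.sin (ω * T) = 0)
    (hT : ∀ t ∈ Icc 0 T, 0 ≤ Real.sin (ω * t) ∧
      0 ≤ ω * Real.cos (ω * t) - μ * Real.sin (ω * t)) :
    ∃ h h' : ℝ → ℝ, (∀ r ∈ Icc x y, HasDerivAt h (h' r) r) ∧ ContinuousOn h' (Icc x y) ∧
      h x = 0 ∧ h y = Real.exp (-μ * T) * Real.sin (ω * T) ∧
      ∫ r in x..y, PhiS4 n a c ρ r (ρ r ^ (-b) * h r)
      (ρ r ^ (-b) * (h' r - b * (deriv ρ r / ρ r) * h r)) ≤ 0 := by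
  have hdρ : ∀ r, DifferentiableAt ℝ ρ r := fun r => (hρ.differentiable (by norm_num)) r
  have hdρ' : ∀ r, DifferentiableAt ℝ (deriv ρ) r := fun r =>
    (((contDiff_succ_iff_deriv (n := 1)).1 hρ).2.2.differentiable (by norm_num)) r
  set H : ℝ → ℝ := fun t => Real.exp (-μ * t) * Real.sin (ω * t) with hH
  set H1 : ℝ → ℝ := fun t =>
    Real.exp (-μ * t) * (ω * Real.cos (ω * t) - μ * Real.sin (ω * t)) with hH1
  set τ : ℝ → ℝ := fun r => Real.log (ρ r) - Real.log (ρ x) with hτ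
  have hxm : x ∈ Icc x y := ⟨le_rfl, hxy⟩
  have hym : y ∈ Icc x y := ⟨hxy, le_rfl⟩
  have hτd : ∀ r ∈ Icc x y, HasDerivAt τ (deriv ρ r / ρ r) r := fun r hr =>
    ((hdρ r).hasDerivAt.log (hpos r hr).ne').sub_const _
  have hτx : τ x = 0 := by simp [hτ]
  have hτy : τ y = T := by
    simp only [hτ]
    rw [hy, Real.log_mul (hpos x hxm).ne' (Real.exp_pos T).ne', Real.log_exp]; ring
  have hτm : ∀ r ∈ Icc x y, τ r ∈ Icc 0 T := by
    intro r hr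
    rw [← hτy]
    constructor
    · simp only [hτ, sub_nonneg]
      exact Real.log_le_log (hpos x hxm) (hmono r hr).1
    · simp only [hτ]
      linarith [Real.log_le_log (hpos r hr) (hmono r hr).2]
  have hh : ∀ r ∈ Icc x y, HasDerivAt (fun r => H (τ r)) (deriv ρ r / ρ r * H1 (τ r)) r := by
    intro r hr
    have := (H_deriv μ ω (τ r)).comp r (hτd r hr)
    convert! this using 1
    simp only [hH1]; ring
  have hh' : ∀ r ∈ Icc x y, HasDerivAt (fun r => deriv ρ r / ρ r * H1 (τ r))
      ((deriv (deriv ρ) r / ρ r - (deriv ρ r / ρ r) ^ 2) * H1 (τ r)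
        + deriv ρ r / ρ r * ((-2 * μ * H1 (τ r) - κ' * H (τ r)) * (deriv ρ r / ρ r))) r := by
    intro r hr
    have h1 := (H1_deriv μ ω (τ r)).comp r (hτd r hr)
    have h2 := ((hdρ' r).hasDerivAt.div (hdρ r).hasDerivAt (hpos r hr).ne').mul h1
    convert! h2 using 1
    have : μ ^ 2 + ω ^ 2 = κ' := by rw [hω]; ring
    rw [this]
    have := (hpos r hr).ne'
    simp only [hH1, hH, Function.comp_apply, Pi.div_apply]
    field_simp
  refine ⟨fun r => H (τ r), fun r => deriv ρ r / ρ r * H1 (τ r), hh,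
    fun r hr => (hh' r hr).continuousAt.continuousWithinAt, ?_, ?_, ?_⟩
  · simp [hH, hτx]
  · simp only [hτy, hH]
  · have := phase n hn a c b m κ κ' ρ _ _ _ hρ x y hxy hpos hb hm hκ hac hh hh' (by
      intro r hr
      have p1 : 0 ≤ H (τ r) := mul_nonneg (Real.exp_pos _).le (hT _ (hτm r hr)).1
      have p2 : 0 ≤ H1 (τ r) := mul_nonneg (Real.exp_pos _).le (hT _ (hτm r hr)).2
      have p3 : 0 ≤ deriv (deriv ρ) r / ρ r := (div_pos (hρ2 r hr) (hpos r hr)).le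
      have p4 := mul_nonneg (mul_nonneg p1 p2) p3
      have : m = 2 * μ + 1 := by rw [hμ]; ring
      rw [this]
      refine p4.trans_eq ?_
      ring)
    refine this.trans_eq ?_
    simp only [hτx, hτy]
    have e1 : H 0 = 0 := by simp [hH]
    have e2 : H1 T = 0 := by simp only [hH1]; rw [hTz]; ring
    rw [e1, e2]; ring

lemma phase2 (n : ℕ) (hn : 3 ≤ n) (a c b m κ κ' k : ℝ) (ρ : ℝ → ℝ) (hρ : ContDiff ℝ 2 ρ)
    (x y : ℝ) (hxy : x < y) (hpos : ∀ r ∈ Icc x y, 0 < ρ r)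
    (hρ1 : ∀ r ∈ Icc x y, 0 < deriv ρ r) (hk : 0 < k) (hκ' : 0 < κ')
    (hb : b = 2 * a * ((n : ℝ) - 1)) (hm : m = (n : ℝ) - 1 - 2 * b)
    (hκ : κ = b ^ 2 - b * ((n : ℝ) - 2) / 2)
    (hac : ∀ r ∈ Icc x y, a * c ≤ (κ - κ') * deriv ρ r ^ 2) :
    ∫ r in x..y, PhiS4 n a c ρ r (ρ r ^ (-b) * k)
      (ρ r ^ (-b) * (0 - b * (deriv ρ r / ρ r) * k)) < 0 := by
  have hdρ : ∀ r, DifferentiableAt ℝ ρ r := fun r => (hρ.differentiable (by norm_num)) r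
  have hGc : ContinuousOn (fun s => ρ s ^ (-b) * k) (Icc x y) := fun r hr =>
    (G_deriv b ρ (fun _ => k) r 0 (hpos r hr) (hdρ r)
      (hasDerivAt_const r k)).continuousAt.continuousWithinAt
  have hGc' := G'_cont b ρ (fun _ => k) (fun _ => 0) hρ x y hpos continuousOn_const
    continuousOn_const
  have hint := (((phi_cont n a c ρ hρ).comp_continuousOn
      (continuousOn_id.prodMk (hGc.prodMk hGc'))).intervalIntegrable_of_Icc (μ := volume) hxy.le)
  have := intervalIntegral.intervalIntegral_pos_of_pos_on hint.neg (by
    intro r hr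
    have hr := Ioo_subset_Icc_self hr
    have h1 := phi_le n hn a c b m κ κ' ρ r k 0 (hpos r hr) hb hm hκ (hac r hr)
    have h2 : 0 < ρ r ^ m * (κ' * (deriv ρ r / ρ r) ^ 2 * k ^ 2) := by
      have := hpos r hr
      have := hρ1 r hr
      have := Real.rpow_pos_of_pos (hpos r hr) m
      positivity
    simp only [Pi.neg_apply, Function.comp_apply, id]
    linarith) hxy
  simp only [Pi.neg_apply, intervalIntegral.integral_neg] at this
  simpa using this

lemma phase3 (n : ℕ) (hn : 3 ≤ n) (a c b m κ κ' k : ℝ) (ρ : ℝ → ℝ) (hρ : ContDiff ℝ 2 ρ)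
    (M : ℕ) (hM : m ^ 2 * (M + 2) ≤ 4 * κ' * (M + 1))
    (x L : ℝ) (hL : 0 < L) (hpos : ∀ r ∈ Icc x (x + L), 0 < ρ r)
    (hb : b = 2 * a * ((n : ℝ) - 1)) (hm : m = (n : ℝ) - 1 - 2 * b)
    (hκ : κ = b ^ 2 - b * ((n : ℝ) - 2) / 2)
    (hac : ∀ r ∈ Icc x (x + L), a * c ≤ (κ - κ') * deriv ρ r ^ 2) :
    ∃ h h' : ℝ → ℝ, (∀ r ∈ Icc x (x + L), HasDerivAt h (h' r) r) ∧
      ContinuousOn h' (Icc x (x + L)) ∧ h (x + L) = 0 ∧ h x = k ∧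
      ∫ r in x..(x + L), PhiS4 n a c ρ r (ρ r ^ (-b) * h r)
      (ρ r ^ (-b) * (h' r - b * (deriv ρ r / ρ r) * h r)) ≤ ρ x ^ m * k ^ 2 * (M + 2) / L := by
  set q := k / L ^ (M + 2) with hq
  have hlin : ∀ r, HasDerivAt (fun r => x + L - r) (-1) r := fun r =>
    (hasDerivAt_id r).const_sub (x + L)
  have hh : ∀ r, HasDerivAt (fun r => q * (x + L - r) ^ (M + 2))
      (-q * (M + 2) * (x + L - r) ^ (M + 1)) r := by
    intro r
    convert! ((hlin r).pow (M + 2)).const_mul q using 1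
    push_cast
    ring
  have hh' : ∀ r, HasDerivAt (fun r => -q * (M + 2) * (x + L - r) ^ (M + 1))
      (q * (M + 2) * (M + 1) * (x + L - r) ^ M) r := by
    intro r
    convert! ((hlin r).pow (M + 1)).const_mul (-q * (M + 2)) using 1
    push_cast
    ring
  refine ⟨_, _, fun r _ => hh r, fun r _ => (hh' r).continuousAt.continuousWithinAt, ?_, ?_, ?_⟩
  · simp
  · simp only [hq, add_sub_cancel_left]; field_simp
  · have := phase n hn a c b m κ κ' ρ _ _ _ hρ x (x + L) (by linarith) hpos hb hm hκ hac
      (fun r _ => hh r) (fun r _ => hh' r) (by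
      intro r hr
      set u := deriv ρ r / ρ r
      set d := x + L - r
      have hE : 0 ≤ ((M:ℝ) + 2) * (M + 1) - m * u * (M + 2) * d + κ' * u ^ 2 * d ^ 2 := by
        have hMp : (0:ℝ) ≤ M := Nat.cast_nonneg M
        have h1 : 0 ≤ (2 * ((M:ℝ) + 1) - m * (u * d)) ^ 2 * (M + 2) := by positivity
        have h2 := mul_le_mul_of_nonneg_right hM (sq_nonneg (u * d))
        have h3 : 0 ≤ 4 * ((M:ℝ) + 1) *
          (((M:ℝ) + 2) * (M + 1) - m * u * (M + 2) * d + κ' * u ^ 2 * d ^ 2) := by nlinarith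
        exact nonneg_of_mul_nonneg_right h3 (by positivity)
      have hS : 0 ≤ (q * d ^ (M + 1)) ^ 2 := sq_nonneg _
      refine (mul_nonneg hS hE).trans_eq ?_
      ring)
    refine this.trans_eq ?_
    simp only [hq, add_sub_cancel_left, sub_self]
    field_simp
    ring

set_option maxHeartbeats 1000000 in
theorem stmt_4 (n : ℕ) (hn : 3 ≤ n) (c : ℝ)
    (ρ : ℝ → ℝ) (hρ : ContDiff ℝ 2 ρ) (hρ0 : ρ 0 = 0)
    (hρpos : ∀ r > (0 : ℝ), 0 < ρ r)
    (hρ'' : ∀ r > (0 : ℝ), 0 < deriv (deriv ρ) r)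
    (h : Tendsto (deriv ρ) atTop atTop ∨ c ≤ 0)
    (a : ℝ) (ha : ((n : ℝ) - 1) / (4 * (n : ℝ)) < a)
    (R₀ : ℝ) (hR₀ : 0 < R₀) :
    ∃ f : ℝ → ℝ, (∃ K, LipschitzWith K f) ∧ HasCompactSupport f ∧
      tsupport f ⊆ Set.Ioi R₀ ∧
      (∫ r in Set.Ioi (0 : ℝ), ((deriv f r) ^ 2 * (ρ r) ^ (n - 1)
        + a * ((n : ℝ) - 1) * ((n : ℝ) - 2) * (deriv ρ r) ^ 2 * (ρ r) ^ (n - 3) * (f r) ^ 2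
        + 4 * a * ((n : ℝ) - 1) * (deriv ρ r) * (ρ r) ^ (n - 2) * (f r) * (deriv f r)
        + a * c * (ρ r) ^ (n - 3) * (f r) ^ 2)) < 0 := by
  obtain ⟨hρ1, hmono, htop⟩ := rho_facts ρ hρ hρ0 hρpos hρ''
  have hdρ : ∀ r, DifferentiableAt ℝ ρ r := fun r => (hρ.differentiable (by norm_num)) r
  have hn' : (3:ℝ) ≤ n := by exact_mod_cast hn
  obtain ⟨b, hb⟩ : ∃ b, b = 2 * a * ((n : ℝ) - 1) := ⟨_, rfl⟩
  obtain ⟨m, hm⟩ : ∃ m, m = (n : ℝ) - 1 - 2 * b := ⟨_, rfl⟩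
  obtain ⟨κ, hκ⟩ : ∃ κ, κ = b ^ 2 - b * ((n : ℝ) - 2) / 2 := ⟨_, rfl⟩
  have ha0 : 0 < a := lt_of_le_of_lt (div_nonneg (by linarith) (by linarith)) ha
  have hbn : ((n:ℝ) - 1) ^ 2 < 2 * b * n := by
    rw [div_lt_iff₀ (by linarith)] at ha
    rw [hb]
    nlinarith
  have hb2 : (n:ℝ) - 2 < 2 * b := by nlinarith
  have hk1 : m ^ 2 / 4 < κ := by rw [hκ, hm]; nlinarith
  have hk2 : (m - 1) ^ 2 / 4 < κ := by
    rw [hκ, hm]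
    nlinarith [mul_pos (show (0:ℝ) < n - 2 by linarith) (sub_pos.2 hb2)]
  obtain ⟨κ', hκ'1, hκ'2⟩ := exists_between (max_lt hk1 hk2)
  rw [max_lt_iff] at hκ'1
  obtain ⟨hq1, hq2⟩ := hκ'1
  have hκ'0 : 0 < κ' := lt_of_le_of_lt (by positivity) hq1
  obtain ⟨M, hM⟩ : ∃ M : ℕ, m ^ 2 * (M + 2) ≤ 4 * κ' * (M + 1) := by
    obtain ⟨M, hM⟩ := exists_nat_ge (2 * m ^ 2 / (4 * κ' - m ^ 2))
    refine ⟨M, ?_⟩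
    rw [div_le_iff₀ (by linarith)] at hM
    nlinarith
  -- the radius beyond which the fiber term is negligible
  obtain ⟨r₀, hr₀, hac⟩ : ∃ r₀, R₀ < r₀ ∧ ∀ r ≥ r₀, a * c ≤ (κ - κ') * deriv ρ r ^ 2 := by
    have hpos : 0 < κ - κ' := sub_pos.2 hκ'2
    rcases h with h | h
    · have h1 : Tendsto (fun r => (κ - κ') * deriv ρ r ^ 2) atTop atTop :=
        ((tendsto_pow_atTop two_ne_zero).comp h).const_mul_atTop hpos
      obtain ⟨r, hr⟩ := eventually_atTop.1 (h1.eventually_ge_atTop (a * c))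
      exact ⟨max r (R₀ + 1), lt_max_of_lt_right (by linarith),
        fun s hs => hr s ((le_max_left _ _).trans hs)⟩
    · refine ⟨R₀ + 1, by linarith, fun r _ => ?_⟩
      have : a * c ≤ 0 := mul_nonpos_of_nonneg_of_nonpos ha0.le h
      exact this.trans (by positivity)
  have hr₀0 : 0 < r₀ := hR₀.trans hr₀
  obtain ⟨ω, T, hω, hT0, hω2, hsT, hTz, hT⟩ := exists_T ((m - 1) / 2) κ' (by
    rw [div_pow]; linarith)
  have hlt : ρ r₀ < ρ r₀ * Real.exp T := by
    have := hρpos r₀ hr₀0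
    have h1 : 1 < Real.exp T := Real.one_lt_exp_iff.2 hT0
    exact lt_mul_of_one_lt_right this h1
  obtain ⟨r₁, hr₁, hy⟩ : ∃ r₁, r₀ < r₁ ∧ ρ r₁ = ρ r₀ * Real.exp T := by
    obtain ⟨s, hs1, hs2⟩ := ((htop.eventually_ge_atTop (ρ r₀ * Real.exp T)).and
      (eventually_ge_atTop r₀)).exists
    obtain ⟨r, hr, he⟩ := intermediate_value_Icc hs2 hρ.continuous.continuousOn ⟨hlt.le, hs1⟩
    refine ⟨r, lt_of_le_of_ne hr.1 ?_, he⟩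
    rintro rfl
    exact hlt.ne he
  have hpos : ∀ x y, r₀ ≤ x → ∀ r ∈ Icc x y, 0 < r := fun x y hx r hr =>
    lt_of_lt_of_le hr₀0 (hx.trans hr.1)
  obtain ⟨h₁, h₁', hd₁, hc₁, e0, e1, hI₁⟩ := phase1 n hn a c b m κ κ' _ ω T ρ hρ r₀ r₁ hr₁.le
    (fun r hr => hρpos r (hpos _ _ le_rfl r hr)) (fun r hr => hρ'' r (hpos _ _ le_rfl r hr))
    hb hm hκ (fun r hr => hac r hr.1) rfl hω2
    (fun r hr => ⟨hmono.monotoneOn (mem_Ici.2 hr₀0.le) (mem_Ici.2 (hpos _ _ le_rfl r hr).le) hr.1,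
      hmono.monotoneOn (mem_Ici.2 (hpos _ _ le_rfl r hr).le) (mem_Ici.2 (by linarith)) hr.2⟩)
    hy hTz hT
  set k := Real.exp (-((m - 1) / 2) * T) * Real.sin (ω * T) with hk
  have hk0 : 0 < k := mul_pos (Real.exp_pos _) hsT
  have hI₂ := phase2 n hn a c b m κ κ' k ρ hρ r₁ (r₁ + 1) (by linarith)
    (fun r hr => hρpos r (hpos _ _ hr₁.le r hr)) (fun r hr => hρ1 r (hpos _ _ hr₁.le r hr))
    hk0 hκ'0 hb hm hκ (fun r hr => hac r (hr₁.le.trans hr.1))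
  set I₂ := ∫ r in r₁..(r₁ + 1), PhiS4 n a c ρ r (ρ r ^ (-b) * k)
      (ρ r ^ (-b) * (0 - b * (deriv ρ r / ρ r) * k)) with hI₂def
  obtain ⟨L, hL0, hL⟩ : ∃ L : ℝ, 0 < L ∧ ρ (r₁ + 1) ^ m * k ^ 2 * (M + 2) / L < -I₂ := by
    have hp := Real.rpow_pos_of_pos (hρpos (r₁ + 1) (by linarith)) m
    have hC : 0 < ρ (r₁ + 1) ^ m * k ^ 2 * (M + 2) := by positivity
    generalize ρ (r₁ + 1) ^ m * k ^ 2 * (M + 2) = C at hC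
    refine ⟨(C + 1) / (-I₂), div_pos (by linarith) (by linarith), ?_⟩
    have hI : 0 < -I₂ := by linarith
    rw [div_div_eq_mul_div, div_lt_iff₀ (by linarith)]
    linarith
  have hr2 : r₀ ≤ r₁ + 1 := by linarith
  obtain ⟨h₃, h₃', hd₃, hc₃, e3, e2, hI₃⟩ := phase3 n hn a c b m κ κ' k ρ hρ M hM (r₁ + 1) L hL0
    (fun r hr => hρpos r (hpos _ _ hr2 r hr)) hb hm hκ (fun r hr => hac r (hr2.trans hr.1))
  have hcont : ∀ (h h' : ℝ → ℝ) (x y : ℝ), (∀ r ∈ Icc x y, HasDerivAt h (h' r) r) →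
      ContinuousOn h (Icc x y) := fun h h' x y hd r hr =>
    (hd r hr).continuousAt.continuousWithinAt
  exact glue (PhiS4 n a c ρ) (phi_cont n a c ρ hρ) (fun r => by simp [PhiS4])
    (fun s => ρ s ^ (-b) * h₁ s)
    (fun r => ρ r ^ (-b) * (h₁' r - b * (deriv ρ r / ρ r) * h₁ r))
    (fun s => ρ s ^ (-b) * k)
    (fun r => ρ r ^ (-b) * (0 - b * (deriv ρ r / ρ r) * k))
    (fun s => ρ s ^ (-b) * h₃ s)
    (fun r => ρ r ^ (-b) * (h₃' r - b * (deriv ρ r / ρ r) * h₃ r))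
    r₀ r₁ (r₁ + 1) (r₁ + 1 + L) R₀ hR₀ hr₀ hr₁ (by linarith) (by linarith)
    (fun r hr => G_deriv b ρ h₁ r _ (hρpos r (hpos _ _ le_rfl r hr)) (hdρ r) (hd₁ r hr))
    (G'_cont b ρ h₁ h₁' hρ _ _ (fun r hr => hρpos r (hpos _ _ le_rfl r hr))
      (hcont _ _ _ _ hd₁) hc₁)
    (fun r hr => G_deriv b ρ (fun _ => k) r _ (hρpos r (hpos _ _ hr₁.le r hr)) (hdρ r)
      (hasDerivAt_const r k))
    (G'_cont b ρ (fun _ => k) (fun _ => 0) hρ _ _ (fun r hr => hρpos r (hpos _ _ hr₁.le r hr))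
      continuousOn_const continuousOn_const)
    (fun r hr => G_deriv b ρ h₃ r _ (hρpos r (hpos _ _ hr2 r hr)) (hdρ r) (hd₃ r hr))
    (G'_cont b ρ h₃ h₃' hρ _ _ (fun r hr => hρpos r (hpos _ _ hr2 r hr))
      (hcont _ _ _ _ hd₃) hc₃)
    (by simp only [e0, mul_zero]) (by simp only [e1]) (by simp only [e2])
    (by simp only [e3, mul_zero])
    (by linarith)
end

section
/- Let R₀ be a real number and ρ : ℝ → ℝ be twice differentiable with ρ(r) > 0 and ρ''(r) > 0 for all r > R₀, and suppose lim_{r→∞} ρ'(r) = ∞. Then there exists R₁ ≥ R₀ such that r·ρ'(r) > ρ(r) for all r > R₁. -/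
open MeasureTheory Filter Set

/-- If `ρ > 0` and `ρ'' > 0` beyond `R₀` and `ρ'(r) → ∞`, then `r·ρ'(r) > ρ(r)` for all
sufficiently large `r`. -/
theorem stmt_5 (R₀ : ℝ) (ρ : ℝ → ℝ)
    (hd : ∀ r > R₀, DifferentiableAt ℝ ρ r ∧ DifferentiableAt ℝ (deriv ρ) r)
    (hρpos : ∀ r > R₀, 0 < ρ r)
    (hρ'' : ∀ r > R₀, 0 < deriv (deriv ρ) r)
    (hlim : Tendsto (deriv ρ) atTop atTop) :
    ∃ R₁, R₀ ≤ R₁ ∧ ∀ r > R₁, ρ r < r * deriv ρ r := by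
  obtain ⟨a, ha, ha0⟩ : ∃ a, R₀ < a ∧ 0 < a :=
    ⟨max R₀ 0 + 1, by linarith [le_max_left R₀ 0], by linarith [le_max_right R₀ 0]⟩
  obtain ⟨N, hN⟩ := eventually_atTop.1 (hlim.eventually_gt_atTop (ρ a / a))
  refine ⟨max N a, ha.le.trans (le_max_right _ _), fun r hr => ?_⟩
  have har : a < r := lt_of_le_of_lt (le_max_right _ _) hr
  have hNr : ρ a / a < deriv ρ r := hN r ((le_max_left _ _).trans hr.le)
  rw [div_lt_iff₀ ha0] at hNr
  obtain ⟨c, hc, hce⟩ := exists_deriv_eq_slope ρ har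
    (fun x hx => (hd x (lt_of_lt_of_le ha hx.1)).1.continuousAt.continuousWithinAt)
    (fun x hx => (hd x (ha.trans hx.1)).1.differentiableWithinAt)
  obtain ⟨d, hdm, hde⟩ := exists_deriv_eq_slope (deriv ρ) hc.2
    (fun x hx => (hd x (lt_of_lt_of_le (ha.trans hc.1) hx.1)).2.continuousAt.continuousWithinAt)
    (fun x hx => (hd x ((ha.trans hc.1).trans hx.1)).2.differentiableWithinAt)
  have h2 := hρ'' d ((ha.trans hc.1).trans hdm.1)
  have hcr : 0 < r - c := sub_pos.2 hc.2
  have har' : 0 < r - a := sub_pos.2 har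
  rw [hde] at h2
  have h3 : 0 < deriv ρ r - deriv ρ c := (div_pos_iff_of_pos_right hcr).1 h2
  rw [eq_div_iff har'.ne'] at hce
  nlinarith [mul_pos h3 har']
end

section
/- Let n ≥ 3 be an integer, c a real number, and R₀ a real number. Let ρ : ℝ → ℝ be twice continuously differentiable with ρ(r) > 0 and ρ''(r) > 0 for all r > R₀, and suppose lim_{r→∞} ρ'(r) = ∞. Then for every real a > (n−1)/(4n) and every R₁ > R₀ there exists a Lipschitz function f : ℝ → ℝ with compact support contained in (R₁, ∞) such that ∫_0^∞ [ f'(r)² ρ(r)^{n−1} + a(n−1)(n−2) ρ'(r)² ρ(r)^{n−3} f(r)² + 4a(n−1) ρ'(r) ρ(r)^{n−2} f(r) f'(r) + a·c·ρ(r)^{n−3} f(r)² ] dr < 0, where f' denotes the almost-everywhere derivative of f. -/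
open MeasureTheory Filter Set

lemma alg_aux (N b : ℝ) (hN : 3 ≤ N) (hb : (N-1)^2 < b * N) :
    ∃ C m κ : ℝ, 0 < C ∧ 0 < m ∧ 0 < κ ∧ ∀ y P D k : ℝ, 1 ≤ y → k ≤ κ →
      D^2 + (1 + (b-N+1)*y)*P*D +
        (1/4 + (b-N+1)*y/2 - (b*N-(N-1)^2)/4*y^2 + k*y^2)*P^2 ≤ C*D^2 - m*P^2 := by
  obtain ⟨m, hm, hm1, hm2⟩ : ∃ m : ℝ, 0 < m ∧ m ≤ (b*N-(N-1)^2)/4 ∧ m ≤ (N-2)*(b-N+2)/4 := by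
    have h2 : 0 < b - N + 2 := by nlinarith
    exact ⟨min _ _, lt_min (by linarith) (by have : 0 < N-2 := by linarith
                                             positivity), min_le_left _ _, min_le_right _ _⟩
  set K := 1 + |b-N+1| with hK
  refine ⟨1 + K^2/m, m/2, m/4, by positivity, by positivity, by positivity, ?_⟩
  intro y P D k hy hk
  have hq : 1/4 + (b-N+1)*y/2 - (b*N-(N-1)^2)/4*y^2 ≤ -m*y^2 := by
    -- chord bound
    nlinarith [mul_nonneg (sub_nonneg.2 hm1) (mul_nonneg (by linarith : 0 ≤ y) (sub_nonneg.2 hy)),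
      mul_nonneg (sub_nonneg.2 hm2) (by linarith : 0 ≤ y)]
  have hc : (1 + (b-N+1)*y)*P*D ≤ (m/4)*y^2*P^2 + K^2/m*D^2 := by
    have h1 : |1 + (b-N+1)*y| ≤ K*y := by
      rw [hK, abs_le]
      constructor <;> nlinarith [le_abs_self (b-N+1), neg_abs_le (b-N+1)]
    have h2 : (1 + (b-N+1)*y)^2 ≤ (K*y)^2 := sq_le_sq' (abs_le.1 h1).1 (abs_le.1 h1).2
    have h3 : (1 + (b-N+1)*y)*P*D ≤ (K*y)*|P*D| := by
      rw [mul_assoc]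
      exact (le_abs_self _).trans (by rw [abs_mul]; gcongr)
    have h4 : (K*y)*|P*D| ≤ (m/4)*y^2*P^2 + K^2/m*D^2 := by
      rw [abs_mul]
      have : (m/4)*y^2*P^2 + K^2/m*D^2 - (K*y) * (|P| * |D|) = (m * y * |P| / 2 - K * |D|)^2/m := by
        rw [← sq_abs P, ← sq_abs D]; field_simp; ring
      have : 0 ≤ (m * y * |P| / 2 - K * |D|)^2/m := by positivity
      linarith
    linarith
  have h5 : (1/4 + (b-N+1)*y/2 - (b*N-(N-1)^2)/4*y^2 + k*y^2)*P^2 ≤ (-(3*m/4)*y^2)*P^2 := by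
    gcongr
    nlinarith [sq_nonneg y]
  have h6 : m/2 * P^2 ≤ m/2*y^2*P^2 := by
    have : 1 ≤ y^2 := by nlinarith
    nlinarith [mul_nonneg hm.le (sq_nonneg P)]
  nlinarith

lemma bump_aux (C m : ℝ) (hm : 0 < m) : ∃ (χ : ℝ → ℝ) (L : ℝ), 0 < L ∧ ContDiff ℝ 2 χ ∧
    (∀ u, u ∉ Icc (-1:ℝ) 1 → χ u = 0) ∧
    ∫ u in (-1:ℝ)..1, (C/L^2*(deriv χ u)^2 - m*(χ u)^2) < 0 := by
  let B : ContDiffBump (0:ℝ) := ⟨1/2, 1, by norm_num, by norm_num⟩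
  have hB : ContDiff ℝ 2 B := B.contDiff
  have hBc : Continuous B := hB.continuous
  have hd : Continuous (deriv B) := hB.continuous_deriv (by norm_num)
  have h0 : 0 < ∫ u in (-1:ℝ)..1, (B u)^2 := by
    refine intervalIntegral.integral_pos (by norm_num) (hB.continuous.pow 2).continuousOn (fun x _ => by positivity) ⟨0, by norm_num, ?_⟩
    have : B (0:ℝ) = 1 := B.one_of_mem_closedBall (by simp [B])
    rw [this]; norm_num
  have ht : Tendsto (fun L : ℝ => C/L^2*(∫ u in (-1:ℝ)..1, (deriv B u)^2) - m * ∫ u in (-1:ℝ)..1, (B u)^2) atTop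
      (nhds (0 * (∫ u in (-1:ℝ)..1, (deriv B u)^2) - m * ∫ u in (-1:ℝ)..1, (B u)^2)) := by
    refine Tendsto.sub_const (Tendsto.mul_const _ ?_) _
    exact tendsto_const_nhds.div_atTop (tendsto_pow_atTop (by norm_num))
  have hneg : 0 * (∫ u in (-1:ℝ)..1, (deriv B u)^2) - m * ∫ u in (-1:ℝ)..1, (B u)^2 < 0 := by
    nlinarith [mul_pos hm h0]
  obtain ⟨L, hL, hL0⟩ := ((ht.eventually_lt_const hneg).and (eventually_gt_atTop 0)).exists
  refine ⟨B, L, hL0, hB, ?_, ?_⟩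
  · intro u hu
    apply B.zero_of_le_dist
    rw [Real.dist_eq, sub_zero]
    by_contra h
    push Not at h
    exact hu (abs_le.1 h.le)
  · rw [intervalIntegral.integral_sub, intervalIntegral.integral_const_mul, intervalIntegral.integral_const_mul]
    · exact hL
    · exact (continuous_const.mul (hd.pow 2)).intervalIntegrable _ _
    · exact (continuous_const.mul (hBc.pow 2)).intervalIntegrable _ _

/-- derivative of the weight -/
lemma weight_deriv (k : ℕ) (ρ : ℝ → ℝ) (σ r ρ' : ℝ) (hρ : HasDerivAt ρ ρ' r) (hp : 0 < ρ r)
    (he : 0 < r - σ) :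
    HasDerivAt (fun r => Real.sqrt ((r - σ) / ρ r ^ (k+2)))
      (Real.sqrt ((r - σ) / ρ r ^ (k+2)) * (1/(2*(r-σ)) - (k+2)*ρ'/(2*ρ r))) r := by
  have hw : 0 < (r - σ) / ρ r ^ (k+2) := by positivity
  have h1 : HasDerivAt (fun r => (r - σ) / ρ r ^ (k+2)) _ r :=
    ((hasDerivAt_id r).sub_const σ).div (hρ.pow (k+2)) (by positivity)
  convert h1.sqrt hw.ne' using 1
  have hs := Real.sq_sqrt hw.le
  have hs0 := Real.sqrt_pos.2 hw
  rw [eq_div_iff (by positivity)]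
  have : Real.sqrt ((r - σ) / ρ r ^ (k+2)) * (1/(2*(r-σ)) - (k+2)*ρ'/(2*ρ r)) *
     (2 * Real.sqrt ((r - σ) / ρ r ^ (k+2))) =
     (Real.sqrt ((r - σ) / ρ r ^ (k+2)))^2 * (1/((r-σ)) - (k+2)*ρ'/(ρ r)) := by
    field_simp
  rw [this, hs]
  simp
  field_simp
  ring

lemma integrand_aux (k : ℕ) (a c e p q g P D : ℝ) (he : 0 < e) (hp : 0 < p) (hq : 0 < q)
    (hg : g^2 = e / p^(k+2)) :
    (g * (D/e + (1/(2*e) - (k+2)*q/(2*p))*P))^2 * p^(k+2)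
      + a * ((k:ℝ)+2) * ((k:ℝ)+1) * q^2 * p^k * (g*P)^2
      + 4*a*((k:ℝ)+2) * q * p^(k+1) * (g*P) * (g * (D/e + (1/(2*e) - (k+2)*q/(2*p))*P))
      + a*c*p^k*(g*P)^2 =
    (1/e) * (D^2 + (1 + (4*a*((k:ℝ)+2)-((k:ℝ)+3)+1)*(q*e/p))*P*D +
        (1/4 + (4*a*((k:ℝ)+2)-((k:ℝ)+3)+1)*(q*e/p)/2
          - (4*a*((k:ℝ)+2)*((k:ℝ)+3)-(((k:ℝ)+3)-1)^2)/4*(q*e/p)^2 + (a*c/q^2)*(q*e/p)^2)*P^2) := by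
  have e1 : ∀ Z : ℝ, (g * Z)^2 * p^(k+2) = e * Z^2 := by
    intro Z; rw [mul_pow, hg]; field_simp
  have e2 : ∀ Z W : ℝ, p^(k+1) * (g*Z) * (g*W) = e/p * (Z*W) := by
    intro Z W
    have : p^(k+1) * (g*Z) * (g*W) = p^(k+1) * g^2 * (Z*W) := by ring
    rw [this, hg]; field_simp; ring
  have e3 : p^k * (g*P)^2 = e/p^2 * P^2 := by
    rw [mul_pow, hg]; field_simp; ring
  generalize hZ : D/e + (1/(2*e) - (k+2)*q/(2*p))*P = Z
  have : (g * Z)^2 * p^(k+2)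
      + a * ((k:ℝ)+2) * ((k:ℝ)+1) * q^2 * p^k * (g*P)^2
      + 4*a*((k:ℝ)+2) * q * p^(k+1) * (g*P) * (g * Z)
      + a*c*p^k*(g*P)^2 = (g * Z)^2 * p^(k+2)
      + a * ((k:ℝ)+2) * ((k:ℝ)+1) * q^2 * (p^k * (g*P)^2)
      + 4*a*((k:ℝ)+2) * q * (p^(k+1) * (g*P) * (g * Z))
      + a*c*(p^k*(g*P)^2) := by ring
  rw [this, e1, e2, e3, ← hZ]
  field_simp
  ring

theorem stmt_6 (n : ℕ) (hn : 3 ≤ n) (c R₀ : ℝ)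
    (ρ : ℝ → ℝ) (hρ : ContDiff ℝ 2 ρ)
    (hρpos : ∀ r > R₀, 0 < ρ r)
    (hρ'' : ∀ r > R₀, 0 < deriv (deriv ρ) r)
    (hlim : Tendsto (deriv ρ) atTop atTop)
    (a : ℝ) (ha : ((n : ℝ) - 1) / (4 * (n : ℝ)) < a)
    (R₁ : ℝ) (hR₁ : R₀ < R₁) :
    ∃ f : ℝ → ℝ, (∃ K, LipschitzWith K f) ∧ HasCompactSupport f ∧
      tsupport f ⊆ Set.Ioi R₁ ∧
      (∫ r in Set.Ioi (0 : ℝ), ((deriv f r) ^ 2 * (ρ r) ^ (n - 1)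
        + a * ((n : ℝ) - 1) * ((n : ℝ) - 2) * (deriv ρ r) ^ 2 * (ρ r) ^ (n - 3) * (f r) ^ 2
        + 4 * a * ((n : ℝ) - 1) * (deriv ρ r) * (ρ r) ^ (n - 2) * (f r) * (deriv f r)
        + a * c * (ρ r) ^ (n - 3) * (f r) ^ 2)) < 0 := by
  obtain ⟨k, rfl⟩ : ∃ k, n = k + 3 := ⟨n - 3, by omega⟩
  have i1 : k + 3 - 1 = k + 2 := by omega
  have i2 : k + 3 - 2 = k + 1 := by omega
  have i3 : k + 3 - 3 = k := by omega
  have j1 : ((k + 3 : ℕ) : ℝ) - 1 = (k:ℝ) + 2 := by push_cast; ring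
  have j2 : ((k + 3 : ℕ) : ℝ) - 2 = (k:ℝ) + 1 := by push_cast; ring
  have j3 : ((k + 3 : ℕ) : ℝ) = (k:ℝ) + 3 := by push_cast; ring
  rw [j1, j3] at ha
  rw [i1, i2, i3, j1, j2]
  have hk0 : (0:ℝ) ≤ k := Nat.cast_nonneg k
  obtain ⟨C, m, κ, hC, hm, hκ, halg⟩ := alg_aux ((k:ℝ)+3) (4*a*((k:ℝ)+2)) (by linarith) (by
    rw [div_lt_iff₀ (by positivity)] at ha
    nlinarith)
  obtain ⟨χ, L, hL, hχ, hχ0, hχi⟩ := bump_aux C m hm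
  -- the regularity of ρ
  have hρd : Differentiable ℝ ρ := hρ.differentiable (by norm_num)
  have hρ1 : ContDiff ℝ 1 (deriv ρ) := by
    have : ContDiff ℝ (1+1) ρ := by convert hρ using 1; norm_num
    exact (contDiff_succ_iff_deriv.1 this).2.2
  have hρ1c : Continuous (deriv ρ) := hρ1.continuous
  have hρ1d : Differentiable ℝ (deriv ρ) := hρ1.differentiable (by norm_num)
  -- choice of r₁
  have hlim2 : Tendsto (fun r => a * c / (deriv ρ r)^2) atTop (nhds 0) :=
    tendsto_const_nhds.div_atTop ((tendsto_pow_atTop (by norm_num)).comp hlim)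
  obtain ⟨r₀, hr₀⟩ := eventually_atTop.1 ((hlim2.eventually_lt_const hκ).and
    (hlim.eventually_gt_atTop 0))
  set r₁ := max r₀ (max R₁ 0) with hr₁
  have hr₁0 : 0 ≤ r₁ := by simp [hr₁]
  have hr₁R : R₁ ≤ r₁ := by simp [hr₁]
  have hq : ∀ r, r₁ ≤ r → 0 < deriv ρ r := fun r hr => (hr₀ r ((le_max_left _ _).trans hr)).2
  have hκ' : ∀ r, r₁ ≤ r → a * c / (deriv ρ r)^2 ≤ κ :=
    fun r hr => (hr₀ r ((le_max_left _ _).trans hr)).1.le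
  have hp : ∀ r, r₁ ≤ r → 0 < ρ r := fun r hr => hρpos r (by linarith)
  set σ := r₁ - ρ r₁ / deriv ρ r₁ with hσ
  have hσ1 : 0 < r₁ - σ := by
    rw [hσ]; have := div_pos (hp r₁ le_rfl) (hq r₁ le_rfl); linarith
  have he : ∀ r, r₁ ≤ r → 0 < r - σ := fun r hr => by linarith
  have hy : ∀ r, r₁ ≤ r → 1 ≤ deriv ρ r * (r - σ) / ρ r := by
    intro r hr
    rw [le_div_iff₀ (hp r hr), one_mul]
    have hG : ∀ x, HasDerivAt (fun x => deriv ρ x * (x - σ) - ρ x)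
        (deriv (deriv ρ) x * (x - σ)) x := by
      intro x
      have := ((hρ1d x).hasDerivAt.mul ((hasDerivAt_id x).sub_const σ)).sub (hρd x).hasDerivAt
      refine HasDerivAt.congr_deriv this ?_
      simp only [id]
      ring
    have hmono : MonotoneOn (fun x => deriv ρ x * (x - σ) - ρ x) (Ici r₁) := by
      apply monotoneOn_of_deriv_nonneg (convex_Ici _)
      · exact fun x _ => (hG x).continuousAt.continuousWithinAt
      · exact fun x _ => (hG x).differentiableAt.differentiableWithinAt
      · intro x hx
        rw [interior_Ici] at hx
        rw [(hG x).deriv]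
        have := hρ'' x (by have : r₁ < x := hx
                           linarith)
        have := he x (le_of_lt hx)
        positivity
    have h := hmono (mem_Ici.2 le_rfl) (mem_Ici.2 hr) hr
    have h0 : deriv ρ r₁ * (r₁ - σ) - ρ r₁ = 0 := by
      have := hq r₁ le_rfl
      rw [hσ]; field_simp; ring
    simp only at h
    linarith
  -- the change of variables
  set τ := Real.log (r₁ + 1 - σ) + L with hτ
  set r₃ := σ + Real.exp (τ + L) with hr₃
  set u : ℝ → ℝ := fun r => (Real.log (r - σ) - τ) / L with hu
  have hu2 : u (r₁+1) = -1 := by simp only [hu, hτ]; field_simp; ring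
  have hu3 : u r₃ = 1 := by simp only [hu, hr₃, add_sub_cancel_left, Real.log_exp, div_self hL.ne']
  have humono : ∀ x y, r₁ ≤ x → x < y → u x < u y := by
    intro x y hx hxy
    simp only [hu]
    have := Real.log_lt_log (he x hx) (by linarith : x - σ < y - σ)
    gcongr
  have hr23 : r₁ + 1 < r₃ := by
    rw [hr₃]
    have : Real.exp (Real.log (r₁+1-σ)) < Real.exp (τ+L) := Real.exp_lt_exp.2 (by rw [hτ]; linarith)
    rw [Real.exp_log (by linarith)] at this
    linarith
  have hud : ∀ r, r₁ ≤ r → HasDerivAt u (1/(L*(r-σ))) r := by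
    intro r hr
    have := ((((hasDerivAt_id r).sub_const σ).log (he r hr).ne').sub_const τ).div_const L
    refine HasDerivAt.congr_deriv this ?_
    have := he r hr
    simp only [id]
    field_simp
  set g : ℝ → ℝ := fun r => Real.sqrt ((r - σ) / ρ r ^ (k+2)) with hg
  set f : ℝ → ℝ := fun r => if r ≤ r₁ then 0 else g r * χ (u r) with hf
  have hf1 : ∀ r, r₁ < r → f r = g r * χ (u r) := fun r hr => by simp [hf, hr]
  have hf1' : ∀ r, r₁ < r → f =ᶠ[nhds r] fun r => g r * χ (u r) := fun r hr => by
    filter_upwards [lt_mem_nhds hr] with x hx using hf1 x hx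
  have hf0 : ∀ r, r ∉ Icc (r₁+1) r₃ → f r = 0 := by
    intro r hr
    by_cases h : r ≤ r₁
    · simp [hf, h]
    · push Not at h
      rw [hf1 r h, hχ0, mul_zero]
      rintro ⟨h1, h2⟩
      apply hr
      constructor
      · by_contra h3
        push Not at h3
        have := humono _ _ h.le h3
        linarith
      · by_contra h3
        push Not at h3
        have := humono _ _ (by linarith) h3
        linarith
  have hsupp : tsupport f ⊆ Icc (r₁+1) r₃ := by
    apply closure_minimal _ isClosed_Icc
    intro r hr
    by_contra h
    exact hr (hf0 r h)
  have hcs : HasCompactSupport f := HasCompactSupport.of_support_subset_isCompact isCompact_Icc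
    ((subset_tsupport f).trans hsupp)
  have hfC : ContDiff ℝ 1 f := by
    rw [contDiff_iff_contDiffAt]
    intro r
    by_cases h : r < r₁ + 1
    · have : f =ᶠ[nhds r] fun _ => 0 := by
        filter_upwards [gt_mem_nhds h] with x hx
        exact hf0 x (fun hx' => absurd hx'.1 (not_le.2 hx))
      exact contDiffAt_const.congr_of_eventuallyEq this
    · push Not at h
      have hr : r₁ ≤ r := by linarith
      refine ContDiffAt.congr_of_eventuallyEq ?_ (hf1' r (by linarith))
      have h1 : ContDiffAt ℝ 1 ρ r := (hρ.of_le (by norm_num)).contDiffAt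
      have hpr := hp r hr
      have her := he r hr
      have h2 : ContDiffAt ℝ 1 g r := by
        refine ContDiffAt.sqrt ?_ (by positivity)
        exact (contDiffAt_id.sub contDiffAt_const).div (h1.pow _) (by positivity)
      have h3 : ContDiffAt ℝ 1 u r := by
        refine ContDiffAt.div_const (ContDiffAt.sub ?_ contDiffAt_const) _
        exact (contDiffAt_id.sub contDiffAt_const).log her.ne'
      exact h2.mul (ContDiffAt.comp r (hχ.of_le (by norm_num)).contDiffAt h3)
  have hfc : Continuous f := hfC.continuous
  have hf'c : Continuous (deriv f) := hfC.continuous_deriv (by norm_num)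
  have hρc : Continuous ρ := hρ.continuous
  have hχd : Continuous (deriv χ) := hχ.continuous_deriv (by norm_num)
  refine ⟨f, hfC.lipschitzWith_of_hasCompactSupport hcs (by norm_num), hcs,
    fun r hr => ?_, ?_⟩
  · have := (hsupp hr).1
    simp only [mem_Ioi]; linarith
  have hderiv : ∀ r, r₁ < r → deriv f r =
      g r * ((deriv χ (u r) / L) / (r-σ) + (1/(2*(r-σ)) - (k+2)*deriv ρ r/(2*ρ r))*χ (u r)) := by
    intro r hr
    rw [(hf1' r hr).deriv_eq]
    have h1 := weight_deriv k ρ σ r _ (hρd r).hasDerivAt (hp r hr.le) (he r hr.le)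
    have h2 : HasDerivAt (fun r => χ (u r)) _ r :=
      ((hχ.differentiable (by norm_num)) (u r)).hasDerivAt.comp r (hud r hr.le)
    have h3 : HasDerivAt (fun r => g r * χ (u r)) _ r := h1.mul h2
    rw [h3.deriv]
    have := he r hr.le
    simp only [hg]
    field_simp
    ring
  set F : ℝ → ℝ := fun r => ((deriv f r) ^ 2 * (ρ r) ^ (k+2)
        + a * ((k : ℝ) + 2) * ((k : ℝ) + 1) * (deriv ρ r) ^ 2 * (ρ r) ^ k * (f r) ^ 2
        + 4 * a * ((k : ℝ) + 2) * (deriv ρ r) * (ρ r) ^ (k+1) * (f r) * (deriv f r)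
        + a * c * (ρ r) ^ k * (f r) ^ 2) with hF
  have hFc : Continuous F := by fun_prop
  have hFle : ∀ r ∈ Icc (r₁+1) r₃, F r ≤
      L * (((fun v => C/L^2*(deriv χ v)^2 - m*(χ v)^2) ∘ u) r * (1/(L*(r-σ)))) := by
    intro r hr
    have h1 : r₁ < r := by linarith [hr.1]
    have her := he r h1.le
    have hpr := hp r h1.le
    simp only [hF]
    rw [hderiv r h1, hf1 r h1, integrand_aux k a c (r-σ) (ρ r) (deriv ρ r) (g r) (χ (u r))
      (deriv χ (u r) / L) her hpr (hq r h1.le) (Real.sq_sqrt (by positivity))]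
    have h2 := halg _ (χ (u r)) (deriv χ (u r) / L) _ (hy r h1.le) (hκ' r h1.le)
    refine (mul_le_mul_of_nonneg_left h2 (by positivity)).trans (le_of_eq ?_)
    simp only [Function.comp]
    field_simp
  have hsub : Ioc (r₁+1) r₃ ⊆ Ioi 0 := fun r hr => by
    have := hr.1
    simp only [mem_Ioi]; linarith
  have hred : ∫ r in Ioi (0:ℝ), F r = ∫ r in (r₁+1)..r₃, F r := by
    rw [intervalIntegral.integral_of_le hr23.le, ← integral_Icc_eq_integral_Ioc]
    apply setIntegral_eq_of_subset_of_forall_sdiff_eq_zero measurableSet_Ioi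
    · intro r hr
      have := hr.1
      simp only [mem_Ioi]; linarith
    · intro r hr
      have h1 : r ∉ tsupport f := fun h => hr.2 (hsupp h)
      have h2 : f r = 0 := image_eq_zero_of_notMem_tsupport h1
      have h3 : deriv f r = 0 := by
        by_contra h
        exact h1 (support_deriv_subset h)
      simp [hF, h2, h3]
  rw [hred]
  have hχc : Continuous χ := hχ.continuous
  have huIcc : uIcc (r₁+1) r₃ = Icc (r₁+1) r₃ := uIcc_of_le hr23.le
  have hucont : ContinuousOn u (Icc (r₁+1) r₃) := fun r hr =>
    (hud r (by linarith [hr.1])).continuousAt.continuousWithinAt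
  have hu'cont : ContinuousOn (fun r => 1/(L*(r-σ))) (Icc (r₁+1) r₃) := by
    refine ContinuousOn.div (by fun_prop) (by fun_prop) (fun r hr => ?_)
    have := he r (by linarith [hr.1])
    positivity
  have hHc : Continuous (fun v => C/L^2*(deriv χ v)^2 - m*(χ v)^2) := by fun_prop
  have hcv : ∫ r in (r₁+1)..r₃, ((fun v => C/L^2*(deriv χ v)^2 - m*(χ v)^2) ∘ u) r * (1/(L*(r-σ)))
      = ∫ v in (-1:ℝ)..1, (C/L^2*(deriv χ v)^2 - m*(χ v)^2) := by
    have key := intervalIntegral.integral_comp_mul_deriv (a := r₁+1) (b := r₃) (f := u)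
      (f' := fun r => 1/(L*(r-σ))) (g := fun v => C/L^2*(deriv χ v)^2 - m*(χ v)^2) ?_ ?_ hHc
    · rw [hu2, hu3] at key
      exact key
    · intro r hr
      rw [huIcc] at hr
      exact hud r (by linarith [hr.1])
    · rw [huIcc]; exact hu'cont
  calc ∫ r in (r₁+1)..r₃, F r ≤ ∫ r in (r₁+1)..r₃,
        L * (((fun v => C/L^2*(deriv χ v)^2 - m*(χ v)^2) ∘ u) r * (1/(L*(r-σ)))) := by
        apply intervalIntegral.integral_mono_on hr23.le (hFc.intervalIntegrable _ _) _ hFle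
        apply ContinuousOn.intervalIntegrable
        rw [huIcc]
        exact continuousOn_const.mul ((hHc.comp_continuousOn hucont).mul hu'cont)
    _ = L * ∫ v in (-1:ℝ)..1, (C/L^2*(deriv χ v)^2 - m*(χ v)^2) := by
        rw [intervalIntegral.integral_const_mul, hcv]
    _ < 0 := mul_neg_of_pos_of_neg hL hχi
end

section
/- Let Q₀ > 0 and let g : [Q₀, ∞) → ℝ be continuous with g(r) > 0 for all r ≥ Q₀, and suppose ∫_{Q₀}^V r·g(r)² dr → ∞ as V → ∞. Then for every C > 0 there exists V > Q₀ such that ∫_{Q₀}^V r·g(r)² dr > C·V·g(V). -/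
open MeasureTheory Filter Set

/-- Growth claim: if `∫_{Q₀}^V r g(r)² dr → ∞`, then for every `C > 0` there is `V > Q₀`
with `∫_{Q₀}^V r g(r)² dr > C·V·g(V)`. -/
theorem stmt_7 (Q₀ : ℝ) (hQ₀ : 0 < Q₀) (g : ℝ → ℝ)
    (hg : ContinuousOn g (Set.Ici Q₀))
    (hgpos : ∀ r ≥ Q₀, 0 < g r)
    (hdiv : Tendsto (fun V => ∫ r in Q₀..V, r * (g r) ^ 2) atTop atTop) :
    ∀ C > (0 : ℝ), ∃ V > Q₀, C * V * g V < ∫ r in Q₀..V, r * (g r) ^ 2 := by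
  intro C hC
  by_contra! hcon
  have hf : ContinuousOn (fun r => r * (g r) ^ 2) (Set.Ici Q₀) :=
    continuousOn_id.mul (hg.pow 2)
  have hder : ∀ V, Q₀ < V →
      HasDerivAt (fun V => ∫ r in Q₀..V, r * (g r) ^ 2) (V * (g V) ^ 2) V := by
    intro V hV
    apply intervalIntegral.integral_hasDerivAt_right
    · apply ContinuousOn.intervalIntegrable
      apply hf.mono
      rw [Set.uIcc_of_le hV.le]
      exact Set.Icc_subset_Ici_self
    · exact (hf.mono Set.Ioi_subset_Ici_self).stronglyMeasurableAtFilter isOpen_Ioi V hV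
    · exact hf.continuousAt (Ici_mem_nhds hV)
  set h : ℝ → ℝ := fun V => ∫ r in Q₀..V, r * (g r) ^ 2 with hh
  obtain ⟨A, hA⟩ := eventually_atTop.1 (hdiv.eventually_ge_atTop 1)
  set B := max A (Q₀ + 1) with hB
  have hBA : A ≤ B := le_max_left _ _
  have hBQ : Q₀ + 1 ≤ B := le_max_right _ _
  have hh1 : ∀ V, B ≤ V → 1 ≤ h V := fun V hV => hA V (hBA.trans hV)
  have hF : ∀ V, B ≤ V → HasDerivAt (fun V => -(h V)⁻¹ - Real.log V / C ^ 2)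
      (-(-(V * (g V) ^ 2) / (h V) ^ 2) - V⁻¹ / C ^ 2) V := by
    intro V hV
    have h1 := hh1 V hV
    have hV0 : V ≠ 0 := by linarith
    exact (((hder V (by linarith)).inv (by linarith : h V ≠ 0)).neg).sub
      ((Real.hasDerivAt_log hV0).div_const _)
  have hmono : MonotoneOn (fun V => -(h V)⁻¹ - Real.log V / C ^ 2) (Set.Ici B) := by
    apply monotoneOn_of_deriv_nonneg (convex_Ici B)
    · exact fun V hV => (hF V hV).continuousAt.continuousWithinAt
    · intro V hV
      rw [interior_Ici] at hV
      exact (hF V (le_of_lt hV)).differentiableAt.differentiableWithinAt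
    · intro V hV
      rw [interior_Ici] at hV
      have hV : B ≤ V := le_of_lt hV
      rw [(hF V hV).deriv]
      have h1 := hh1 V hV
      have hV0 : 0 < V := by linarith
      have hc : h V ≤ C * V * g V := hcon V (by linarith)
      have hsq : h V ^ 2 ≤ (C * V * g V) ^ 2 := by gcongr
      have hpos : 0 < h V ^ 2 := by positivity
      rw [neg_div, neg_neg, sub_nonneg, inv_eq_one_div, div_div,
        div_le_div_iff₀ (by positivity) hpos]
      nlinarith
  obtain ⟨V, hV1, hV2⟩ := ((Real.tendsto_log_atTop.eventually_gt_atTop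
    (-C ^ 2 * (-(h B)⁻¹ - Real.log B / C ^ 2))).and (eventually_ge_atTop B)).exists
  have hm := hmono (Set.mem_Ici.2 le_rfl) (Set.mem_Ici.2 hV2) hV2
  simp only at hm
  have hi : 0 < (h V)⁻¹ := inv_pos.2 (by linarith [hh1 V hV2])
  have hle : Real.log V / C ^ 2 ≤ -(-(h B)⁻¹ - Real.log B / C ^ 2) := by linarith
  rw [div_le_iff₀ (by positivity)] at hle
  linarith
end

section
/- Let 0 < R ≤ T be real numbers and let ρ : ℝ → ℝ be twice continuously differentiable on [R, T] with ρ(r) > 0, ρ''(r) ≥ 0, and r·ρ'(r) ≥ ρ(r) for all r ∈ [R, T], and ρ(T) = 2ρ(R). Then ∫_R^T r·ρ(r)^{−2}·ρ'(r)² dr ≤ log 2 + T·ρ(T)^{−1}·ρ'(T). -/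
open MeasureTheory Filter Set

/-- Integral estimate over the cutoff interval: if `ρ > 0`, `ρ'' ≥ 0`, `r·ρ' ≥ ρ` on
`[R,T]` and `ρ(T) = 2ρ(R)`, then `∫_R^T r ρ(r)⁻² ρ'(r)² dr ≤ log 2 + T ρ(T)⁻¹ ρ'(T)`. -/
theorem stmt_8 (R T : ℝ) (hR : 0 < R) (hRT : R ≤ T) (ρ : ℝ → ℝ)
    (hρ : ContDiffOn ℝ 2 ρ (Set.Icc R T))
    (hpos : ∀ r ∈ Set.Icc R T, 0 < ρ r)
    (hconv : ∀ r ∈ Set.Icc R T, 0 ≤ deriv (deriv ρ) r)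
    (hineq : ∀ r ∈ Set.Icc R T, ρ r ≤ r * deriv ρ r)
    (hT : ρ T = 2 * ρ R) :
    ∫ r in R..T, r * ((ρ r)⁻¹) ^ 2 * (deriv ρ r) ^ 2
      ≤ Real.log 2 + T * (ρ T)⁻¹ * deriv ρ T := by
  have hmR : R ∈ Icc R T := ⟨le_refl _, hRT⟩
  have hmT : T ∈ Icc R T := ⟨hRT, le_refl _⟩
  have hρR := hpos R hmR
  have hlt : R < T := by
    rcases hRT.lt_or_eq with h | h
    · exact h
    · rw [← h] at hT; linarith
  have hd0 : ∀ r ∈ Icc R T, 0 < deriv ρ r := by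
    intro r hr
    have h1 := hpos r hr
    have h2 := hineq r hr
    have h3 : 0 < r := hR.trans_le hr.1
    by_contra h
    push Not at h
    nlinarith
  have hda : ∀ r ∈ Icc R T, DifferentiableAt ℝ ρ r := fun r hr =>
    differentiableAt_of_deriv_ne_zero (hd0 r hr).ne'
  have hu : UniqueDiffOn ℝ (Icc R T) := uniqueDiffOn_Icc hlt
  have hC : ContDiffOn ℝ 1 (deriv ρ) (Icc R T) := by
    have h : ContDiffOn ℝ 1 (derivWithin ρ (Icc R T)) (Icc R T) :=
      hρ.derivWithin hu (by norm_num)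
    exact h.congr fun r hr => ((hda r hr).derivWithin (hu r hr)).symm
  have hcd : ContinuousOn (deriv ρ) (Icc R T) := hC.continuousOn
  have hc : ContinuousOn ρ (Icc R T) := hρ.continuousOn
  have hmono : MonotoneOn (deriv ρ) (Icc R T) :=
    monotoneOn_of_deriv_nonneg (convex_Icc R T) hcd
      ((hC.differentiableOn (by norm_num)).mono interior_subset)
      (fun r hr => hconv r (interior_subset hr))
  have hne : ∀ r ∈ Icc R T, ρ r ≠ 0 := fun r hr => (hpos r hr).ne'
  set M := deriv ρ T with hM
  have hM0 : 0 < M := hd0 T hmT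
  have hder : ∀ r ∈ uIcc R T, HasDerivAt (fun r => Real.log (ρ r) - M * (r / ρ r))
      (deriv ρ r / ρ r - M * ((1 * ρ r - r * deriv ρ r) / ρ r ^ 2)) r := by
    intro r hr
    rw [uIcc_of_le hRT] at hr
    have h := (hda r hr).hasDerivAt
    exact (h.log (hne r hr)).sub (((hasDerivAt_id r).div h (hne r hr)).const_mul M)
  have hi1 : IntervalIntegrable
      (fun r => deriv ρ r / ρ r - M * ((1 * ρ r - r * deriv ρ r) / ρ r ^ 2)) volume R T := by
    apply ContinuousOn.intervalIntegrable
    rw [uIcc_of_le hRT]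
    refine (hcd.div hc hne).sub (continuousOn_const.mul (ContinuousOn.div ?_ (hc.pow 2) ?_))
    · exact (continuousOn_const.mul hc).sub (continuousOn_id.mul hcd)
    · exact fun r hr => pow_ne_zero 2 (hne r hr)
  have hi2 : IntervalIntegrable
      (fun r => r * ((ρ r)⁻¹) ^ 2 * (deriv ρ r) ^ 2) volume R T := by
    apply ContinuousOn.intervalIntegrable
    rw [uIcc_of_le hRT]
    exact (continuousOn_id.mul ((hc.inv₀ hne).pow 2)).mul (hcd.pow 2)
  have hle := intervalIntegral.integral_mono_on hRT hi2 hi1 (by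
    intro r hr
    have h1 := hpos r hr
    have h2 := hineq r hr
    have h3 : deriv ρ r ≤ M := hmono hr hmT hr.2
    have h4 : deriv ρ r / ρ r - M * ((1 * ρ r - r * deriv ρ r) / ρ r ^ 2)
        - r * ((ρ r)⁻¹) ^ 2 * (deriv ρ r) ^ 2
        = (M - deriv ρ r) * (r * deriv ρ r - ρ r) / ρ r ^ 2 := by
      field_simp
      ring
    have h5 : 0 ≤ (M - deriv ρ r) * (r * deriv ρ r - ρ r) / ρ r ^ 2 :=
      div_nonneg (mul_nonneg (by linarith) (by linarith)) (by positivity)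
    linarith)
  rw [intervalIntegral.integral_eq_sub_of_hasDerivAt hder hi1] at hle
  refine hle.trans ?_
  rw [hT, Real.log_mul (by norm_num) hρR.ne']
  have h6 : T * (2 * ρ R)⁻¹ * M + M * (T / (2 * ρ R)) - M * (R / ρ R)
      = M * (T - R) / ρ R := by
    field_simp
    ring
  have h7 : 0 ≤ M * (T - R) / ρ R :=
    div_nonneg (mul_nonneg hM0.le (by linarith)) hρR.le
  linarith
end

section
/- Let n ≥ 3 be an integer, α > 1 a real number, c a real number, and 0 < C₁ ≤ C₂ real constants. Let ρ : ℝ → ℝ be continuously differentiable with ρ(r) > 0 for all r > 0 and C₁·r^α ≤ ρ(r) ≤ C₂·r^α for all r ≥ 1. Then for every real a > (nα−α−1)²/(4α(n−1)(nα−2)) there exists a Lipschitz function f : ℝ → ℝ with compact support contained in (0, ∞) such that ∫_0^∞ [ f'(r)² ρ(r)^{n−1} + a(n−1)(n−2) ρ'(r)² ρ(r)^{n−3} f(r)² + 4a(n−1) ρ'(r) ρ(r)^{n−2} f(r) f'(r) + a·c·ρ(r)^{n−3} f(r)² ] dr < 0, where f' denotes the almost-everywhere derivative of f. -/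
open MeasureTheory Filter Set

/-- The radial integrand, with `n = N + 3`. -/
noncomputable def radJ (N : ℕ) (ρ f : ℝ → ℝ) (a c : ℝ) (r : ℝ) : ℝ :=
  (deriv f r) ^ 2 * (ρ r) ^ (N + 2)
    + a * ((N : ℝ) + 2) * ((N : ℝ) + 1) * (deriv ρ r) ^ 2 * (ρ r) ^ N * (f r) ^ 2
    + 4 * a * ((N : ℝ) + 2) * (deriv ρ r) * (ρ r) ^ (N + 1) * (f r) * (deriv f r)
    + a * c * (ρ r) ^ N * (f r) ^ 2

lemma exists_cutoff : ∃ χ : ℝ → ℝ, ContDiff ℝ 1 χ ∧ (∀ y, y ≤ 1 → χ y = 0) ∧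
    (∀ y, 2 ≤ y → χ y = 0) ∧ (∀ y ∈ Ioo (1:ℝ) 2, 0 < χ y) ∧ (∀ y, |χ y| ≤ 1) ∧
    ∃ M : ℝ, 0 ≤ M ∧ ∀ y, |deriv χ y| ≤ M := by
  let b : ContDiffBump (3/2 : ℝ) := ⟨1/4, 1/2, by norm_num, by norm_num⟩
  have hb : b.rOut = 1/2 := rfl
  have hd : ContDiff ℝ 1 (b : ℝ → ℝ) := b.contDiff
  refine ⟨b, hd, ?_, ?_, ?_, ?_, ?_⟩
  · intro y hy
    apply b.zero_of_le_dist
    rw [hb, Real.dist_eq, abs_of_nonpos] <;> linarith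
  · intro y hy
    apply b.zero_of_le_dist
    rw [hb, Real.dist_eq, abs_of_nonneg] <;> linarith
  · intro y hy
    apply b.pos_of_mem_ball
    rw [Metric.mem_ball, hb, Real.dist_eq, abs_lt]
    constructor <;> linarith [hy.1, hy.2]
  · intro y
    rw [abs_of_nonneg b.nonneg]
    exact b.le_one
  · have hc : HasCompactSupport (deriv (b : ℝ → ℝ)) := b.hasCompactSupport.deriv
    obtain ⟨C, hC⟩ := (hd.continuous_deriv le_rfl).bounded_above_of_compact_support hc
    exact ⟨C, (norm_nonneg _).trans (hC 0), fun y => by simpa using hC y⟩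

/-- Pointwise algebraic identity/inequality. -/
lemma pointwise_alg (m a c α q s t B δ k r g p P φ φ1 p1 p2 M : ℝ)
    (hr : 0 < r) (hk : 1 ≤ k) (hq0 : q ≠ 0) (hs : s = 2 * a * m)
    (hB : B = a * m * (4 * a * m - m + 1)) (hB0 : 0 ≤ B)
    (hδ : δ = B * α ^ 2 - t ^ 2) (hδ0 : 0 < δ) (hp1 : 0 < p1) (hP1 : p1 ≤ P) (hP2 : P ≤ p2)
    (hM : 0 ≤ M) (hφ : |φ| ≤ 1) (hφ1 : |φ1| ≤ M)
    (hsmall : a * c * r ^ 2 / p ^ 2 ≤ δ / 2) :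
    P * r * ((-s * g * φ - t / r * φ + φ1 / (k * r)) ^ 2 + a * m * (m - 1) * g ^ 2 * φ ^ 2
      + 4 * a * m * g * φ * (-s * g * φ - t / r * φ + φ1 / (k * r)) + a * c / p ^ 2 * φ ^ 2) ≤
    -(B * α / q) * (P * (2 * q * (g - α / r)) * φ ^ 2 + P * (2 * φ * (φ1 / (k * r))))
      + (-(δ / 2 * p1) * (φ ^ 2 / r)
      + ((M ^ 2 + |2 * B * α / q - 2 * t| * M) * p2 / k) / r) := by
  have hk0 : 0 < k := by linarith
  have hPpos : 0 < P := hp1.trans_le hP1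
  set D := 2 * B * α / q - 2 * t with hD
  have e1 : P * r * ((-s * g * φ - t / r * φ + φ1 / (k * r)) ^ 2 + a * m * (m - 1) * g ^ 2 * φ ^ 2
      + 4 * a * m * g * φ * (-s * g * φ - t / r * φ + φ1 / (k * r)) + a * c / p ^ 2 * φ ^ 2)
      = -(B * α / q) * (P * (2 * q * (g - α / r)) * φ ^ 2 + P * (2 * φ * (φ1 / (k * r))))
        + P / r * (-δ * φ ^ 2 + φ1 ^ 2 / k ^ 2 + D * (φ * φ1 / k)
          + a * c * r ^ 2 / p ^ 2 * φ ^ 2 - B * (g * r - α) ^ 2 * φ ^ 2) := by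
    have : a * c * r ^ 2 / p ^ 2 = a * c / p ^ 2 * r ^ 2 := by ring
    rw [this]
    generalize a * c / p ^ 2 = z
    subst hs
    rw [hδ, hD]
    subst hB
    field_simp
    ring
  rw [e1]
  have hb : φ1 ^ 2 / k ^ 2 + D * (φ * φ1 / k) ≤ (M ^ 2 + |D| * M) / k := by
    have h1 : φ1 ^ 2 ≤ M ^ 2 := sq_le_sq' (by linarith [abs_le.1 hφ1]) (abs_le.1 hφ1).2
    have h2 : φ1 ^ 2 / k ^ 2 ≤ M ^ 2 / k := by
      apply div_le_div₀ (by positivity) h1 hk0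
      nlinarith
    have h3 : D * (φ * φ1 / k) ≤ |D| * M / k := by
      rw [← mul_div_assoc]
      apply div_le_div_of_nonneg_right _ hk0.le
      calc D * (φ * φ1) ≤ |D * (φ * φ1)| := le_abs_self _
        _ = |D| * (|φ| * |φ1|) := by rw [abs_mul, abs_mul]
        _ ≤ |D| * (1 * M) := by gcongr
        _ = |D| * M := by ring
    rw [add_div]; linarith
  have hbr : -δ * φ ^ 2 + φ1 ^ 2 / k ^ 2 + D * (φ * φ1 / k)
          + a * c * r ^ 2 / p ^ 2 * φ ^ 2 - B * (g * r - α) ^ 2 * φ ^ 2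
      ≤ -(δ / 2) * φ ^ 2 + (M ^ 2 + |D| * M) / k := by
    have h4 := mul_le_mul_of_nonneg_right hsmall (sq_nonneg φ)
    have h5 : 0 ≤ B * (g * r - α) ^ 2 * φ ^ 2 := by positivity
    linarith
  have h6 : P / r * (-δ * φ ^ 2 + φ1 ^ 2 / k ^ 2 + D * (φ * φ1 / k)
          + a * c * r ^ 2 / p ^ 2 * φ ^ 2 - B * (g * r - α) ^ 2 * φ ^ 2)
      ≤ P / r * (-(δ / 2) * φ ^ 2 + (M ^ 2 + |D| * M) / k) :=
    mul_le_mul_of_nonneg_left hbr (by positivity)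
  have h7 : p1 * (δ / 2 * φ ^ 2 / r) ≤ P * (δ / 2 * φ ^ 2 / r) :=
    mul_le_mul_of_nonneg_right hP1 (by positivity)
  have h8 : P * ((M ^ 2 + |D| * M) / k / r) ≤ p2 * ((M ^ 2 + |D| * M) / k / r) :=
    mul_le_mul_of_nonneg_right hP2 (by positivity)
  have e2 : P / r * (-(δ / 2) * φ ^ 2 + (M ^ 2 + |D| * M) / k)
    = - (P * (δ / 2 * φ ^ 2 / r)) + P * ((M ^ 2 + |D| * M) / k / r) := by ring
  have e3 : (-(δ / 2 * p1) * (φ ^ 2 / r) + ((M ^ 2 + |D| * M) * p2 / k) / r)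
    = - (p1 * (δ / 2 * φ ^ 2 / r)) + p2 * ((M ^ 2 + |D| * M) / k / r) := by ring
  rw [e3]
  linarith

lemma radJ_eq (N : ℕ) (ρ f : ℝ → ℝ) (a c r s t q α φ w : ℝ) (hr : 0 < r) (hp : 0 < ρ r)
    (hs : 2 * q = (N : ℝ) + 2 - 2 * s) (ht : t = α * q - 1 / 2)
    (hf : f r = Real.exp (-s * Real.log (ρ r) - t * Real.log r) * φ)
    (hf' : deriv f r = Real.exp (-s * Real.log (ρ r) - t * Real.log r) * w) :
    radJ N ρ f a c r = Real.exp (2 * q * (Real.log (ρ r) - α * Real.log r)) * r *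
      (w ^ 2 + a * ((N : ℝ) + 2) * ((N : ℝ) + 2 - 1) * (deriv ρ r / ρ r) ^ 2 * φ ^ 2
      + 4 * a * ((N : ℝ) + 2) * (deriv ρ r / ρ r) * φ * w + a * c / (ρ r) ^ 2 * φ ^ 2) := by
  have key : Real.exp (2 * q * (Real.log (ρ r) - α * Real.log r)) * r
      = ρ r ^ N * ρ r ^ 2 * Real.exp (-s * Real.log (ρ r) - t * Real.log r) ^ 2 := by
    have h1 : ρ r ^ N * ρ r ^ 2 = Real.exp (((N : ℝ) + 2) * Real.log (ρ r)) := by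
      rw [← pow_add, ← Real.exp_log (pow_pos hp (N + 2)), Real.log_pow]
      push_cast; rfl
    have h2 : Real.exp (2 * q * (Real.log (ρ r) - α * Real.log r)) * r
        = Real.exp (2 * q * (Real.log (ρ r) - α * Real.log r) + Real.log r) := by
      rw [Real.exp_add, Real.exp_log hr]
    rw [h1, h2, ← Real.exp_nat_mul, ← Real.exp_add]
    congr 1
    subst ht
    have : s = ((N : ℝ) + 2) / 2 - q := by linarith
    subst this
    push_cast
    ring
  rw [key, radJ, hf, hf']
  field_simp
  ring

lemma radJ_continuous (N : ℕ) (ρ f : ℝ → ℝ) (a c : ℝ) (hρ : ContDiff ℝ 1 ρ)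
    (hf : ContDiff ℝ 1 f) : Continuous (radJ N ρ f a c) := by
  have h1 := hρ.continuous
  have h2 := hf.continuous
  have h3 := hρ.continuous_deriv le_rfl
  have h4 := hf.continuous_deriv le_rfl
  unfold radJ
  fun_prop

lemma P_bounds (α C₁ C₂ q r p : ℝ) (hr : 0 < r) (hC₁ : 0 < C₁)
    (h1 : C₁ * r ^ α ≤ p) (h2 : p ≤ C₂ * r ^ α) :
    Real.exp (-(2 * |q| * max |Real.log C₁| |Real.log C₂|))
      ≤ Real.exp (2 * q * (Real.log p - α * Real.log r)) ∧
    Real.exp (2 * q * (Real.log p - α * Real.log r))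
      ≤ Real.exp (2 * |q| * max |Real.log C₁| |Real.log C₂|) := by
  have hrα : 0 < r ^ α := Real.rpow_pos_of_pos hr α
  have hp : 0 < p := (mul_pos hC₁ hrα).trans_le h1
  have hC₂ : 0 < C₂ := by
    by_contra h
    have := mul_nonpos_of_nonpos_of_nonneg (not_lt.1 h) hrα.le
    linarith
  have l1 : Real.log C₁ + α * Real.log r ≤ Real.log p := by
    rw [← Real.log_rpow hr, ← Real.log_mul hC₁.ne' hrα.ne']
    exact Real.log_le_log (by positivity) h1
  have l2 : Real.log p ≤ Real.log C₂ + α * Real.log r := by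
    rw [← Real.log_rpow hr, ← Real.log_mul hC₂.ne' hrα.ne']
    exact Real.log_le_log hp h2
  have hy : |Real.log p - α * Real.log r| ≤ max |Real.log C₁| |Real.log C₂| :=
    abs_le_max_abs_abs (by linarith) (by linarith)
  have : |2 * q * (Real.log p - α * Real.log r)|
      ≤ 2 * |q| * max |Real.log C₁| |Real.log C₂| := by
    rw [abs_mul, abs_mul, abs_two]
    gcongr
  rw [abs_le] at this
  exact ⟨Real.exp_le_exp.2 this.1, Real.exp_le_exp.2 this.2⟩

lemma small_term (α C₁ e ε : ℝ) (hα : 1 < α) (hC₁ : 0 < C₁) (hε : 0 < ε) :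
    ∃ R : ℝ, 1 ≤ R ∧ ∀ r ≥ R, ∀ p, C₁ * r ^ α ≤ p → e * r ^ 2 / p ^ 2 ≤ ε := by
  have h1 : Tendsto (fun r : ℝ => |e| / C₁ ^ 2 * (r ^ (-(α - 1))) ^ 2) atTop
      (nhds (|e| / C₁ ^ 2 * 0 ^ 2)) :=
    ((tendsto_rpow_neg_atTop (by linarith)).pow 2).const_mul _
  have h2 : ∀ᶠ r : ℝ in atTop, |e| / C₁ ^ 2 * (r ^ (-(α - 1))) ^ 2 < ε :=
    h1.eventually (gt_mem_nhds (by simpa using hε))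
  obtain ⟨R, hR⟩ := eventually_atTop.1 h2
  refine ⟨max R 1, le_max_right _ _, fun r hr p hp => ?_⟩
  have hr1 : 1 ≤ r := (le_max_right _ _).trans hr
  have hr0 : 0 < r := by linarith
  have hrα : 0 < r ^ α := Real.rpow_pos_of_pos hr0 α
  have h3 := hR r ((le_max_left _ _).trans hr)
  have h4 : r ^ (-(α - 1)) = r / r ^ α := by
    rw [neg_sub, Real.rpow_sub hr0, Real.rpow_one]
  rw [h4] at h3
  calc e * r ^ 2 / p ^ 2 ≤ |e| * r ^ 2 / (C₁ * r ^ α) ^ 2 := by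
        have := le_abs_self e
        gcongr
    _ = |e| / C₁ ^ 2 * (r / r ^ α) ^ 2 := by field_simp
    _ ≤ ε := h3.le

lemma core (N : ℕ) (α c C₁ C₂ : ℝ) (hα : 1 < α)
    (hC₁ : 0 < C₁)
    (ρ : ℝ → ℝ) (hρ : ContDiff ℝ 1 ρ) (hρpos : ∀ r > (0 : ℝ), 0 < ρ r)
    (hbound : ∀ r ≥ (1 : ℝ), C₁ * r ^ α ≤ ρ r ∧ ρ r ≤ C₂ * r ^ α)
    (a m q s t B δ : ℝ) (hm : m = (N : ℝ) + 2)
    (hq0 : q ≠ 0) (hs : s = 2 * a * m) (hq : 2 * q = (N : ℝ) + 2 - 2 * s)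
    (ht : t = α * q - 1 / 2) (hB : B = a * m * (4 * a * m - m + 1)) (hB0 : 0 ≤ B)
    (hδ : δ = B * α ^ 2 - t ^ 2) (hδ0 : 0 < δ) :
    ∃ f : ℝ → ℝ, ContDiff ℝ 1 f ∧ HasCompactSupport f ∧
      tsupport f ⊆ Set.Ioi (0 : ℝ) ∧ (∫ r in Set.Ioi (0 : ℝ), radJ N ρ f a c r) < 0 := by
  obtain ⟨χ, hχ, hχ1, hχ2, hχpos, hχle, M, hM, hχM⟩ := exists_cutoff
  obtain ⟨R, hR1, hR⟩ := small_term α C₁ (a * c) (δ / 2) hα hC₁ (by linarith)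
  set p2 := Real.exp (2 * |q| * max |Real.log C₁| |Real.log C₂|) with hp2
  set p1 := Real.exp (-(2 * |q| * max |Real.log C₁| |Real.log C₂|)) with hp1
  have hp1pos : 0 < p1 := Real.exp_pos _
  have hχc : Continuous χ := hχ.continuous
  have hχ2c : Continuous (fun y => χ y ^ 2) := hχc.pow 2
  set X0 := ∫ y in (1:ℝ)..2, χ y ^ 2 with hX0
  have hX0pos : 0 < X0 := by
    apply intervalIntegral.intervalIntegral_pos_of_pos_on
    · exact hχ2c.intervalIntegrable _ _
    · intro y hy
      have := hχpos y hy
      positivity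
    · norm_num
  set M3 := (M ^ 2 + |2 * B * α / q - 2 * t| * M) * p2 with hM3
  obtain ⟨k, hk1, hkR, hkM⟩ : ∃ k : ℝ, 1 ≤ k ∧ R ≤ Real.exp k ∧ M3 < δ / 2 * p1 * X0 * k := by
    have A : Tendsto (fun k : ℝ => δ / 2 * p1 * X0 * k) atTop atTop :=
      tendsto_id.const_mul_atTop (by positivity)
    obtain ⟨k, h1, h2, h3⟩ := ((eventually_ge_atTop (1:ℝ)).and
      ((Real.tendsto_exp_atTop.eventually_ge_atTop R).and (A.eventually_gt_atTop M3))).exists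
    exact ⟨k, h1, h2, h3⟩
  have hk0 : 0 < k := by linarith
  have hek : 1 ≤ Real.exp k := hR1.trans hkR
  have he2k : Real.exp k ≤ Real.exp (2 * k) := Real.exp_le_exp.2 (by linarith)
  set E : ℝ → ℝ := fun r => Real.exp (-s * Real.log (ρ r) - t * Real.log r) with hE
  set φ : ℝ → ℝ := fun r => χ (Real.log r / k) with hφ
  set f : ℝ → ℝ := fun r => if 0 < r then E r * φ r else 0 with hf
  have hφlow : ∀ r, 0 < r → r ≤ Real.exp k → φ r = 0 := by
    intro r hr h
    apply hχ1
    rw [div_le_one hk0, Real.log_le_iff_le_exp hr]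
    exact h
  have hφhigh : ∀ r, Real.exp (2 * k) ≤ r → φ r = 0 := by
    intro r h
    apply hχ2
    rw [le_div_iff₀ hk0, Real.le_log_iff_exp_le ((Real.exp_pos _).trans_le h)]
    exact h
  have hfpos : ∀ r, 0 < r → f r = E r * φ r := fun r hr => by simp [hf, hr]
  have hflow : ∀ r, r ≤ Real.exp k → f r = 0 := by
    intro r h
    by_cases hr : 0 < r
    · rw [hfpos r hr, hφlow r hr h, mul_zero]
    · simp [hf, hr]
  have hfhigh : ∀ r, Real.exp (2 * k) ≤ r → f r = 0 := by
    intro r h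
    rw [hfpos r ((Real.exp_pos _).trans_le h), hφhigh r h, mul_zero]
  have hfC : ContDiff ℝ 1 f := by
    rw [contDiff_iff_contDiffAt]
    intro r
    by_cases hr : 0 < r
    · have h1 : ContDiffAt ℝ 1 (fun r => E r * φ r) r := by
        have hlog : ContDiffAt ℝ 1 Real.log r := Real.contDiffAt_log.2 hr.ne'
        have hlogρ : ContDiffAt ℝ 1 (fun r => Real.log (ρ r)) r :=
          hρ.contDiffAt.log (hρpos r hr).ne'
        have hEd : ContDiffAt ℝ 1 E r :=
          ((contDiffAt_const.mul hlogρ).sub (contDiffAt_const.mul hlog)).exp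
        have hφd : ContDiffAt ℝ 1 φ r :=
          ContDiffAt.comp r hχ.contDiffAt (hlog.div_const k)
        exact hEd.mul hφd
      apply h1.congr_of_eventuallyEq
      filter_upwards [lt_mem_nhds hr] with x hx using hfpos x hx
    · apply (contDiffAt_const (c := (0:ℝ))).congr_of_eventuallyEq
      filter_upwards [gt_mem_nhds (show r < Real.exp k by linarith [not_lt.1 hr])] with x hx
      exact hflow x hx.le
  have hts : tsupport f ⊆ Icc (Real.exp k) (Real.exp (2 * k)) := by
    apply closure_minimal _ isClosed_Icc
    intro x hx
    by_contra h
    apply hx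
    rw [mem_Icc, not_and_or, not_le, not_le] at h
    rcases h with h | h
    · exact hflow x h.le
    · exact hfhigh x h.le
  have hJc := radJ_continuous N ρ f a c hρ hfC
  refine ⟨f, hfC, HasCompactSupport.of_support_subset_isCompact isCompact_Icc
    (subset_closure.trans hts), fun x hx => by
      have := (hts hx).1
      exact mem_Ioi.2 (by linarith), ?_⟩
  have hint : (∫ r in Set.Ioi (0 : ℝ), radJ N ρ f a c r)
      = ∫ r in (Real.exp k)..(Real.exp (2 * k)), radJ N ρ f a c r := by
    rw [intervalIntegral.integral_of_le he2k, ← integral_Icc_eq_integral_Ioc]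
    apply setIntegral_eq_of_subset_of_forall_sdiff_eq_zero measurableSet_Ioi
    · intro x hx
      have := hx.1
      exact mem_Ioi.2 (by linarith)
    · intro x hx
      have h1 : x ∉ tsupport f := fun h => hx.2 (hts h)
      have h2 : f x = 0 := image_eq_zero_of_notMem_tsupport h1
      have h3 : deriv f x = 0 := by
        by_contra h
        exact h1 (support_deriv_subset h)
      simp [radJ, h2, h3]
  rw [hint]
  set P : ℝ → ℝ := fun r => Real.exp (2 * q * (Real.log (ρ r) - α * Real.log r)) with hP
  set H : ℝ → ℝ := fun r => -(B * α / q) * (P r * φ r ^ 2)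
    + (-(δ / 2 * p1) * (k * ∫ y in (0:ℝ)..(Real.log r / k), χ y ^ 2) + M3 / k * Real.log r) with hH
  set H' : ℝ → ℝ := fun r => -(B * α / q) * (P r * (2 * q * (deriv ρ r / ρ r - α / r)) * φ r ^ 2
      + P r * (2 * φ r * (deriv χ (Real.log r / k) / (k * r))))
    + (-(δ / 2 * p1) * (φ r ^ 2 / r) + (M3 / k) / r) with hH'
  have dlog : ∀ r, 0 < r → HasDerivAt Real.log r⁻¹ r := fun r hr => Real.hasDerivAt_log hr.ne'
  have dlogρ : ∀ r, 0 < r → HasDerivAt (fun r => Real.log (ρ r)) (deriv ρ r / ρ r) r :=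
    fun r hr => ((hρ.differentiable one_ne_zero r).hasDerivAt).log (hρpos r hr).ne'
  have dφ : ∀ r, 0 < r → HasDerivAt φ (deriv χ (Real.log r / k) / (k * r)) r := by
    intro r hr
    have h1 := ((hχ.differentiable one_ne_zero (Real.log r / k)).hasDerivAt).comp r
      ((dlog r hr).div_const k)
    convert! h1 using 1
    field_simp
  have dH : ∀ r, 0 < r → HasDerivAt H (H' r) r := by
    intro r hr
    have h1 : HasDerivAt P (P r * (2 * q * (deriv ρ r / ρ r - α * r⁻¹))) r :=
      (((dlogρ r hr).sub ((dlog r hr).const_mul α)).const_mul (2 * q)).exp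
    have h2 : HasDerivAt (fun z => ∫ y in (0:ℝ)..z, χ y ^ 2) (χ (Real.log r / k) ^ 2)
        (Real.log r / k) :=
      intervalIntegral.integral_hasDerivAt_right (hχ2c.intervalIntegrable _ _)
        hχ2c.aestronglyMeasurable.stronglyMeasurableAtFilter hχ2c.continuousAt
    have h3 := h2.comp r ((dlog r hr).div_const k)
    have h4 := ((h1.mul ((dφ r hr).pow 2)).const_mul (-(B * α / q))).add
      (((h3.const_mul k).const_mul (-(δ / 2 * p1))).add ((dlog r hr).const_mul (M3 / k)))
    convert! h4 using 1
    simp only [hH', hφ, Pi.pow_apply]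
    field_simp
    try ring
  have hle : (∫ r in (Real.exp k)..(Real.exp (2 * k)), radJ N ρ f a c r)
      ≤ H (Real.exp (2 * k)) - H (Real.exp k) := by
    apply intervalIntegral.integral_le_sub_of_hasDeriv_right_of_le he2k (g' := H')
    · intro x hx
      have := hx.1
      exact (dH x (by linarith)).continuousAt.continuousWithinAt
    · intro x hx
      have := hx.1
      exact (dH x (by linarith)).hasDerivWithinAt
    · exact hJc.continuousOn.integrableOn_Icc
    · intro r hr
      have hr1 : 1 ≤ r := hek.trans hr.1.le
      have hr0 : 0 < r := by linarith
      have hb := hbound r hr1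
      have hPb := P_bounds α C₁ C₂ q r (ρ r) hr0 hC₁ hb.1 hb.2
      have dE : HasDerivAt E (E r * (-s * (deriv ρ r / ρ r) - t * r⁻¹)) r :=
        (((dlogρ r hr0).const_mul (-s)).sub ((dlog r hr0).const_mul t)).exp
      have df : HasDerivAt f (E r * (-s * (deriv ρ r / ρ r) * φ r - t / r * φ r
          + deriv χ (Real.log r / k) / (k * r))) r := by
        have h1 := dE.mul (dφ r hr0)
        have h2 : HasDerivAt f _ r := h1.congr_of_eventuallyEq (by
          filter_upwards [lt_mem_nhds hr0] with x hx using hfpos x hx)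
        convert! h2 using 1
        ring
      rw [radJ_eq N ρ f a c r s t q α (φ r) _ hr0 (hρpos r hr0) hq ht (hfpos r hr0) df.deriv,
        ← hm]
      exact pointwise_alg m a c α q s t B δ k r (deriv ρ r / ρ r) (ρ r) (P r) (φ r)
        (deriv χ (Real.log r / k)) p1 p2 M hr0 hk1 hq0 hs hB hB0 hδ hδ0 hp1pos hPb.1 hPb.2
        hM (hχle _) (hχM _) (hR r (hkR.trans hr.1.le) _ hb.1)
  refine hle.trans_lt ?_
  have hX : (∫ y in (0:ℝ)..2, χ y ^ 2) = (∫ y in (0:ℝ)..1, χ y ^ 2) + X0 :=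
    (intervalIntegral.integral_add_adjacent_intervals (hχ2c.intervalIntegrable _ _)
      (hχ2c.intervalIntegrable _ _)).symm
  have e1 : φ (Real.exp k) = 0 := hφlow _ (Real.exp_pos _) le_rfl
  have e2 : φ (Real.exp (2 * k)) = 0 := hφhigh _ le_rfl
  have e3 : 2 * k / k = 2 := by field_simp
  have e4 : M3 / k * (2 * k) = 2 * M3 := by field_simp
  have e5 : M3 / k * k = M3 := by field_simp
  simp only [hH, e1, e2, Real.log_exp, e3, div_self hk0.ne', hX, e4, e5]
  linarith

/-- Radial formulation of the instability theorem for warping functions of polynomial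
growth: if `C₁ r^α ≤ ρ(r) ≤ C₂ r^α` for `r ≥ 1` with `α > 1`, then for every
`a > (nα-α-1)²/(4α(n-1)(nα-2))` there is a compactly supported Lipschitz test function
making the radial stability form negative. -/
theorem stmt_10 (n : ℕ) (hn : 3 ≤ n) (α c C₁ C₂ : ℝ) (hα : 1 < α)
    (hC₁ : 0 < C₁) (hC : C₁ ≤ C₂)
    (ρ : ℝ → ℝ) (hρ : ContDiff ℝ 1 ρ) (hρpos : ∀ r > (0 : ℝ), 0 < ρ r)
    (hbound : ∀ r ≥ (1 : ℝ), C₁ * r ^ α ≤ ρ r ∧ ρ r ≤ C₂ * r ^ α)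
    (a : ℝ)
    (ha : ((n : ℝ) * α - α - 1) ^ 2 / (4 * α * ((n : ℝ) - 1) * ((n : ℝ) * α - 2)) < a) :
    ∃ f : ℝ → ℝ, (∃ K, LipschitzWith K f) ∧ HasCompactSupport f ∧
      tsupport f ⊆ Set.Ioi (0 : ℝ) ∧
      (∫ r in Set.Ioi (0 : ℝ), ((deriv f r) ^ 2 * (ρ r) ^ (n - 1)
        + a * ((n : ℝ) - 1) * ((n : ℝ) - 2) * (deriv ρ r) ^ 2 * (ρ r) ^ (n - 3) * (f r) ^ 2
        + 4 * a * ((n : ℝ) - 1) * (deriv ρ r) * (ρ r) ^ (n - 2) * (f r) * (deriv f r)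
        + a * c * (ρ r) ^ (n - 3) * (f r) ^ 2)) < 0 := by
  obtain ⟨N, rfl⟩ := Nat.exists_eq_add_of_le' hn
  set T := (((N + 3 : ℕ) : ℝ) * α - α - 1) ^ 2 /
    (4 * α * (((N + 3 : ℕ) : ℝ) - 1) * (((N + 3 : ℕ) : ℝ) * α - 2)) with hT
  obtain ⟨b, hTb, hba, hb4⟩ : ∃ b, T < b ∧ b < a ∧ b ≠ 1 / 4 := by
    by_cases h : (T + a) / 2 = 1 / 4
    · exact ⟨(2 * T + a) / 3, by linarith, by linarith, by
        intro hh; linarith⟩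
    · exact ⟨(T + a) / 2, by linarith, by linarith, h⟩
  have hN : (0:ℝ) ≤ N := Nat.cast_nonneg N
  obtain ⟨m, hm⟩ : ∃ m : ℝ, m = (N : ℝ) + 2 := ⟨_, rfl⟩
  have hm2 : 2 ≤ m := by linarith
  have hden1 : 0 < (m + 1) * α - 2 := by nlinarith
  have hden : 0 < 4 * α * m * ((m + 1) * α - 2) := by positivity
  have hTm : T = (m * α - 1) ^ 2 / (4 * α * m * ((m + 1) * α - 2)) := by
    rw [hT, hm]; push_cast; congr 1 <;> ring
  have hkey : (m * α - 1) ^ 2 < b * (4 * α * m * ((m + 1) * α - 2)) := by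
    rw [hTm, div_lt_iff₀ hden] at hTb
    exact hTb
  have hb0 : 0 < b := by
    have : 0 < b * (4 * α * m * ((m + 1) * α - 2)) := (sq_nonneg _).trans_lt hkey
    exact pos_of_mul_pos_left this hden.le
  have hb1 : m - 1 < 4 * b * m := by
    have h1 : (m - 1) * (α * ((m + 1) * α - 2)) ≤ (m * α - 1) ^ 2 := by
      nlinarith [sq_nonneg (α - 1)]
    have h2 : (m - 1) * (α * ((m + 1) * α - 2)) < (4 * b * m) * (α * ((m + 1) * α - 2)) := by
      linarith
    exact lt_of_mul_lt_mul_right h2 (by positivity)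
  obtain ⟨f, hf, hfc, hfs, hneg⟩ := core N α c C₁ C₂ hα hC₁ ρ hρ hρpos hbound b m
    ((m - 4 * b * m) / 2) (2 * b * m) (α * ((m - 4 * b * m) / 2) - 1 / 2)
    (b * m * (4 * b * m - m + 1))
    (b * m * (4 * b * m - m + 1) * α ^ 2 - (α * ((m - 4 * b * m) / 2) - 1 / 2) ^ 2) hm
    (by
      intro h
      have h1 : m * (1 - 4 * b) = 0 := by linarith
      rcases mul_eq_zero.1 h1 with h | h
      · linarith
      · exact hb4 (by linarith))
    rfl (by rw [hm]; ring) rfl rfl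
    (mul_nonneg (by positivity) (by linarith)) rfl (by nlinarith)
  refine ⟨f, hf.lipschitzWith_of_hasCompactSupport hfc one_ne_zero, hfc, hfs, ?_⟩
  have hI : ∀ x, Integrable (radJ N ρ f x c) := by
    intro x
    apply (radJ_continuous N ρ f x c hρ hf).integrable_of_hasCompactSupport
    apply HasCompactSupport.of_support_subset_isCompact (K := tsupport f) hfc
    intro y hy
    by_contra h1
    have h2 : f y = 0 := image_eq_zero_of_notMem_tsupport h1
    have h3 : deriv f y = 0 := by
      by_contra h
      exact h1 (support_deriv_subset h)
    exact hy (by simp [radJ, h2, h3])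
  have hlin : (∫ r in Ioi (0:ℝ), radJ N ρ f b c r) = (1 - b / a) * (∫ r in Ioi (0:ℝ), radJ N ρ f 0 c r)
      + b / a * ∫ r in Ioi (0:ℝ), radJ N ρ f a c r := by
    rw [← integral_const_mul, ← integral_const_mul, ← integral_add
      ((hI 0).integrableOn.const_mul _) ((hI a).integrableOn.const_mul _)]
    congr 1
    ext r
    have : a ≠ 0 := by linarith
    simp only [radJ]
    field_simp
    ring
  have h0 : 0 ≤ ∫ r in Ioi (0:ℝ), radJ N ρ f 0 c r := by
    apply setIntegral_nonneg measurableSet_Ioi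
    intro r hr
    have := hρpos r hr
    simp only [radJ]
    have : 0 ≤ (deriv f r) ^ 2 * (ρ r) ^ (N + 2) := by positivity
    linarith
  have ha0 : 0 < a := by linarith
  have hba1 : b / a < 1 := (div_lt_one ha0).2 hba
  have hfin : (∫ r in Ioi (0:ℝ), radJ N ρ f a c r) < 0 := by
    by_contra h
    have h1 : 0 ≤ b / a * ∫ r in Ioi (0:ℝ), radJ N ρ f a c r :=
      mul_nonneg (by positivity) (not_lt.1 h)
    have h2 := mul_nonneg (by linarith : 0 ≤ 1 - b / a) h0
    linarith
  convert! hfin using 3 with r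
  simp only [radJ, show N + 3 - 1 = N + 2 from rfl, show N + 3 - 2 = N + 1 from rfl,
    Nat.add_sub_cancel]
  push_cast
  ring
end

section
/- Let n ≥ 3 be an integer, α ≥ 1 a real number, and c a real number. Let ξ : (0, ∞) → ℝ be continuously differentiable, positive, nonincreasing, with ξ(r) → 0 as r → ∞, and suppose there exists R₁ > 0 such that r·ξ'(r) ≥ −(α−1)·ξ(r) for all r ≥ R₁. Define ρ(r) = r^α·ξ(r) and set a = (nα−α−1)²/(4α(n−1)(nα−2)). If ∫_0^∞ [ f'(r)² ρ(r)^{n−1} + a(n−1)(n−2) ρ'(r)² ρ(r)^{n−3} f(r)² + 4a(n−1) ρ'(r) ρ(r)^{n−2} f(r) f'(r) + a·c·ρ(r)^{n−3} f(r)² ] dr ≥ 0 for every Lipschitz function f : ℝ → ℝ with compact support contained in (0, ∞) (f' the almost-everywhere derivative of f), then there exists C > 0 such that ρ(r) ≤ C·r for all r ≥ 1. -/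
open MeasureTheory Filter Set

lemma aux_alg (m α a c κ E D β G x y : ℝ) (hm : 2 ≤ m) (hα : 1 < α)
    (ha : a = (m * α - 1) ^ 2 / (4 * α * m * ((m + 1) * α - 2)))
    (hκ : κ = (m - 1) * (α - 1) / (4 * α * ((m + 1) * α - 2)))
    (hE : E = ((4 * a - 1) * m) ^ 2 / (2 * κ))
    (hD : D = |a * c| / (2 * (α - 1)))
    (hβ1 : 1 ≤ β) (hβ2 : β ≤ α) (hG : 0 ≤ G) (hG2 : |a * c| * G ≤ (α - 1) * (κ / 4))
    (hx : x ^ 2 ≤ 1) :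
    (y + (1 - m * β) / 2 * x) ^ 2 + a * m * (m - 1) * β ^ 2 * x ^ 2
      + 4 * a * m * β * x * (y + (1 - m * β) / 2 * x) + a * c * G * x ^ 2
    ≤ (1 + E * (α - 1)) * y ^ 2 + (1 + (4 * a - 1) * m * α) * x * y
      - κ / 4 * (α - β) * x ^ 2 + 2 * D * (β - 1) * G := by
  have hp : 0 < (m + 1) * α - 2 := by nlinarith
  have hp' : α * (m + 1) - 2 ≠ 0 := by rw [mul_comm]; exact hp.ne'
  have hα0 : 0 < α := by linarith
  have hm0 : 0 < m := by linarith
  have hκ0 : 0 < κ := by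
    rw [hκ]; apply div_pos <;> [apply mul_pos; positivity] <;> linarith
  have hα1 : 0 < α - 1 := by linarith
  have hA : m ^ 2 / 4 - a * m * (m + 1) = (2 * m * α - m - 1) / (4 * α * ((m + 1) * α - 2)) := by
    rw [ha]; field_simp; ring
  have hA0 : 0 ≤ m ^ 2 / 4 - a * m * (m + 1) := by
    rw [hA]; apply div_nonneg <;> [skip; positivity]; nlinarith
  have hq : (1 - m * β) ^ 2 / 4 + a * m * (m - 1) * β ^ 2 + 2 * a * m * β * (1 - m * β)
      = -κ * (α - β) - (m ^ 2 / 4 - a * m * (m + 1)) * ((β - 1) * (α - β)) := by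
    rw [ha, hκ]; field_simp; ring
  have h1 : (1 - m * β) ^ 2 / 4 + a * m * (m - 1) * β ^ 2 + 2 * a * m * β * (1 - m * β)
      ≤ -κ * (α - β) := by
    rw [hq]
    have : 0 ≤ (m ^ 2 / 4 - a * m * (m + 1)) * ((β - 1) * (α - β)) :=
      mul_nonneg hA0 (mul_nonneg (by linarith) (by linarith))
    linarith
  have h2 := mul_le_mul_of_nonneg_right h1 (sq_nonneg x)
  have hE0 : 0 ≤ E := by rw [hE]; positivity
  have h3 : -((4 * a - 1) * m) * (x * y) ≤ κ / 2 * x ^ 2 + E * y ^ 2 := by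
    have : κ / 2 * x ^ 2 + E * y ^ 2 - (-((4 * a - 1) * m) * (x * y))
       = (κ * x + (4 * a - 1) * m * y) ^ 2 / (2 * κ) := by
      rw [hE]; field_simp; ring
    have h : 0 ≤ (κ * x + (4 * a - 1) * m * y) ^ 2 / (2 * κ) := by positivity
    linarith
  have h4 := mul_le_mul_of_nonneg_left h3 (sub_nonneg.2 hβ2)
  have h5 : (α - β) * (E * y ^ 2) ≤ (α - 1) * (E * y ^ 2) :=
    mul_le_mul_of_nonneg_right (by linarith) (by positivity)
  have h6 : a * c * G * x ^ 2 ≤ |a * c| * G * x ^ 2 := by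
    gcongr; exact le_abs_self _
  have h7 : |a * c| * G * x ^ 2 ≤ κ / 4 * (α - β) * x ^ 2 + 2 * D * (β - 1) * G := by
    have e : |a * c| * G * x ^ 2 = (|a * c| * G) * ((α - β) * x ^ 2) / (α - 1)
        + 2 * D * (β - 1) * G * x ^ 2 := by
      rw [hD]; field_simp; ring
    have e1 : (|a * c| * G) * ((α - β) * x ^ 2) / (α - 1) ≤ κ / 4 * (α - β) * x ^ 2 := by
      rw [div_le_iff₀ hα1]
      have := mul_le_mul_of_nonneg_right hG2
        (mul_nonneg (sub_nonneg.2 hβ2) (sq_nonneg x))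
      linarith
    have e2 : 2 * D * (β - 1) * G * x ^ 2 ≤ 2 * D * (β - 1) * G * 1 := by
      have hD0 : 0 ≤ D := by rw [hD]; positivity
      have : 0 ≤ β - 1 := by linarith
      gcongr
    linarith
  nlinarith [h2, h4, h5, h6, h7]

lemma aux_cut : ∃ K : ℝ, 0 ≤ K ∧ ∀ R M : ℝ, 0 < R → 2 * R ≤ M → ∃ φ : ℝ → ℝ, ContDiff ℝ 1 φ ∧
    (∀ r, φ r ^ 2 ≤ 1) ∧ (∀ r ≤ R, φ r = 0) ∧ (∀ r, 2 * M ≤ r → φ r = 0) ∧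
    (∀ r, 2 * R ≤ r → r ≤ M → φ r = 1) ∧ 
    (∀ r ∈ Ioo R (2 * R), |r * deriv φ r| ≤ K) ∧
    (∀ r ∈ Ioo M (2 * M), |r * deriv φ r| ≤ K) := by
  set s := Real.smoothTransition with hs
  have hsc : ContDiff ℝ 1 s := Real.smoothTransition.contDiff
  have hsd : Differentiable ℝ s := hsc.differentiable (by norm_num)
  have hdc : Continuous (deriv s) := hsc.continuous_deriv (by norm_num)
  obtain ⟨K, hK⟩ := (isCompact_Icc (a := (0:ℝ)) (b := 1)).exists_bound_of_continuousOn
    hdc.continuousOn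
  have hK0 : 0 ≤ K := (norm_nonneg _).trans (hK 0 (by simp))
  have h01 : ∀ x, 0 ≤ s x ∧ s x ≤ 1 := fun x =>
    ⟨Real.smoothTransition.nonneg x, Real.smoothTransition.le_one x⟩
  refine ⟨2 * K, by positivity, fun R M hR hM => ?_⟩
  have hM0 : 0 < M := by linarith
  refine ⟨fun r => s (r / R - 1) * s (2 - r / M), ?_, ?_, ?_, ?_, ?_, ?_, ?_⟩
  · fun_prop
  · intro r
    have h1 := h01 (r / R - 1)
    have h2 := h01 (2 - r / M)
    have : s (r / R - 1) * s (2 - r / M) ≤ 1 := mul_le_one₀ h1.2 h2.1 h2.2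
    have h0 : 0 ≤ s (r / R - 1) * s (2 - r / M) := mul_nonneg h1.1 h2.1
    exact pow_le_one₀ h0 this
  · intro r hr
    have : s (r / R - 1) = 0 := Real.smoothTransition.zero_of_nonpos (by
      rw [sub_nonpos, div_le_one hR]; exact hr)
    simp [this]
  · intro r hr
    have : s (2 - r / M) = 0 := Real.smoothTransition.zero_of_nonpos (by
      rw [sub_nonpos, le_div_iff₀ hM0]; exact hr)
    simp [this]
  · intro r hr hr2
    have h1 : s (r / R - 1) = 1 := Real.smoothTransition.one_of_one_le (by
      rw [le_sub_iff_add_le, le_div_iff₀ hR]; linarith)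
    have h2 : s (2 - r / M) = 1 := Real.smoothTransition.one_of_one_le (by
      have : r / M ≤ 1 := by rw [div_le_one hM0]; exact hr2
      linarith)
    simp [h1, h2]
  · rintro r ⟨hr, hr2⟩
    have he : (fun r => s (r / R - 1) * s (2 - r / M)) =ᶠ[nhds r] fun r => s (r / R - 1) := by
      filter_upwards [Iio_mem_nhds hr2] with u hu
      have h2 : s (2 - u / M) = 1 := Real.smoothTransition.one_of_one_le (by
        have : u / M ≤ 1 := by rw [div_le_one hM0]; linarith [mem_Iio.1 hu]
        linarith)
      simp [h2]
    rw [he.deriv_eq]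
    have hd : HasDerivAt (fun r => s (r / R - 1)) (deriv s (r / R - 1) * (1 / R)) r :=
      (hsd _).hasDerivAt.comp r (((hasDerivAt_id r).div_const R).sub_const 1)
    rw [hd.deriv]
    have hb := hK (r / R - 1) ⟨by rw [sub_nonneg, le_div_iff₀ hR]; linarith, by
      rw [sub_le_iff_le_add, div_le_iff₀ hR]; linarith⟩
    have : r * (deriv s (r / R - 1) * (1 / R)) = (r / R) * deriv s (r / R - 1) := by ring
    have hrR : 0 ≤ r / R := by apply div_nonneg <;> linarith
    rw [this, abs_mul, abs_of_nonneg hrR]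
    have : r / R ≤ 2 := by rw [div_le_iff₀ hR]; linarith
    rw [Real.norm_eq_abs] at hb
    gcongr
  · rintro r ⟨hr, hr2⟩
    have he : (fun r => s (r / R - 1) * s (2 - r / M)) =ᶠ[nhds r] fun r => s (2 - r / M) := by
      filter_upwards [Ioi_mem_nhds hr] with u hu
      have h2 : s (u / R - 1) = 1 := Real.smoothTransition.one_of_one_le (by
        rw [le_sub_iff_add_le, le_div_iff₀ hR]; linarith [mem_Ioi.1 hu])
      simp [h2]
    rw [he.deriv_eq]
    have hd : HasDerivAt (fun r => s (2 - r / M)) (deriv s (2 - r / M) * (-(1 / M))) r :=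
      (hsd _).hasDerivAt.comp r (((hasDerivAt_id r).div_const M).const_sub 2)
    rw [hd.deriv]
    have hb := hK (2 - r / M) ⟨by rw [sub_nonneg, div_le_iff₀ hM0]; linarith, by
      have : 1 ≤ r / M := by rw [le_div_iff₀ hM0]; linarith
      linarith⟩
    have : r * (deriv s (2 - r / M) * (-(1 / M))) = -((r / M) * deriv s (2 - r / M)) := by ring
    have hrR : 0 ≤ r / M := by apply div_nonneg <;> linarith
    rw [this, abs_neg, abs_mul, abs_of_nonneg hrR]
    have : r / M ≤ 2 := by rw [div_le_iff₀ hM0]; linarith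
    rw [Real.norm_eq_abs] at hb
    gcongr

lemma aux_form (m a c b x Z w p r : ℝ) (k : ℕ) (hw : 0 < w) (hp : 0 < p) (hr : 0 < r)
    (h : w ^ 2 * p ^ (k + 2) = r) :
    (w / r * Z) ^ 2 * p ^ (k + 2)
        + a * (m + 1 - 1) * (m + 1 - 2) * (b * p / r) ^ 2 * p ^ k * (w * x) ^ 2
        + 4 * a * (m + 1 - 1) * (b * p / r) * p ^ (k + 1) * (w * x) * (w / r * Z)
        + a * c * p ^ k * (w * x) ^ 2
    = (Z ^ 2 + a * m * (m - 1) * b ^ 2 * x ^ 2 + 4 * a * m * b * x * Z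
      + a * c * (r / p) ^ 2 * x ^ 2) / r := by
  have hP : p ^ k = r / (w ^ 2 * p ^ 2) := by
    rw [eq_div_iff (by positivity), ← h, pow_add]; ring
  rw [pow_add, pow_add, hP]
  field_simp
  ring

set_option maxHeartbeats 1600000 in
theorem stmt_11 (n : ℕ) (hn : 3 ≤ n) (α c : ℝ) (hα : 1 ≤ α)
    (ξ : ℝ → ℝ)
    (hξd : ∀ r > (0 : ℝ), DifferentiableAt ℝ ξ r)
    (hξd' : ContinuousOn (deriv ξ) (Set.Ioi (0 : ℝ)))
    (hξpos : ∀ r > (0 : ℝ), 0 < ξ r)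
    (hξanti : AntitoneOn ξ (Set.Ioi (0 : ℝ)))
    (hξ0 : Tendsto ξ atTop (nhds 0))
    (R₁ : ℝ) (hR₁ : 0 < R₁)
    (hξ' : ∀ r ≥ R₁, -(α - 1) * ξ r ≤ r * deriv ξ r)
    (ρ : ℝ → ℝ) (hρdef : ∀ r, ρ r = r ^ α * ξ r)
    (a : ℝ)
    (hadef : a = ((n : ℝ) * α - α - 1) ^ 2 / (4 * α * ((n : ℝ) - 1) * ((n : ℝ) * α - 2)))
    (hstab : ∀ f : ℝ → ℝ, (∃ K, LipschitzWith K f) → HasCompactSupport f →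
      tsupport f ⊆ Set.Ioi (0 : ℝ) →
      0 ≤ ∫ r in Set.Ioi (0 : ℝ), ((deriv f r) ^ 2 * (ρ r) ^ (n - 1)
        + a * ((n : ℝ) - 1) * ((n : ℝ) - 2) * (deriv ρ r) ^ 2 * (ρ r) ^ (n - 3) * (f r) ^ 2
        + 4 * a * ((n : ℝ) - 1) * (deriv ρ r) * (ρ r) ^ (n - 2) * (f r) * (deriv f r)
        + a * c * (ρ r) ^ (n - 3) * (f r) ^ 2)) :
    ∃ C > (0 : ℝ), ∀ r ≥ (1 : ℝ), ρ r ≤ C * r := by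
  have hrα : ∀ r : ℝ, 0 < r → r ^ α = r * r ^ (α - 1) := by
    intro r hr
    rw [Real.rpow_sub_one hr.ne']; field_simp
  have hξ1 : ∀ r ≥ (1 : ℝ), ξ r ≤ ξ 1 := fun r hr =>
    hξanti (mem_Ioi.2 one_pos) (mem_Ioi.2 (by linarith)) hr
  rcases hα.eq_or_lt with h1 | hα1
  · refine ⟨ξ 1, hξpos 1 one_pos, fun r hr => ?_⟩
    rw [hρdef, ← h1, Real.rpow_one, mul_comm]
    exact mul_le_mul_of_nonneg_right (hξ1 r hr) (by linarith)
  obtain ⟨k, rfl⟩ : ∃ k, n = k + 3 := ⟨n - 3, by omega⟩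
  simp only [show k + 3 - 1 = k + 2 by omega, show k + 3 - 2 = k + 1 by omega,
    show k + 3 - 3 = k by omega] at hstab
  obtain ⟨m, hm⟩ : ∃ m : ℝ, m = (k : ℝ) + 2 := ⟨_, rfl⟩
  have hm2 : 2 ≤ m := by rw [hm]; have : (0 : ℝ) ≤ k := Nat.cast_nonneg k; linarith
  have hc1 : (((k + 3 : ℕ) : ℝ)) = m + 1 := by rw [hm]; push_cast; ring
  rw [hc1] at hstab hadef
  have ha : a = (m * α - 1) ^ 2 / (4 * α * m * ((m + 1) * α - 2)) := by
    rw [hadef]; ring_nf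
  by_contra hcon
  push Not at hcon
  have hp : 0 < (m + 1) * α - 2 := by nlinarith
  have hα0 : 0 < α := by linarith
  have hα10 : 0 < α - 1 := by linarith
  obtain ⟨κ, hκ⟩ : ∃ κ, κ = (m - 1) * (α - 1) / (4 * α * ((m + 1) * α - 2)) := ⟨_, rfl⟩
  have hκ0 : 0 < κ := by
    rw [hκ]; apply div_pos <;> [apply mul_pos; positivity] <;> linarith
  obtain ⟨E, hE⟩ : ∃ E, E = ((4 * a - 1) * m) ^ 2 / (2 * κ) := ⟨_, rfl⟩
  have hE0 : 0 ≤ E := by rw [hE]; positivity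
  obtain ⟨D, hD⟩ : ∃ D, D = |a * c| / (2 * (α - 1)) := ⟨_, rfl⟩
  have hD0 : 0 ≤ D := by rw [hD]; positivity
  obtain ⟨k0, hk0⟩ : ∃ k0, k0 = 1 + (4 * a - 1) * m * α := ⟨_, rfl⟩
  -- basic facts on ρ
  have hρpos : ∀ r : ℝ, 0 < r → 0 < ρ r := fun r hr => by
    rw [hρdef]; exact mul_pos (Real.rpow_pos_of_pos hr _) (hξpos r hr)
  obtain ⟨β, hβ⟩ : ∃ β : ℝ → ℝ, β = fun r => α + r * deriv ξ r / ξ r := ⟨_, rfl⟩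
  have hρfun : ρ = fun r => r ^ α * ξ r := funext hρdef
  have hρd : ∀ r : ℝ, 0 < r → HasDerivAt ρ (β r * ρ r / r) r := by
    intro r hr
    have h := (Real.hasDerivAt_rpow_const (x := r) (p := α) (Or.inl hr.ne')).mul
      (hξd r hr).hasDerivAt
    rw [hρfun]
    refine h.congr_deriv ?_
    have := (hξpos r hr).ne'
    rw [hβ, Real.rpow_sub_one hr.ne']
    field_simp
  have hβ1 : ∀ r ≥ R₁, 1 ≤ β r := by
    intro r hr
    have h := hξ' r hr
    have hx := hξpos r (by linarith)
    have : -(α - 1) ≤ r * deriv ξ r / ξ r := by rw [le_div_iff₀ hx]; exact h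
    rw [hβ]; simp only; linarith
  have hdξ : ∀ r : ℝ, 0 < r → deriv ξ r ≤ 0 := by
    intro r hr
    rw [← derivWithin_of_isOpen isOpen_Ioi (mem_Ioi.2 hr)]
    exact hξanti.derivWithin_nonpos
  have hβ2 : ∀ r : ℝ, 0 < r → β r ≤ α := by
    intro r hr
    have : r * deriv ξ r / ξ r ≤ 0 :=
      div_nonpos_of_nonpos_of_nonneg (mul_nonpos_of_nonneg_of_nonpos hr.le (hdξ r hr))
        (hξpos r hr).le
    rw [hβ]; simp only; linarith
  have hξC : ContDiffOn ℝ 1 ξ (Ioi 0) := by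
    rw [contDiffOn_one_iff_derivWithin isOpen_Ioi.uniqueDiffOn]
    refine ⟨fun r hr => (hξd r hr).differentiableWithinAt, hξd'.congr fun r hr => ?_⟩
    exact derivWithin_of_isOpen isOpen_Ioi hr
  have hρC : ContDiffOn ℝ 1 ρ (Ioi 0) := by
    rw [hρfun]
    refine ContDiffOn.mul (fun r hr => ?_) hξC
    exact (Real.contDiffAt_rpow_const (Or.inl (ne_of_gt hr))).contDiffWithinAt
  have hρdc : ContinuousOn (deriv ρ) (Ioi 0) :=
    hρC.continuousOn_deriv_of_isOpen isOpen_Ioi (by norm_num)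
  -- monotonicity of ρ / r
  have hmono : MonotoneOn (fun r => ρ r / r) (Ici R₁) := by
    have hd : ∀ r : ℝ, 0 < r → HasDerivAt (fun r => ρ r / r) ((β r - 1) * ρ r / r ^ 2) r := by
      intro r hr
      refine ((hρd r hr).div (hasDerivAt_id r) hr.ne').congr_deriv ?_
      simp only [id]
      field_simp
    refine monotoneOn_of_deriv_nonneg (convex_Ici R₁) ?_ ?_ ?_
    · intro r hr
      exact (hd r (lt_of_lt_of_le hR₁ hr)).continuousAt.continuousWithinAt
    · intro r hr
      rw [interior_Ici] at hr
      exact (hd r (lt_trans hR₁ hr)).differentiableAt.differentiableWithinAt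
    · intro r hr
      rw [interior_Ici] at hr
      have hr0 : 0 < r := lt_trans hR₁ hr
      rw [(hd r hr0).deriv]
      have := hβ1 r (le_of_lt hr)
      have := hρpos r hr0
      apply div_nonneg (mul_nonneg _ _) <;> first | positivity | linarith
  -- choice of R
  obtain ⟨R, hR1, hRR, hGR⟩ : ∃ R, 0 < R ∧ R₁ ≤ R ∧
      ∀ r ≥ R, |a * c| * (r / ρ r) ^ 2 ≤ (α - 1) * (κ / 4) := by
    obtain ⟨B, hB⟩ : ∃ B, B = R₁ ^ (α - 1) * ξ 1 := ⟨_, rfl⟩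
    have hB0 : 0 ≤ B := by
      rw [hB]; exact mul_nonneg (Real.rpow_nonneg hR₁.le _) (hξpos 1 one_pos).le
    obtain ⟨C, hC⟩ : ∃ C, C = 1 + B + |a * c| / ((α - 1) * (κ / 4)) := ⟨_, rfl⟩
    have hq0 : 0 ≤ |a * c| / ((α - 1) * (κ / 4)) := by positivity
    have hC1 : 1 ≤ C := by linarith
    obtain ⟨R, hR, hCR⟩ := hcon C (by linarith)
    have hR0 : 0 < R := by linarith
    have hRR : R₁ ≤ R := by
      by_contra hlt
      push Not at hlt
      have : ρ R ≤ B * R := by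
        rw [hρdef, hrα R hR0, hB]
        have e1 : R ^ (α - 1) ≤ R₁ ^ (α - 1) := Real.rpow_le_rpow hR0.le hlt.le hα10.le
        have e2 := hξ1 R hR
        have e3 := hξpos R hR0
        have : R ^ (α - 1) * ξ R ≤ R₁ ^ (α - 1) * ξ 1 := by gcongr
        nlinarith
      nlinarith
    refine ⟨R, hR0, hRR, fun r hr => ?_⟩
    have hr0 : 0 < r := by linarith
    have h1 : ρ R / R ≤ ρ r / r := hmono hRR (le_trans hRR hr) hr
    have h2 : C ≤ ρ R / R := by rw [le_div_iff₀ hR0]; exact hCR.le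
    have h3 : r / ρ r ≤ 1 / C := by
      rw [← inv_div, ← one_div]
      exact one_div_le_one_div_of_le (by linarith) (by linarith)
    have h4 : 0 ≤ r / ρ r := (div_pos hr0 (hρpos r hr0)).le
    have h5 : (r / ρ r) ^ 2 ≤ 1 / C := by
      have : 1 / C ≤ 1 := by rw [div_le_one (by linarith)]; exact hC1
      nlinarith
    have h6 : |a * c| ≤ (α - 1) * (κ / 4) * C := by
      have : |a * c| / ((α - 1) * (κ / 4)) ≤ C := by linarith
      rw [div_le_iff₀ (by positivity)] at this
      linarith
    calc |a * c| * (r / ρ r) ^ 2 ≤ |a * c| * (1 / C) := by gcongr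
      _ ≤ (α - 1) * (κ / 4) := by
        rw [mul_one_div, div_le_iff₀ (by linarith)]; exact h6
  obtain ⟨K, hK0, hcut⟩ := aux_cut
  obtain ⟨L, hL⟩ : ∃ L, L = (1 + E * (α - 1)) * K ^ 2 := ⟨_, rfl⟩
  -- choice of M
  obtain ⟨M, hRM, hMneg⟩ : ∃ M, 2 * R ≤ M ∧
      2 * (L * Real.log 2) + D * (R / ρ R) ^ 2
        + κ / 4 * (Real.log (ξ M) - Real.log (ξ (2 * R))) < 0 := by
    have ht : Tendsto ξ atTop (nhdsWithin 0 (Ioi 0)) := by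
      rw [tendsto_nhdsWithin_iff]
      refine ⟨hξ0, ?_⟩
      filter_upwards [eventually_gt_atTop 0] with r hr using hξpos r hr
    have hl := Real.tendsto_log_nhdsGT_zero.comp ht
    obtain ⟨X, hX⟩ : ∃ X, X = Real.log (ξ (2 * R))
      - (2 * (L * Real.log 2) + D * (R / ρ R) ^ 2) / (κ / 4) := ⟨_, rfl⟩
    obtain ⟨M, hM1, hM2⟩ := ((hl.eventually (eventually_lt_atBot X)).and
      (eventually_ge_atTop (2 * R))).exists
    refine ⟨M, hM2, ?_⟩
    simp only [Function.comp] at hM1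
    have : Real.log (ξ M) - Real.log (ξ (2 * R)) <
      - ((2 * (L * Real.log 2) + D * (R / ρ R) ^ 2) / (κ / 4)) := by linarith
    have h2 := mul_lt_mul_of_pos_left this (show 0 < κ / 4 by positivity)
    have h3 : κ / 4 * (- ((2 * (L * Real.log 2) + D * (R / ρ R) ^ 2) / (κ / 4)))
      = - (2 * (L * Real.log 2) + D * (R / ρ R) ^ 2) := by field_simp
    linarith
  obtain ⟨φ, hφC, hφ1, hφR, hφM, hφmid, hφd1, hφd2⟩ := hcut R M hR1 hRM
  have hM0 : 0 < M := by linarith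
  have hφd : ∀ r, HasDerivAt φ (deriv φ r) r := fun r =>
    (hφC.differentiable (by norm_num) r).hasDerivAt
  -- the test function
  obtain ⟨w, hw⟩ : ∃ w : ℝ → ℝ,
    w = fun r => Real.exp (1 / 2 * Real.log r - m / 2 * Real.log (ρ r)) := ⟨_, rfl⟩
  have hwd : ∀ r : ℝ, 0 < r → HasDerivAt w (w r * ((1 - m * β r) / 2 / r)) r := by
    intro r hr
    have h := (((Real.hasDerivAt_log hr.ne').const_mul (1 / 2)).sub
      (((hρd r hr).log (hρpos r hr).ne').const_mul (m / 2))).exp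
    rw [hw]
    refine h.congr_deriv ?_
    have := (hρpos r hr).ne'
    simp only [Pi.sub_apply]
    congr 1
    field_simp
  have hw2 : ∀ r : ℝ, 0 < r → w r ^ 2 * (ρ r) ^ (k + 2) = r := by
    intro r hr
    have hp := hρpos r hr
    have e : ρ r ^ (k + 2) = Real.exp (m * Real.log (ρ r)) := by
      have : m = ((k + 2 : ℕ) : ℝ) := by rw [hm]; push_cast; ring
      rw [this, Real.exp_nat_mul, Real.exp_log hp]
    rw [e, hw]
    simp only
    rw [← Real.exp_nat_mul, ← Real.exp_add]
    conv_rhs => rw [← Real.exp_log hr]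
    congr 1
    push_cast; ring
  have hwC : ContDiffOn ℝ 1 w (Ioi 0) := by
    rw [hw]
    refine ContDiffOn.exp (ContDiffOn.sub (contDiffOn_const.mul ?_) (contDiffOn_const.mul ?_))
    · exact contDiffOn_id.log fun r hr => ne_of_gt hr
    · exact hρC.log fun r hr => (hρpos r hr).ne'
  obtain ⟨f, hf⟩ : ∃ f : ℝ → ℝ, f = fun r => w r * φ r := ⟨_, rfl⟩
  have hfz : ∀ r, r ∉ Icc R (2 * M) → f r = 0 := by
    intro r hr
    have : φ r = 0 := by
      by_cases h : r ≤ R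
      · exact hφR r h
      · refine hφM r ?_
        by_contra h2
        exact hr ⟨by linarith, by linarith⟩
    rw [hf]; simp [this]
  have hts : tsupport f ⊆ Icc R (2 * M) := by
    refine closure_minimal (fun r hr => ?_) isClosed_Icc
    by_contra h
    exact hr (hfz r h)
  have hfcs : HasCompactSupport f := HasCompactSupport.intro isCompact_Icc hfz
  have hfC : ContDiff ℝ 1 f := by
    rw [contDiff_iff_contDiffAt]
    intro r
    by_cases hr : 0 < r
    · rw [hf]
      exact (hwC.contDiffAt (Ioi_mem_nhds hr)).mul hφC.contDiffAt
    · have : f =ᶠ[nhds r] fun _ => 0 := by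
        filter_upwards [Iio_mem_nhds (show r < R by linarith)] with u hu
        exact hfz u fun h => absurd h.1 (not_le.2 hu)
      exact contDiffAt_const.congr_of_eventuallyEq this
  have hlip : ∃ K, LipschitzWith K f :=
    ContDiff.lipschitzWith_of_hasCompactSupport hfcs hfC (by norm_num)
  have hmain := hstab f hlip hfcs (hts.trans fun r hr => lt_of_lt_of_le hR1 hr.1)
  obtain ⟨F, hF⟩ : ∃ F : ℝ → ℝ, F = fun r => ((deriv f r) ^ 2 * (ρ r) ^ (k + 2)
        + a * (m + 1 - 1) * (m + 1 - 2) * (deriv ρ r) ^ 2 * (ρ r) ^ k * (f r) ^ 2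
        + 4 * a * (m + 1 - 1) * (deriv ρ r) * (ρ r) ^ (k + 1) * (f r) * (deriv f r)
        + a * c * (ρ r) ^ k * (f r) ^ 2) := ⟨_, rfl⟩
  have hmain' : 0 ≤ ∫ r in Ioi (0 : ℝ), F r := by rw [hF]; exact hmain
  have hF0 : ∀ r, r ∉ Icc R (2 * M) → F r = 0 := by
    intro r hr
    have h1 := hfz r hr
    have h2 : deriv f r = 0 := by
      by_contra h
      exact hr (hts (support_deriv_subset h))
    rw [hF]; simp [h1, h2]
  have hle : R ≤ 2 * M := by linarith
  rw [setIntegral_eq_of_subset_of_forall_sdiff_eq_zero measurableSet_Ioi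
    (fun r (hr : r ∈ Icc R (2 * M)) => lt_of_lt_of_le hR1 hr.1)
    (fun r hr => hF0 r hr.2), integral_Icc_eq_integral_Ioc,
    ← intervalIntegral.integral_of_le hle] at hmain'
  have hfc : Continuous f := hfC.continuous
  have hfdc : Continuous (deriv f) := hfC.continuous_deriv (by norm_num)
  have hFc : ContinuousOn F (Ioi 0) := by
    have := hρC.continuousOn
    have h1 := hfc.continuousOn (s := Ioi 0)
    have h2 := hfdc.continuousOn (s := Ioi 0)
    rw [hF]
    fun_prop
  -- pointwise inequality
  have hpt : ∀ r ≥ R, F r ≤ ((1 + E * (α - 1)) * (r * deriv φ r) ^ 2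
      - κ / 4 * (α - β r) * φ r ^ 2) / r
      + (k0 * φ r * deriv φ r + 2 * D * (β r - 1) * (r / ρ r) ^ 2 / r) := by
    intro r hr
    have hr0 : 0 < r := by linarith
    have hal := aux_alg m α a c κ E D (β r) ((r / ρ r) ^ 2) (φ r) (r * deriv φ r) hm2 hα1 ha hκ
      hE hD (hβ1 r (by linarith)) (hβ2 r hr0) (sq_nonneg _) (hGR r hr) (hφ1 r)
    rw [← hk0] at hal
    have hfd : deriv f r = w r / r * (r * deriv φ r + (1 - m * β r) / 2 * φ r) := by
      have := (hwd r hr0).mul (hφd r)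
      rw [hf]
      rw [show (fun r => w r * φ r) = w * φ from rfl, this.deriv]
      field_simp
      ring
    have hp := hρpos r hr0
    have hFe : F r = ((r * deriv φ r + (1 - m * β r) / 2 * φ r) ^ 2
      + a * m * (m - 1) * β r ^ 2 * φ r ^ 2
      + 4 * a * m * β r * φ r * (r * deriv φ r + (1 - m * β r) / 2 * φ r)
      + a * c * (r / ρ r) ^ 2 * φ r ^ 2) / r := by
      have hfr : f r = w r * φ r := by rw [hf]
      rw [hF]
      simp only
      rw [hfd, hfr, (hρd r hr0).deriv]
      have hwp : 0 < w r := by rw [hw]; exact Real.exp_pos _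
      exact aux_form m a c (β r) (φ r) _ (w r) (ρ r) r k hwp hp hr0 (hw2 r hr0)
    rw [hFe]
    have := div_le_div_of_nonneg_right hal hr0.le
    refine this.trans (le_of_eq ?_)
    field_simp
    ring
  obtain ⟨J, hJ⟩ : ∃ J : ℝ → ℝ, J = fun r => k0 / 2 * φ r ^ 2 - D * (r / ρ r) ^ 2 := ⟨_, rfl⟩
  have hJd : ∀ r : ℝ, 0 < r → HasDerivAt J
      (k0 * φ r * deriv φ r + 2 * D * (β r - 1) * (r / ρ r) ^ 2 / r) r := by
    intro r hr
    have hp := hρpos r hr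
    have h := (((hφd r).pow 2).const_mul (k0 / 2)).sub
      ((((hasDerivAt_id r).div (hρd r hr) hp.ne').pow 2).const_mul D)
    rw [hJ]
    refine h.congr_deriv ?_
    have hp0 := hp.ne'
    simp only [Pi.div_apply, id, Nat.cast_ofNat, Nat.add_one_sub_one, pow_one]
    field_simp
    ring
  -- one piece
  have hpiece : ∀ (H H' : ℝ → ℝ) (x y : ℝ), R ≤ x → x ≤ y →
      (∀ r : ℝ, 0 < r → HasDerivAt H (H' r) r) →
      (∀ r ∈ Ioo x y, ((1 + E * (α - 1)) * (r * deriv φ r) ^ 2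
        - κ / 4 * (α - β r) * φ r ^ 2) / r ≤ H' r) →
      ∫ r in x..y, F r ≤ (H y + J y) - (H x + J x) := by
    intro H H' x y hx hxy hH hHle
    refine intervalIntegral.integral_le_sub_of_hasDeriv_right_of_le hxy
      (g := fun r => H r + J r)
      (g' := fun r => H' r + (k0 * φ r * deriv φ r + 2 * D * (β r - 1) * (r / ρ r) ^ 2 / r))
      ?_ ?_ ?_ ?_
    · intro r hr
      have hr0 : 0 < r := by linarith [hr.1]
      exact ((hH r hr0).add (hJd r hr0)).continuousAt.continuousWithinAt
    · intro r hr
      have hr0 : 0 < r := by linarith [hr.1]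
      exact ((hH r hr0).add (hJd r hr0)).hasDerivWithinAt
    · exact (hFc.mono fun r hr => by
        have := hr.1
        exact mem_Ioi.2 (by linarith)).integrableOn_Icc
    · intro r hr
      have h1 := hpt r (by linarith [hr.1])
      have h2 := hHle r hr
      linarith
  have hramp : ∀ r : ℝ, 0 < r → |r * deriv φ r| ≤ K → ((1 + E * (α - 1)) * (r * deriv φ r) ^ 2
        - κ / 4 * (α - β r) * φ r ^ 2) / r ≤ L * r⁻¹ := by
    intro r hr h
    rw [← div_eq_mul_inv]
    apply div_le_div_of_nonneg_right _ hr.le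
    have h1 : (r * deriv φ r) ^ 2 ≤ K ^ 2 := sq_le_sq' (abs_le.1 h).1 (abs_le.1 h).2
    have h2 : 0 ≤ κ / 4 * (α - β r) * φ r ^ 2 :=
      mul_nonneg (mul_nonneg (by positivity) (sub_nonneg.2 (hβ2 r hr))) (sq_nonneg _)
    have h3 : (1 + E * (α - 1)) * (r * deriv φ r) ^ 2 ≤ L := by
      rw [hL]; gcongr
    linarith
  have hlogd : ∀ r : ℝ, 0 < r → HasDerivAt (fun r => L * Real.log r) (L * r⁻¹) r := fun r hr =>
    (Real.hasDerivAt_log hr.ne').const_mul L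
  have p1 := hpiece _ _ R (2 * R) le_rfl (by linarith) hlogd
    (fun r hr => hramp r (by linarith [hr.1]) (hφd1 r hr))
  have p3 := hpiece _ _ M (2 * M) (by linarith) (by linarith) hlogd
    (fun r hr => hramp r (by linarith [hr.1]) (hφd2 r hr))
  have p2 := hpiece (fun r => κ / 4 * Real.log (ξ r)) (fun r => κ / 4 * (deriv ξ r / ξ r))
    (2 * R) M (by linarith) hRM
    (fun r hr => ((hξd r hr).hasDerivAt.log (hξpos r hr).ne').const_mul _) (by
      rintro r ⟨hr1, hr2⟩
      have hr0 : 0 < r := by linarith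
      have hx := (hξpos r hr0).ne'
      have hφr : φ r = 1 := hφmid r hr1.le hr2.le
      have hφ' : deriv φ r = 0 := by
        have : φ =ᶠ[nhds r] fun _ => 1 := by
          filter_upwards [Ioo_mem_nhds hr1 hr2] with u hu
          exact hφmid u hu.1.le hu.2.le
        rw [this.deriv_eq]; simp
      rw [hφr, hφ', hβ]
      simp only
      apply le_of_eq
      field_simp
      ring)
  have hint : ∀ x y : ℝ, 0 < x → x ≤ y → IntervalIntegrable F volume x y := by
    intro x y hx hxy
    refine (hFc.mono fun r hr => ?_).intervalIntegrable
    rw [uIcc_of_le hxy] at hr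
    exact lt_of_lt_of_le hx hr.1
  have hsum : ∫ r in R..(2 * M), F r = (∫ r in R..(2 * R), F r) + (∫ r in (2 * R)..M, F r)
      + ∫ r in M..(2 * M), F r := by
    have i1 := hint R (2 * R) hR1 (by linarith)
    have i2 := hint (2 * R) M (by linarith) hRM
    have i3 := hint M (2 * M) hM0 (by linarith)
    rw [intervalIntegral.integral_add_adjacent_intervals i1 i2,
      intervalIntegral.integral_add_adjacent_intervals (i1.trans i2) i3]
  have l1 : Real.log (2 * R) = Real.log 2 + Real.log R := Real.log_mul (by norm_num) hR1.ne'
  have l2 : Real.log (2 * M) = Real.log 2 + Real.log M := Real.log_mul (by norm_num) hM0.ne'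
  have hJR : J R = - (D * (R / ρ R) ^ 2) := by rw [hJ]; simp [hφR R le_rfl]
  have hJM : J (2 * M) ≤ 0 := by
    rw [hJ]
    simp only [hφM (2 * M) le_rfl]
    have : 0 ≤ D * (2 * M / ρ (2 * M)) ^ 2 := by positivity
    linarith
  rw [l1] at p1
  rw [l2] at p3
  rw [hsum] at hmain'
  linarith
end

section
/- Let n ≥ 3 be an integer and C₂ ≥ C₁ > 1 real constants. Let ρ : ℝ → ℝ be continuously differentiable with ρ(r) > 0 for all r > 0 and C₁·r ≤ ρ(r) ≤ C₂·r for all r ≥ 1. Then for every real a > (n−2)/(4(n−1)(1−C₁^{−2})) and every R₀ > 0 there exists a Lipschitz function f : ℝ → ℝ with compact support contained in (R₀, ∞) such that ∫_0^∞ [ f'(r)² ρ(r)^{n−1} + a(n−1)(n−2) ρ'(r)² ρ(r)^{n−3} f(r)² + 4a(n−1) ρ'(r) ρ(r)^{n−2} f(r) f'(r) + a(n−1)(n−2) ρ(r)^{n−3} f(r)² ] dr < 0, where f' denotes the almost-everywhere derivative of f. -/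
open MeasureTheory Filter Set

/-- pointwise algebraic estimate -/
lemma pointwise_est (p q r g g' u k ε D A C₁ C₂ B U L : ℝ) (hp1 : C₁ * r ≤ p) (hp2 : p ≤ C₂ * r)
    (hr : 0 < r) (hL : 0 < L) (hC₁ : 0 < C₁) (hA : 0 < A) (hε : 0 < ε) (hD : 0 < D - ε)
    (hB : 0 ≤ B) (hg0 : 0 ≤ g) (hg1 : g ≤ 1) (hg' : |g'| ≤ B) (hu0 : 0 ≤ u) (huU : u ≤ U) :
    p * (g' / (L * r)) ^ 2 + k * q * g * (g' / (L * r)) - D * q ^ 2 / p * g ^ 2 + A * g ^ 2 / p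
      ≤ -2 * ((D - ε) * C₁) * (2 * g * (g' / (L * r)) * u + g ^ 2 * (q / p - 1 / r))
        + ((1 + k ^ 2 / (4 * ε)) * C₂ * B ^ 2 / L ^ 2 + 4 * ((D - ε) * C₁) * U * B / L) * (1 / r)
        - ((D - ε) * C₁ - A / C₁) * (g ^ 2 * (1 / r)) := by
  have hp : 0 < p := lt_of_lt_of_le (by positivity) hp1
  set w := g' / (L * r) with hw
  -- Young
  have h1 : k * q * g * w ≤ ε * (q ^ 2 / p * g ^ 2) + k ^ 2 / (4 * ε) * (p * w ^ 2) := by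
    have : ε * (q ^ 2 / p * g ^ 2) + k ^ 2 / (4 * ε) * (p * w ^ 2) - k * q * g * w
        = (2 * ε * q * g - k * p * w) ^ 2 / (4 * ε * p) := by
      field_simp; ring
    have h2 : 0 ≤ (2 * ε * q * g - k * p * w) ^ 2 / (4 * ε * p) := by positivity
    linarith
  have h2 : C₁ * (2 * (q / p) - 1 / r) ≤ q ^ 2 / p := by
    have e1 : q ^ 2 / p - C₁ * r * (q / p) ^ 2 = (p - C₁ * r) * (q / p) ^ 2 := by
      field_simp
    have e2 : C₁ * r * (q / p) ^ 2 - C₁ * (2 * (q / p) - 1 / r) = C₁ * r * (q / p - 1 / r) ^ 2 := by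
      field_simp; ring
    have e3 : 0 ≤ (p - C₁ * r) * (q / p) ^ 2 := mul_nonneg (by linarith) (sq_nonneg _)
    have e4 : 0 ≤ C₁ * r * (q / p - 1 / r) ^ 2 := by positivity
    linarith
  have h3 : A * g ^ 2 / p ≤ A / C₁ * (g ^ 2 * (1 / r)) := by
    have : A / C₁ * (g ^ 2 * (1 / r)) = A * g ^ 2 / (C₁ * r) := by field_simp
    rw [this]; gcongr
  have hgsq : g' ^ 2 ≤ B ^ 2 := by
    rw [← sq_abs]; gcongr
  have hC₂ : 0 ≤ C₂ := by
    by_contra h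
    push Not at h
    have := mul_neg_of_neg_of_pos h hr
    linarith
  have h4 : (1 + k ^ 2 / (4 * ε)) * (p * w ^ 2) ≤ (1 + k ^ 2 / (4 * ε)) * C₂ * B ^ 2 / L ^ 2 * (1 / r) := by
    have e : p * w ^ 2 ≤ C₂ * B ^ 2 / L ^ 2 * (1 / r) := by
      calc p * w ^ 2 ≤ (C₂ * r) * w ^ 2 := by gcongr
        _ = C₂ * g' ^ 2 / L ^ 2 * (1 / r) := by rw [hw]; field_simp
        _ ≤ _ := by gcongr
    calc _ ≤ (1 + k ^ 2 / (4 * ε)) * (C₂ * B ^ 2 / L ^ 2 * (1 / r)) := by gcongr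
      _ = _ := by ring
  have h5 : 2 * ((D - ε) * C₁) * (2 * g * w * u) ≤ 4 * ((D - ε) * C₁) * U * B / L * (1 / r) := by
    have e0 : g * g' * u ≤ 1 * B * U := by
      have : g' ≤ B := (le_abs_self _).trans hg'
      calc g * g' * u ≤ g * B * u := by gcongr
        _ ≤ 1 * B * U := by gcongr
    calc 2 * ((D - ε) * C₁) * (2 * g * w * u) = 4 * ((D - ε) * C₁) / L * (1 / r) * (g * g' * u) := by
          rw [hw]; field_simp; ring
      _ ≤ 4 * ((D - ε) * C₁) / L * (1 / r) * (1 * B * U) := by gcongr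
      _ = _ := by ring
  have h6 := mul_le_mul_of_nonneg_left h2 (mul_nonneg hD.le (sq_nonneg g))
  have h5' : -(2 * ((D - ε) * C₁) * (2 * g * w * u)) ≤ 4 * ((D - ε) * C₁) * U * B / L * (1 / r) := by
    have e0 : g * (-g') * u ≤ 1 * B * U := by
      have : -g' ≤ B := (neg_le_abs _).trans hg'
      calc g * (-g') * u ≤ g * B * u := by gcongr
        _ ≤ 1 * B * U := by gcongr
    calc -(2 * ((D - ε) * C₁) * (2 * g * w * u)) = 4 * ((D - ε) * C₁) / L * (1 / r) * (g * (-g') * u) := by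
          rw [hw]; field_simp; ring
      _ ≤ 4 * ((D - ε) * C₁) / L * (1 / r) * (1 * B * U) := by gcongr
      _ = _ := by ring
  have h7 : D * q ^ 2 / p * g ^ 2 = D * (q ^ 2 / p * g ^ 2) := by ring
  rw [h7]
  nlinarith [h1, h3, h4, h5', h6]

/-- a standard bump -/
lemma exists_bump : ∃ h H : ℝ → ℝ, ∃ B η : ℝ, 0 ≤ B ∧ 0 < η ∧ ContDiff ℝ 1 h ∧
    (∀ s, 0 ≤ h s) ∧ (∀ s, h s ≤ 1) ∧ (∀ s, 2 ≤ |s| → h s = 0) ∧ (∀ s, |deriv h s| ≤ B) ∧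
    (∀ s, HasDerivAt H (h s ^ 2) s) ∧ H 2 - H (-2) = η := by
  let b : ContDiffBump (0 : ℝ) := ⟨1, 2, by norm_num, by norm_num⟩
  have hb : ContDiff ℝ 1 b := b.contDiff
  have hc : Continuous b := b.continuous
  obtain ⟨B, hB⟩ := (b.hasCompactSupport.deriv (𝕜 := ℝ)).exists_bound_of_continuous
    (hb.continuous_deriv le_rfl)
  have hd : ∀ s, HasDerivAt (fun s => ∫ x in (-2 : ℝ)..s, b x ^ 2) (b s ^ 2) s := fun s =>
    intervalIntegral.integral_hasDerivAt_right ((hc.pow 2).intervalIntegrable _ _)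
      ((hc.pow 2).stronglyMeasurableAtFilter _ _) (hc.pow 2).continuousAt
  refine ⟨b, fun s => ∫ x in (-2 : ℝ)..s, b x ^ 2, B, ∫ x in (-2 : ℝ)..2, b x ^ 2,
    (norm_nonneg _).trans (hB 0), ?_, hb, fun s => b.nonneg, fun s => b.le_one, ?_, hB, hd, ?_⟩
  · apply intervalIntegral.intervalIntegral_pos_of_pos_on ((hc.pow 2).intervalIntegrable _ _)
    · intro x hx
      have : 0 < b x := b.pos_of_mem_ball (by
        simp only [Metric.mem_ball, Real.dist_eq, sub_zero]
        exact abs_lt.2 hx)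
      exact pow_pos this 2
    · norm_num
  · intro s hs
    exact b.zero_of_le_dist (by simpa [Real.dist_eq] using hs)
  · simp

/-- the exponent computation -/
lemma alg_est (m : ℕ) (p q v g w a : ℝ) (hp : 0 < p) (hv : v ^ 2 * p ^ (m + 1) = 1) :
    (v * w - ((m : ℝ) + 1) / 2 * v * q / p * g) ^ 2 * p ^ (m + 2)
      + a * ((m : ℝ) + 2) * ((m : ℝ) + 1) * q ^ 2 * p ^ m * (v * g) ^ 2
      + 4 * a * ((m : ℝ) + 2) * q * p ^ (m + 1) * (v * g)
          * (v * w - ((m : ℝ) + 1) / 2 * v * q / p * g)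
      + a * ((m : ℝ) + 2) * ((m : ℝ) + 1) * p ^ m * (v * g) ^ 2
    = p * w ^ 2 + (4 * a * ((m : ℝ) + 2) - ((m : ℝ) + 1)) * q * g * w
      - (a * ((m : ℝ) + 2) * ((m : ℝ) + 1) - ((m : ℝ) + 1) ^ 2 / 4) * q ^ 2 / p * g ^ 2
      + a * ((m : ℝ) + 2) * ((m : ℝ) + 1) * g ^ 2 / p := by
  have hv' : v ^ 2 * p ^ m = 1 / p := by
    rw [eq_div_iff hp.ne', ← hv]; ring
  have e : (v * w - ((m : ℝ) + 1) / 2 * v * q / p * g) = v * (w - ((m : ℝ) + 1) / 2 * q / p * g) := by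
    ring
  rw [e]
  trans (v ^ 2 * p ^ m) * ((w - ((m : ℝ) + 1) / 2 * q / p * g) ^ 2 * p ^ 2
      + a * ((m : ℝ) + 2) * ((m : ℝ) + 1) * q ^ 2 * g ^ 2
      + 4 * a * ((m : ℝ) + 2) * q * p * g * (w - ((m : ℝ) + 1) / 2 * q / p * g)
      + a * ((m : ℝ) + 2) * ((m : ℝ) + 1) * g ^ 2)
  · ring
  · rw [hv']; field_simp; ring

set_option maxHeartbeats 2000000 in
lemma main_aux (m : ℕ) (C₁ C₂ : ℝ) (hC₁ : 1 < C₁)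
    (ρ : ℝ → ℝ) (hρ : ContDiff ℝ 1 ρ) (hρpos : ∀ r > (0 : ℝ), 0 < ρ r)
    (hbound : ∀ r ≥ (1 : ℝ), C₁ * r ≤ ρ r ∧ ρ r ≤ C₂ * r)
    (a : ℝ) (ha : ((m : ℝ) + 1) / (4 * ((m : ℝ) + 2) * (1 - (C₁)⁻¹ ^ 2)) < a)
    (R₀ : ℝ) (hR₀ : 0 < R₀) :
    ∃ f : ℝ → ℝ, (∃ K, LipschitzWith K f) ∧ HasCompactSupport f ∧
      tsupport f ⊆ Set.Ioi R₀ ∧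
      (∫ r in Set.Ioi (0 : ℝ), ((deriv f r) ^ 2 * (ρ r) ^ (m + 2)
        + a * ((m : ℝ) + 2) * ((m : ℝ) + 1) * (deriv ρ r) ^ 2 * (ρ r) ^ m * (f r) ^ 2
        + 4 * a * ((m : ℝ) + 2) * (deriv ρ r) * (ρ r) ^ (m + 1) * (f r) * (deriv f r)
        + a * ((m : ℝ) + 2) * ((m : ℝ) + 1) * (ρ r) ^ m * (f r) ^ 2)) < 0 := by
  obtain ⟨h, H, B, η, hB, hη, hh, hh0, hh1, hhz, hhB, hH, hHη⟩ := exists_bump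
  have hC₁p : 0 < C₁ := by linarith
  have hinv : 0 < 1 - (C₁)⁻¹ ^ 2 := by
    have h1 : C₁⁻¹ < 1 := inv_lt_one_of_one_lt₀ hC₁
    have h2 : 0 < C₁⁻¹ := by positivity
    nlinarith
  have hapos : 0 < a := lt_of_le_of_lt (by positivity) ha
  set A : ℝ := a * ((m : ℝ) + 2) * ((m : ℝ) + 1) with hA
  set D : ℝ := A - ((m : ℝ) + 1) ^ 2 / 4 with hD
  have hApos : 0 < A := by positivity
  have hDA : A / C₁ ^ 2 < D := by
    rw [div_lt_iff₀ (by positivity)] at ha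
    have h1 := mul_lt_mul_of_pos_right ha (show (0 : ℝ) < ((m : ℝ) + 1) / 4 by positivity)
    have h2 : A / C₁ ^ 2 = A * C₁⁻¹ ^ 2 := by field_simp
    rw [h2, hD]
    have h3 : a * (4 * ((m : ℝ) + 2) * (1 - C₁⁻¹ ^ 2)) * (((m : ℝ) + 1) / 4)
      = A - A * C₁⁻¹ ^ 2 := by rw [hA]; ring
    rw [h3] at h1
    nlinarith
  set ε : ℝ := (D - A / C₁ ^ 2) / 2 with hεd
  have hε : 0 < ε := by rw [hεd]; linarith
  have hAC : 0 < A / C₁ ^ 2 := by positivity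
  have hDε : A / C₁ ^ 2 < D - ε := by rw [hεd]; linarith
  have hDε0 : 0 < D - ε := by linarith
  set k : ℝ := 4 * a * ((m : ℝ) + 2) - ((m : ℝ) + 1) with hk
  set δ : ℝ := (D - ε) * C₁ - A / C₁ with hδd
  have hδ : 0 < δ := by
    have h1 := mul_lt_mul_of_pos_right hDε hC₁p
    have h2 : A / C₁ ^ 2 * C₁ = A / C₁ := by field_simp
    rw [hδd]; linarith
  set U := Real.log C₂ with hU
  set c : ℝ := (D - ε) * C₁ with hc
  set B1 : ℝ := (1 + k ^ 2 / (4 * ε)) * C₂ * B ^ 2 with hB1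
  set B2 : ℝ := 4 * c * U * B with hB2
  -- choose L
  obtain ⟨L, hL1, hLR, hLneg⟩ : ∃ L : ℝ, 1 ≤ L ∧ Real.log R₀ < L ∧
      4 * (B1 / L + B2) - δ * L * η < 0 := by
    have hδη : 0 < δ * η := by positivity
    refine ⟨max (max 1 (Real.log R₀ + 1)) ((4 * (|B1| + B2) + 1) / (δ * η)), ?_, ?_, ?_⟩
    · exact (le_max_left _ _).trans (le_max_left _ _)
    · exact lt_of_lt_of_le (by linarith) ((le_max_right _ _).trans (le_max_left _ _))
    · set L := max (max 1 (Real.log R₀ + 1)) ((4 * (|B1| + B2) + 1) / (δ * η)) with hLdef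
      have h1 : 1 ≤ L := (le_max_left _ _).trans (le_max_left _ _)
      have h2 : (4 * (|B1| + B2) + 1) / (δ * η) ≤ L := le_max_right _ _
      rw [div_le_iff₀ hδη] at h2
      have h3 : B1 / L ≤ |B1| := by
        calc B1 / L ≤ |B1| / L := by gcongr; exact le_abs_self _
          _ ≤ |B1| := div_le_self (abs_nonneg _) h1
      nlinarith
  have hL : 0 < L := by linarith
  set α := Real.exp L with hα
  set β := Real.exp (5 * L) with hβ
  have hαβ : α ≤ β := Real.exp_le_exp.2 (by linarith)
  have hα1 : 1 < α := by rw [hα]; exact Real.one_lt_exp_iff.2 hL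
  have hαR : R₀ < α := (Real.log_lt_iff_lt_exp hR₀).1 hLR
  set g : ℝ → ℝ := fun r => h (Real.log r / L - 3) with hg
  set v : ℝ → ℝ := fun r => (ρ r) ^ (-(((m : ℝ) + 1) / 2)) with hv
  set f : ℝ → ℝ := fun r => if 0 < r then v r * g r else 0 with hf
  have hgα : ∀ r, 0 < r → r ≤ α → g r = 0 := by
    intro r hr hrα
    have h1 : Real.log r ≤ L := (Real.log_le_iff_le_exp hr).2 hrα
    have h2 : Real.log r / L ≤ 1 := (div_le_one hL).2 h1
    apply hhz
    rw [abs_of_nonpos (by linarith)]; linarith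
  have hgβ : ∀ r, β ≤ r → g r = 0 := by
    intro r hr
    have hr0 : 0 < r := lt_of_lt_of_le (Real.exp_pos _) hr
    have h1 : 5 * L ≤ Real.log r := (Real.le_log_iff_exp_le hr0).2 hr
    have h2 : 5 ≤ Real.log r / L := (le_div_iff₀ hL).2 h1
    apply hhz
    rw [abs_of_nonneg (by linarith)]; linarith
  have hfz : ∀ r, r ∉ Icc α β → f r = 0 := by
    intro r hr
    simp only [hf]
    split_ifs with h0
    · rw [mem_Icc, not_and_or] at hr
      rcases hr with hr | hr
      · rw [hgα r h0 (by linarith), mul_zero]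
      · rw [hgβ r (by linarith), mul_zero]
    · rfl
  have hts : tsupport f ⊆ Icc α β := by
    apply closure_minimal _ isClosed_Icc
    intro r hr
    by_contra hc
    exact hr (hfz r hc)
  have hcs : HasCompactSupport f := isCompact_Icc.of_isClosed_subset (isClosed_tsupport _) hts
  have hfev : ∀ r, 0 < r → f =ᶠ[nhds r] fun r => v r * g r := by
    intro r hr
    filter_upwards [lt_mem_nhds hr] with x hx
    simp [hf, hx]
  have hfc : ContDiff ℝ 1 f := by
    rw [contDiff_iff_contDiffAt]
    intro r
    by_cases hr : 0 < r
    · apply ContDiffAt.congr_of_eventuallyEq _ (hfev r hr)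
      apply ContDiffAt.mul
      · exact (hρ.contDiffAt).rpow_const_of_ne (hρpos r hr).ne'
      · exact hh.contDiffAt.comp r (((Real.contDiffAt_log.2 hr.ne').div_const L).sub contDiffAt_const)
    · have : f =ᶠ[nhds r] fun _ => 0 := by
        filter_upwards [gt_mem_nhds (show r < α by linarith)] with x hx
        exact hfz x (fun hh => by linarith [hh.1])
      exact contDiffAt_const.congr_of_eventuallyEq this
  have hdg : ∀ r, 0 < r → HasDerivAt g (deriv h (Real.log r / L - 3) / (L * r)) r := by
    intro r hr
    have h1 : HasDerivAt (fun r => Real.log r / L - 3) (r⁻¹ / L) r :=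
      ((Real.hasDerivAt_log hr.ne').div_const L).sub_const 3
    have h2 := ((hh.differentiable one_ne_zero) (Real.log r / L - 3)).hasDerivAt.comp r h1
    refine h2.congr_deriv ?_
    field_simp
  have hdρ : ∀ r, HasDerivAt ρ (deriv ρ r) r := fun r => (hρ.differentiable one_ne_zero r).hasDerivAt
  have hdf : ∀ r, 0 < r → deriv f r = v r * (deriv h (Real.log r / L - 3) / (L * r))
      - ((m : ℝ) + 1) / 2 * v r * deriv ρ r / ρ r * g r := by
    intro r hr
    rw [(hfev r hr).deriv_eq]
    have hp := hρpos r hr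
    have h1 : HasDerivAt v _ r := (hdρ r).rpow_const (Or.inl hp.ne')
    have h2 : HasDerivAt (fun r => v r * g r) _ r := h1.mul (hdg r hr)
    rw [h2.deriv]
    rw [Real.rpow_sub_one hp.ne']
    simp only [hv]
    field_simp
    ring
  refine ⟨f, hfc.lipschitzWith_of_hasCompactSupport hcs one_ne_zero, hcs,
    hts.trans (fun r hr => lt_of_lt_of_le hαR hr.1), ?_⟩
  set F : ℝ → ℝ := fun r => ((deriv f r) ^ 2 * (ρ r) ^ (m + 2)
        + A * (deriv ρ r) ^ 2 * (ρ r) ^ m * (f r) ^ 2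
        + 4 * a * ((m : ℝ) + 2) * (deriv ρ r) * (ρ r) ^ (m + 1) * (f r) * (deriv f r)
        + A * (ρ r) ^ m * (f r) ^ 2) with hF
  change ∫ r in Set.Ioi (0 : ℝ), F r < 0
  have hFc : Continuous F := by
    have := hfc.continuous
    have := hfc.continuous_deriv le_rfl
    have := hρ.continuous
    have := hρ.continuous_deriv le_rfl
    fun_prop
  have hFz : ∀ r, r ∉ Icc α β → F r = 0 := by
    intro r hr
    have h1 : f r = 0 := hfz r hr
    have h2 : deriv f r = 0 := by
      by_contra hne
      exact hr (hts (support_deriv_subset hne))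
    simp [hF, h1, h2]
  have hint : ∫ r in Set.Ioi (0 : ℝ), F r = ∫ r in α..β, F r := by
    rw [intervalIntegral.integral_of_le hαβ, ← integral_Icc_eq_integral_Ioc]
    apply setIntegral_eq_of_subset_of_forall_sdiff_eq_zero measurableSet_Ioi
    · intro r hr
      have := hr.1
      simp only [mem_Ioi]; linarith
    · intro r hr; exact hFz r hr.2
  rw [hint]
  set Φ : ℝ → ℝ := fun r => -2 * c * (g r ^ 2 * (Real.log (ρ r) - Real.log r))
    + (B1 / L ^ 2 + B2 / L) * Real.log r - δ * (L * H (Real.log r / L - 3)) with hΦ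
  have hdΦ : ∀ r, 0 < r → HasDerivAt Φ
      (-2 * c * (2 * g r * (deriv h (Real.log r / L - 3) / (L * r)) * (Real.log (ρ r) - Real.log r)
          + g r ^ 2 * (deriv ρ r / ρ r - 1 / r))
        + (B1 / L ^ 2 + B2 / L) * (1 / r) - δ * (g r ^ 2 * (1 / r))) r := by
    intro r hr
    have h1 : HasDerivAt (fun r => Real.log r / L - 3) (r⁻¹ / L) r :=
      ((Real.hasDerivAt_log hr.ne').div_const L).sub_const 3
    have h2 := (hH (Real.log r / L - 3)).comp r h1
    have h3 := (hdρ r).log (hρpos r hr).ne'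
    have h4 := Real.hasDerivAt_log hr.ne'
    have h5 := (((hdg r hr).pow 2).mul (h3.sub h4)).const_mul (-2 * c)
    have h6 := (h5.add (h4.const_mul (B1 / L ^ 2 + B2 / L))).sub ((h2.const_mul L).const_mul δ)
    refine h6.congr_deriv ?_
    simp only [hg, Pi.sub_apply, Pi.pow_apply, Nat.cast_ofNat, Nat.reduceSub, pow_one]
    field_simp
  have hle : ∫ r in α..β, F r ≤ Φ β - Φ α := by
    apply intervalIntegral.integral_le_sub_of_hasDeriv_right_of_le hαβ
      (g' := fun r => (-2 * c * (2 * g r * (deriv h (Real.log r / L - 3) / (L * r)) * (Real.log (ρ r) - Real.log r)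
          + g r ^ 2 * (deriv ρ r / ρ r - 1 / r))
        + (B1 / L ^ 2 + B2 / L) * (1 / r) - δ * (g r ^ 2 * (1 / r))))
    · intro r hr
      exact (hdΦ r (by linarith [hr.1])).continuousAt.continuousWithinAt
    · intro r hr
      exact (hdΦ r (by linarith [hr.1])).hasDerivWithinAt
    · exact hFc.integrableOn_Icc
    · intro r hr
      have hr1 : 1 ≤ r := by linarith [hr.1]
      have hr0 : 0 < r := by linarith
      have hp := hρpos r hr0
      obtain ⟨hb1, hb2⟩ := hbound r hr1
      have hC₂p : 0 < C₂ := by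
        by_contra hneg
        push Not at hneg
        have := mul_nonpos_of_nonpos_of_nonneg hneg hr0.le
        linarith
      have hvv : v r ^ 2 * ρ r ^ (m + 1) = 1 := by
        simp only [hv]
        rw [← Real.rpow_natCast, ← Real.rpow_natCast, ← Real.rpow_mul hp.le, ← Real.rpow_add hp]
        rw [show -(((m : ℝ) + 1) / 2) * ((2 : ℕ) : ℝ) + ((m + 1 : ℕ) : ℝ) = 0 by push_cast; ring]
        exact Real.rpow_zero _
      have hfr : f r = v r * g r := by simp [hf, hr0]
      have hu0 : 0 ≤ Real.log (ρ r) - Real.log r := by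
        have := Real.log_le_log hr0 (show r ≤ ρ r by nlinarith)
        linarith
      have huU : Real.log (ρ r) - Real.log r ≤ U := by
        have := Real.log_le_log hp hb2
        rw [Real.log_mul hC₂p.ne' hr0.ne'] at this
        linarith
      have e1 := alg_est m (ρ r) (deriv ρ r) (v r) (g r)
        (deriv h (Real.log r / L - 3) / (L * r)) a hp hvv
      rw [← hdf r hr0, ← hfr] at e1
      have e2 := pointwise_est (ρ r) (deriv ρ r) r (g r) (deriv h (Real.log r / L - 3))
        (Real.log (ρ r) - Real.log r) k ε D A C₁ C₂ B U L hb1 hb2 hr0 hL hC₁p hApos hε hDε0 hB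
        (hh0 _) (hh1 _) (hhB _) hu0 huU
      exact (le_of_eq e1).trans e2
  have hΦv : Φ β - Φ α = 4 * (B1 / L + B2) - δ * L * η := by
    have g1 : g α = 0 := hgα α (by linarith) le_rfl
    have g2 : g β = 0 := hgβ β le_rfl
    have l1 : Real.log α = L := Real.log_exp _
    have l2 : Real.log β = 5 * L := Real.log_exp _
    simp only [hΦ, g1, g2, l1, l2]
    rw [show 5 * L / L - 3 = 2 by field_simp; norm_num, show L / L - 3 = -2 by field_simp; norm_num,
      ← hHη]
    field_simp
    ring
  linarith

/-- Radial formulation: if `C₁ r ≤ ρ(r) ≤ C₂ r` for `r ≥ 1` with `C₁ > 1`, the ends of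
the warped product `I ×_ρ 𝕊^{n-1}` are `a`-unstable for all
`a > (n-2)/(4(n-1)(1-C₁⁻²))`. -/
theorem stmt_13 (n : ℕ) (hn : 3 ≤ n) (C₁ C₂ : ℝ) (hC₁ : 1 < C₁) (hC : C₁ ≤ C₂)
    (ρ : ℝ → ℝ) (hρ : ContDiff ℝ 1 ρ) (hρpos : ∀ r > (0 : ℝ), 0 < ρ r)
    (hbound : ∀ r ≥ (1 : ℝ), C₁ * r ≤ ρ r ∧ ρ r ≤ C₂ * r)
    (a : ℝ) (ha : ((n : ℝ) - 2) / (4 * ((n : ℝ) - 1) * (1 - (C₁)⁻¹ ^ 2)) < a)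
    (R₀ : ℝ) (hR₀ : 0 < R₀) :
    ∃ f : ℝ → ℝ, (∃ K, LipschitzWith K f) ∧ HasCompactSupport f ∧
      tsupport f ⊆ Set.Ioi R₀ ∧
      (∫ r in Set.Ioi (0 : ℝ), ((deriv f r) ^ 2 * (ρ r) ^ (n - 1)
        + a * ((n : ℝ) - 1) * ((n : ℝ) - 2) * (deriv ρ r) ^ 2 * (ρ r) ^ (n - 3) * (f r) ^ 2
        + 4 * a * ((n : ℝ) - 1) * (deriv ρ r) * (ρ r) ^ (n - 2) * (f r) * (deriv f r)
        + a * ((n : ℝ) - 1) * ((n : ℝ) - 2) * (ρ r) ^ (n - 3) * (f r) ^ 2)) < 0 := by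
  obtain ⟨m, rfl⟩ : ∃ m, n = m + 3 := ⟨n - 3, by omega⟩
  have e1 : ((m + 3 : ℕ) : ℝ) - 1 = (m : ℝ) + 2 := by push_cast; ring
  have e2 : ((m + 3 : ℕ) : ℝ) - 2 = (m : ℝ) + 1 := by push_cast; ring
  rw [e1, e2] at ha ⊢
  rw [show m + 3 - 1 = m + 2 by omega, show m + 3 - 2 = m + 1 by omega,
    show m + 3 - 3 = m by omega]
  exact main_aux m C₁ C₂ hC₁ ρ hρ hρpos hbound a ha R₀ hR₀
end
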